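/- Let p₁, …, p_k be rationally independent integer polynomials with p_i(0) = 0 for i = 1, …, k. For every δ > 0 and ε > 0 there exists N(ε, δ) such that for all N > N(ε, δ), every subset Λ ⊂ {1, …, N} with |Λ| ≥ δN contains at least (1 − ε)δ^{k+1}N configurations of the form {x, x + p₁(n), …, x + p_k(n)} for some fixed n ≥ 1; that is, there exists n ≥ 1 such that the number of x with x ∈ Λ and x + p_i(n) ∈ Λ for all i = 1, …, k is at least (1 − ε)δ^{k+1}N. -/

import Mathlib

open MeasureTheory Filter Finset

/-- An integer polynomial: a function `ℤ → ℤ` given by a polynomial (with rational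
coefficients) taking integer values on the integers. -/
def IsIntPoly (p : ℤ → ℤ) : Prop :=
  ∃ q : Polynomial ℚ, ∀ n : ℤ, q.eval (n : ℚ) = (p n : ℚ)

/-- Rational independence: every nontrivial integer linear combination is nonconstant. -/
def RatIndep {k : ℕ} (p : Fin k → ℤ → ℤ) : Prop :=
  ∀ c : Fin k → ℤ, c ≠ 0 → ¬ ∃ C : ℤ, ∀ n : ℤ, (∑ i, c i * p i n) = C

namespace PolyConfig

/-- The average of `φ` over `{0, …, H - 1}`. -/
noncomputable def av (H : ℕ) (φ : ℕ → ℝ) : ℝ := (∑ h ∈ range H, φ h) / H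

theorem av_mono {H : ℕ} {φ ψ : ℕ → ℝ} (h : ∀ i < H, φ i ≤ ψ i) : av H φ ≤ av H ψ := by
  unfold av
  gcongr with i hi
  exact h i (mem_range.1 hi)

theorem av_nonneg {H : ℕ} {φ : ℕ → ℝ} (h : ∀ i, 0 ≤ φ i) : 0 ≤ av H φ :=
  div_nonneg (sum_nonneg fun i _ => h i) (Nat.cast_nonneg _)

theorem av_mul_left (H : ℕ) (c : ℝ) (φ : ℕ → ℝ) : av H (fun h => c * φ h) = c * av H φ := by
  unfold av
  rw [← mul_sum, mul_div_assoc]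

theorem av_add (H : ℕ) (φ ψ : ℕ → ℝ) : av H (fun h => φ h + ψ h) = av H φ + av H ψ := by
  unfold av
  rw [sum_add_distrib, add_div]

theorem av_sum {ι : Type*} (s : Finset ι) (H : ℕ) (φ : ι → ℕ → ℝ) :
    av H (fun h => ∑ i ∈ s, φ i h) = ∑ i ∈ s, av H (φ i) := by
  unfold av
  rw [sum_comm, sum_div]

theorem av_const {H : ℕ} (hH : 0 < H) (c : ℝ) : av H (fun _ => c) = c := by
  unfold av
  simp
  field_simp

theorem av_comm (H K : ℕ) (φ : ℕ → ℕ → ℝ) :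
    av H (fun h => av K fun k => φ h k) = av K fun k => av H fun h => φ h k := by
  unfold av
  simp_rw [← sum_div]
  rw [sum_comm, div_div, div_div, mul_comm]

theorem av_pow_le (H : ℕ) {φ : ℕ → ℝ} (h : ∀ i, 0 ≤ φ i) (n : ℕ) :
    (av H φ) ^ (n + 1) ≤ av H fun i => φ i ^ (n + 1) := by
  rcases Nat.eq_zero_or_pos H with rfl | hH
  · simp [av]
  have hH' : (0 : ℝ) < H := by exact_mod_cast hH
  unfold av
  have := Real.pow_arith_mean_le_arith_mean_pow (range H) (fun _ => (H : ℝ)⁻¹) φ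
    (fun _ _ => by positivity) (by simp [hH'.ne']) (fun i _ => h i) (n + 1)
  simpa [← mul_sum, div_eq_inv_mul] using this

theorem exists_le_of_le_av {H : ℕ} {φ : ℕ → ℝ} {c : ℝ} (hc : 0 < c) (h : c ≤ av H φ) :
    ∃ i < H, c ≤ φ i := by
  by_contra! hcon
  rcases Nat.eq_zero_or_pos H with rfl | hH
  · simp [av] at h
    linarith
  · have : av H φ < c := by
      unfold av
      rw [div_lt_iff₀ (by exact_mod_cast hH)]
      calc ∑ i ∈ range H, φ i < ∑ i ∈ range H, c :=
            sum_lt_sum_of_nonempty (by simpa using hH.ne') fun i hi => hcon i (mem_range.1 hi)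
        _ = c * H := by simp [mul_comm]
    linarith

/-- Iterated averages over boxes whose side lengths are listed. -/
noncomputable def Avg : List ℕ → (List ℕ → ℝ) → ℝ
  | [], φ => φ []
  | H :: l, φ => av H fun h => Avg l fun k => φ (h :: k)

/-- Iterated averages over squares of boxes. -/
noncomputable def Avg2 : List ℕ → (List ℕ → List ℕ → ℝ) → ℝ
  | [], φ => φ [] []
  | H :: l, φ => av H fun h => av H fun h' => Avg2 l fun k k' => φ (h :: k) (h' :: k')

theorem Avg_mono {l : List ℕ} {φ ψ : List ℕ → ℝ}
    (h : ∀ k, k.length = l.length → φ k ≤ ψ k) : Avg l φ ≤ Avg l ψ := by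
  induction l generalizing φ ψ with
  | nil => exact h [] rfl
  | cons H l ih => exact av_mono fun i _ => ih fun k hk => h _ (by simp [hk])

theorem Avg2_mono {l : List ℕ} {φ ψ : List ℕ → List ℕ → ℝ}
    (h : ∀ k k', k.length = l.length → k'.length = l.length → φ k k' ≤ ψ k k') :
    Avg2 l φ ≤ Avg2 l ψ := by
  induction l generalizing φ ψ with
  | nil => exact h [] [] rfl rfl
  | cons H l ih =>
    exact av_mono fun i _ => av_mono fun j _ => ih fun k k' hk hk' =>
      h _ _ (by simp [hk]) (by simp [hk'])

theorem Avg_nonneg {l : List ℕ} {φ : List ℕ → ℝ} (h : ∀ k, 0 ≤ φ k) : 0 ≤ Avg l φ := by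
  induction l generalizing φ with
  | nil => exact h []
  | cons H l ih => exact av_nonneg fun i => ih fun k => h _

theorem Avg2_nonneg {l : List ℕ} {φ : List ℕ → List ℕ → ℝ} (h : ∀ k k', 0 ≤ φ k k') :
    0 ≤ Avg2 l φ := by
  induction l generalizing φ with
  | nil => exact h [] []
  | cons H l ih => exact av_nonneg fun i => av_nonneg fun j => ih fun k k' => h _ _

theorem Avg_mul_left (l : List ℕ) (c : ℝ) (φ : List ℕ → ℝ) :
    Avg l (fun k => c * φ k) = c * Avg l φ := by
  induction l generalizing φ with
  | nil => rfl
  | cons H l ih => simp only [Avg, ih, av_mul_left]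

theorem Avg2_mul_left (l : List ℕ) (c : ℝ) (φ : List ℕ → List ℕ → ℝ) :
    Avg2 l (fun k k' => c * φ k k') = c * Avg2 l φ := by
  induction l generalizing φ with
  | nil => rfl
  | cons H l ih => simp only [Avg2, ih, av_mul_left]

theorem Avg2_add (l : List ℕ) (φ ψ : List ℕ → List ℕ → ℝ) :
    Avg2 l (fun k k' => φ k k' + ψ k k') = Avg2 l φ + Avg2 l ψ := by
  induction l generalizing φ ψ with
  | nil => rfl
  | cons H l ih => simp only [Avg2, ih, av_add]

theorem Avg2_sum {ι : Type*} (s : Finset ι) (l : List ℕ) (φ : ι → List ℕ → List ℕ → ℝ) :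
    Avg2 l (fun k k' => ∑ i ∈ s, φ i k k') = ∑ i ∈ s, Avg2 l (φ i) := by
  induction l generalizing φ with
  | nil => rfl
  | cons H l ih => simp only [Avg2, ih, av_sum]

theorem Avg2_const {l : List ℕ} (hl : ∀ H ∈ l, 0 < H) (c : ℝ) : Avg2 l (fun _ _ => c) = c := by
  induction l with
  | nil => rfl
  | cons H l ih =>
    simp only [List.mem_cons, forall_eq_or_imp] at hl
    simp only [Avg2, ih hl.2, av_const hl.1]

theorem av_Avg_comm (H : ℕ) (l : List ℕ) (φ : ℕ → List ℕ → ℝ) :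
    av H (fun h => Avg l (φ h)) = Avg l fun k => av H fun h => φ h k := by
  induction l generalizing φ with
  | nil => rfl
  | cons K l ih =>
    simp only [Avg]
    rw [av_comm]
    simp only [ih]

theorem Avg2_eq (l : List ℕ) (φ : List ℕ → List ℕ → ℝ) :
    Avg2 l φ = Avg l fun k' => Avg l fun k => φ k k' := by
  induction l generalizing φ with
  | nil => rfl
  | cons H l ih =>
    simp only [Avg, Avg2, ih]
    rw [av_comm]
    congr 1
    funext h'
    simp only [av_Avg_comm]

theorem Avg_pow_le (l : List ℕ) {φ : List ℕ → ℝ} (h : ∀ k, 0 ≤ φ k) (n : ℕ) :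
    (Avg l φ) ^ (n + 1) ≤ Avg l fun k => φ k ^ (n + 1) := by
  induction l generalizing φ with
  | nil => exact le_rfl
  | cons H l ih =>
    exact (av_pow_le H (fun i => Avg_nonneg fun k => h _) n).trans
      (av_mono fun i _ => ih fun k => h _)

theorem exists_le_of_le_Avg {l : List ℕ} {φ : List ℕ → ℝ} {c : ℝ} (hc : 0 < c)
    (h : c ≤ Avg l φ) : ∃ k, k.length = l.length ∧ c ≤ φ k := by
  induction l generalizing φ with
  | nil => exact ⟨[], rfl, h⟩
  | cons H l ih =>
    obtain ⟨i, -, hi⟩ := exists_le_of_le_av hc h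
    obtain ⟨k, hk, hk'⟩ := ih hi
    exact ⟨i :: k, by simp [hk], hk'⟩

theorem Avg2_eventually {α : Type*} {F : Filter α} {l : List ℕ}
    {φ : α → List ℕ → List ℕ → ℝ} {ψ : List ℕ → List ℕ → ℝ}
    (h : ∀ k k', ∀ᶠ i in F, φ i k k' ≤ ψ k k') : ∀ᶠ i in F, Avg2 l (φ i) ≤ Avg2 l ψ := by
  induction l generalizing φ ψ with
  | nil => exact h [] []
  | cons H l ih =>
    have : ∀ᶠ i in F, ∀ a ∈ range H, ∀ b ∈ range H,
        Avg2 l (fun k k' => φ i (a :: k) (b :: k')) ≤ Avg2 l fun k k' => ψ (a :: k) (b :: k') := by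
      rw [eventually_all_finset]
      intro a _
      rw [eventually_all_finset]
      intro b _
      exact ih fun k k' => h _ _
    filter_upwards [this] with i hi
    exact av_mono fun a ha => av_mono fun b hb => hi a (mem_range.2 ha) b (mem_range.2 hb)

/-- A function with values in `[0, 1]` and large average is often large. -/
theorem Avg2_indicator {l : List ℕ} (hl : ∀ H ∈ l, 0 < H) {φ : List ℕ → List ℕ → ℝ} {c : ℝ}
    (hc : 0 ≤ c) (h1 : ∀ k k', φ k k' ≤ 1) (h : c ≤ Avg2 l φ)
    {p : List ℕ → List ℕ → Prop} [∀ k k', Decidable (p k k')]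
    (hp : ∀ k k', k.length = l.length → k'.length = l.length → c / 2 ≤ φ k k' → p k k') :
    c / 2 ≤ Avg2 l fun k k' => if p k k' then 1 else 0 := by
  have : Avg2 l φ ≤ Avg2 l (fun k k' => (if p k k' then 1 else 0) + c / 2) := by
    refine Avg2_mono fun k k' hk hk' => ?_
    split_ifs with hpk
    · linarith [h1 k k']
    · have := mt (hp k k' hk hk') hpk
      linarith
  rw [Avg2_add, Avg2_const hl] at this
  linarith

end PolyConfig

namespace PolyConfig

/-- A commutative algebra of functions with its unit ball, conjugation and integral. -/
structure PreSys (A : Type*) [CommRing A] [Algebra ℂ A] where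
  /-- the unit ball for the supremum norm -/
  B : Set A
  /-- complex conjugation -/
  conj : A →+* A
  /-- the integral -/
  m : A →ₗ[ℂ] ℂ
  conj_conj : ∀ a, conj (conj a) = a
  conj_smul : ∀ (c : ℂ) a, conj (c • a) = star c • conj a
  one_mem : 1 ∈ B
  mul_mem : ∀ {a b}, a ∈ B → b ∈ B → a * b ∈ B
  conj_mem : ∀ {a}, a ∈ B → conj a ∈ B
  avg_mem : ∀ (H : ℕ) (c : ℕ → ℂ) (a : ℕ → A), (∀ h, ‖c h‖ ≤ 1) → (∀ h, a h ∈ B) →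
    (H : ℂ)⁻¹ • ∑ h ∈ range H, c h • a h ∈ B
  norm_m_le : ∀ {a}, a ∈ B → ‖m a‖ ≤ 1
  cs : ∀ {g a}, g ∈ B → a ∈ B → ‖m (g * a)‖ ^ 2 ≤ (m (a * conj a)).re

theorem exists_phase (z : ℂ) : ∃ θ : ℂ, ‖θ‖ ≤ 1 ∧ θ * z = (‖z‖ : ℂ) := by
  refine ⟨star z / ‖z‖, ?_, ?_⟩
  · rw [norm_div, norm_star, Complex.norm_real, norm_norm]
    exact div_self_le_one _
  · rcases eq_or_ne z 0 with rfl | hz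
    · simp
    · have : (‖z‖ : ℂ) ≠ 0 := by simpa using hz
      field_simp
      rw [mul_comm]
      exact Complex.mul_conj' z

namespace PreSys

variable {A : Type*} [CommRing A] [Algebra ℂ A] (S : PreSys A)

theorem smul_mem {c : ℂ} {a : A} (hc : ‖c‖ ≤ 1) (ha : a ∈ S.B) : c • a ∈ S.B := by
  simpa using S.avg_mem 1 (fun _ => c) (fun _ => a) (fun _ => hc) (fun _ => ha)

theorem prod_mem {ι : Type*} (s : Finset ι) (f : ι → A) (h : ∀ i ∈ s, f i ∈ S.B) :
    ∏ i ∈ s, f i ∈ S.B :=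
  Finset.prod_induction f (· ∈ S.B) (fun _ _ ha hb => S.mul_mem ha hb) S.one_mem h

theorem re_avg_le (H : ℕ) (c : ℕ → ℂ) (a : ℕ → A) (hc : ∀ h, ‖c h‖ ≤ 1) :
    (S.m (((H : ℂ)⁻¹ • ∑ h ∈ range H, c h • a h) *
      S.conj ((H : ℂ)⁻¹ • ∑ h ∈ range H, c h • a h))).re ≤
      av H fun h => av H fun h' => ‖S.m (a h * S.conj (a h'))‖ := by
  have : S.m (((H : ℂ)⁻¹ • ∑ h ∈ range H, c h • a h) *
      S.conj ((H : ℂ)⁻¹ • ∑ h ∈ range H, c h • a h)) =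
      ∑ h ∈ range H, ∑ h' ∈ range H,
        ((H : ℂ)⁻¹ * c h * ((H : ℂ)⁻¹ * star (c h'))) * S.m (a h * S.conj (a h')) := by
    rw [S.conj_smul, smul_mul_smul_comm, map_smul, map_sum, sum_mul_sum]
    simp only [map_sum, S.conj_smul, smul_mul_smul_comm, map_smul, smul_eq_mul, mul_sum]
    refine sum_congr rfl fun i _ => sum_congr rfl fun j _ => ?_
    simp
    ring
  rw [this]
  refine (Complex.re_le_norm _).trans ((norm_sum_le _ _).trans ?_)
  unfold av
  rw [sum_div]
  refine sum_le_sum fun i _ => (norm_sum_le _ _).trans ?_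
  rw [sum_div, sum_div]
  refine sum_le_sum fun j _ => ?_
  simp only [norm_mul, norm_inv, norm_star, Complex.norm_natCast]
  have h1 := hc i
  have h2 := hc j
  have : ‖c i‖ * ‖c j‖ ≤ 1 := mul_le_one₀ h1 (norm_nonneg _) h2
  calc (H : ℝ)⁻¹ * ‖c i‖ * ((H : ℝ)⁻¹ * ‖c j‖) * ‖S.m (a i * S.conj (a j))‖
      = (‖c i‖ * ‖c j‖) * ((H : ℝ)⁻¹ * (H : ℝ)⁻¹ * ‖S.m (a i * S.conj (a j))‖) := by ring
    _ ≤ 1 * ((H : ℝ)⁻¹ * (H : ℝ)⁻¹ * ‖S.m (a i * S.conj (a j))‖) := by gcongr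
    _ = _ := by rw [div_div]; field_simp

theorem av_norm_sq_le (H : ℕ) (a : ℕ → A) (b : A) (ha : ∀ h, a h ∈ S.B) (hb : b ∈ S.B) :
    (av H fun h => ‖S.m (b * a h)‖) ^ 2 ≤
      av H fun h => av H fun h' => ‖S.m (a h * S.conj (a h'))‖ := by
  choose θ hθ hθ' using fun h => exists_phase (S.m (b * a h))
  have h1 := S.cs hb (S.avg_mem H θ a hθ ha)
  refine le_trans (le_of_eq ?_) (h1.trans (S.re_avg_le H θ a hθ))
  congr 1
  have : S.m (b * ((H : ℂ)⁻¹ • ∑ h ∈ range H, θ h • a h)) =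
      ((av H fun h => ‖S.m (b * a h)‖ : ℝ) : ℂ) := by
    simp only [mul_smul_comm, mul_sum, map_smul, map_sum, smul_eq_mul, hθ', av]
    push_cast
    rw [div_eq_inv_mul, mul_sum]
  rw [this, Complex.norm_real, Real.norm_of_nonneg (av_nonneg fun _ => norm_nonneg _)]

end PreSys

section Cube

variable {A : Type*} [CommRing A]

/-- The product of the (conjugated) values of `u` over the vertices of a cube. -/
def cube (σ : A →+* A) : (List ℕ → A) → List ℕ → List ℕ → A
  | u, h :: k, h' :: k' => cube σ (fun j => u (h :: j) * σ (u (h' :: j))) k k'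
  | u, [], _ => u []
  | u, _ :: _, [] => u []

/-- Functions that are products of functions not depending on all of their arguments. -/
def Dec (B : Set A) : ℕ → (List ℕ → A) → Prop
  | 0, g => g [] = 1
  | t + 1, g => ∃ (G : List ℕ → A) (g' : ℕ → List ℕ → A), (∀ k, G k ∈ B) ∧
      (∀ h k, g (h :: k) = G k * g' h k) ∧ ∀ h, Dec B t (g' h)

end Cube

namespace PreSys

variable {A : Type*} [CommRing A] [Algebra ℂ A] (S : PreSys A)

variable {S} in
theorem Dec.mul {t : ℕ} {g g' : List ℕ → A} (hg : Dec S.B t g) (hg' : Dec S.B t g') :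
    Dec S.B t fun k => g k * g' k := by
  induction t generalizing g g' with
  | zero =>
    simp only [Dec] at *
    simp [hg, hg']
  | succ t ih =>
    obtain ⟨G, g1, hG, h1, h2⟩ := hg
    obtain ⟨G', g1', hG', h1', h2'⟩ := hg'
    exact ⟨fun k => G k * G' k, fun h k => g1 h k * g1' h k, fun k => S.mul_mem (hG k) (hG' k),
      fun h k => by simp only [h1, h1']; ring, fun h => ih (h2 h) (h2' h)⟩

variable {S} in
theorem Dec.conj {t : ℕ} {g : List ℕ → A} (hg : Dec S.B t g) :
    Dec S.B t fun k => S.conj (g k) := by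
  induction t generalizing g with
  | zero =>
    simp only [Dec] at *
    simp [hg]
  | succ t ih =>
    obtain ⟨G, g1, hG, h1, h2⟩ := hg
    exact ⟨fun k => S.conj (G k), fun h k => S.conj (g1 h k), fun k => S.conj_mem (hG k),
      fun h k => by simp only [h1, map_mul], fun h => ih (h2 h)⟩

variable {S} in
theorem Dec.const_mul {t : ℕ} {g : List ℕ → A} (hg : Dec S.B (t + 1) g) {b : A} (hb : b ∈ S.B) :
    Dec S.B (t + 1) fun k => b * g k := by
  obtain ⟨G, g1, hG, h1, h2⟩ := hg
  exact ⟨fun k => b * G k, g1, fun k => S.mul_mem hb (hG k),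
      fun h k => by simp only [h1]; ring, h2⟩

variable {S} in
theorem Dec.mem {t : ℕ} {g : List ℕ → A} (hg : Dec S.B t g) {k : List ℕ} (hk : k.length = t) :
    g k ∈ S.B := by
  induction t generalizing g k with
  | zero =>
    rw [List.length_eq_zero_iff] at hk
    subst hk
    rw [show g [] = 1 from hg]
    exact S.one_mem
  | succ t ih =>
    obtain ⟨G, g1, hG, h1, h2⟩ := hg
    obtain _ | ⟨h, k⟩ := k
    · simp at hk
    · rw [h1]
      exact S.mul_mem (hG _) (ih (h2 h) (by simpa using hk))

theorem cube_mem {u : List ℕ → A} (hu : ∀ k, u k ∈ S.B) (k k' : List ℕ) :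
    cube S.conj u k k' ∈ S.B := by
  induction k generalizing u k' with
  | nil => exact hu _
  | cons h k ih =>
    cases k' with
    | nil => exact hu _
    | cons h' k' => exact ih (fun j => S.mul_mem (hu _) (S.conj_mem (hu _))) k'

theorem cube_mul (u v : List ℕ → A) (k k' : List ℕ) :
    cube S.conj (fun j => u j * v j) k k' = cube S.conj u k k' * cube S.conj v k k' := by
  induction k generalizing u v k' with
  | nil => rfl
  | cons h k ih =>
    cases k' with
    | nil => rfl
    | cons h' k' =>
      simp only [cube, ← ih]
      congr 1
      funext j
      rw [map_mul]
      ring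

/-- The cube is its vertex `k` times a decomposable function. -/
theorem cube_eq_mul_dec {u : List ℕ → A} (hu : ∀ k, u k ∈ S.B) (k' : List ℕ) :
    ∃ g, Dec S.B k'.length g ∧ ∀ k, k.length = k'.length → cube S.conj u k k' = u k * g k := by
  induction k' generalizing u with
  | nil =>
    refine ⟨fun _ => 1, rfl, fun k hk => ?_⟩
    simp only [List.length_nil, List.length_eq_zero_iff] at hk
    subst hk
    simp [cube]
  | cons h' k' ih =>
    choose g hg hg' using fun h : ℕ => ih (u := fun j => u (h :: j) * S.conj (u (h' :: j)))
      (fun j => S.mul_mem (hu _) (S.conj_mem (hu _)))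
    refine ⟨fun k => S.conj (u (h' :: k.tail)) * g (k.headD 0) k.tail,
      ⟨fun k => S.conj (u (h' :: k)), g, fun k => S.conj_mem (hu _), fun h k => rfl, hg⟩, ?_⟩
    intro k hk
    cases k with
    | nil => simp at hk
    | cons h k =>
      simp only [cube, List.tail_cons, List.headD_cons]
      rw [hg' h k (by simpa using hk)]
      ring

theorem av_Avg_pow_le (H : ℕ) (l : List ℕ) (φ : ℕ → ℕ → List ℕ → ℝ) (h0 : ∀ i j k, 0 ≤ φ i j k)
    (n : ℕ) : (av H fun h => av H fun h' => Avg l (φ h h')) ^ (n + 1) ≤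
      av H fun h => av H fun h' => (Avg l (φ h h')) ^ (n + 1) :=
  (av_pow_le H (fun _ => av_nonneg fun _ => Avg_nonneg (h0 _ _)) n).trans
    (av_mono fun _ _ => av_pow_le H (fun _ => Avg_nonneg (h0 _ _)) n)

/-- The Cauchy–Schwarz–Gowers inequality for box norms. -/
theorem box_le (l : List ℕ) {u g : List ℕ → A} (hu : ∀ k, u k ∈ S.B)
    (hg : Dec S.B l.length g) :
    (Avg l fun k => ‖S.m (u k * g k)‖) ^ (2 ^ l.length) ≤
      Avg2 l fun k k' => ‖S.m (cube S.conj u k k')‖ := by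
  induction l generalizing u g with
  | nil =>
    have : g [] = 1 := hg
    simp [Avg, Avg2, cube, this]
  | cons H l ih =>
    obtain ⟨G, g', hG, hg1, hg2⟩ := hg
    have hpos : (2 ^ l.length) = 2 ^ l.length - 1 + 1 :=
      (Nat.sub_add_cancel Nat.one_le_two_pow).symm
    have key : (Avg (H :: l) fun k => ‖S.m (u k * g k)‖) ^ 2 ≤
        av H fun h => av H fun h' => Avg l fun k =>
          ‖S.m ((u (h :: k) * S.conj (u (h' :: k))) * (g' h k * S.conj (g' h' k)))‖ := by
      calc (Avg (H :: l) fun k => ‖S.m (u k * g k)‖) ^ 2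
          = (Avg l fun k => av H fun h => ‖S.m (G k * (u (h :: k) * g' h k))‖) ^ 2 := by
            rw [← av_Avg_comm]
            simp only [Avg, hg1]
            congr! 6 with h k
            ring_nf
        _ ≤ Avg l fun k => (av H fun h => ‖S.m (G k * (u (h :: k) * g' h k))‖) ^ 2 :=
            Avg_pow_le l (fun k => av_nonneg fun h => norm_nonneg _) 1
        _ ≤ Avg l fun k => av H fun h => av H fun h' =>
            ‖S.m ((u (h :: k) * g' h k) * S.conj (u (h' :: k) * g' h' k))‖ := by
            refine Avg_mono fun k hk => S.av_norm_sq_le H _ _ (fun h => ?_) (hG k)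
            exact S.mul_mem (hu _) (Dec.mem (hg2 h) hk)
        _ = _ := by
            rw [← av_Avg_comm]
            simp only [← av_Avg_comm, map_mul]
            congr! 8
            ring_nf
    calc (Avg (H :: l) fun k => ‖S.m (u k * g k)‖) ^ (2 ^ (H :: l).length)
        = ((Avg (H :: l) fun k => ‖S.m (u k * g k)‖) ^ 2) ^ (2 ^ l.length) := by
          rw [List.length_cons, pow_succ', pow_mul]
      _ ≤ _ := by
          refine (pow_le_pow_left₀ (sq_nonneg _) key _).trans ?_
          rw [hpos]
          refine (av_Avg_pow_le H l _ (fun _ _ _ => norm_nonneg _) _).trans ?_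
          rw [← hpos]
          refine av_mono fun h _ => av_mono fun h' _ => ?_
          exact ih (fun k => S.mul_mem (hu _) (S.conj_mem (hu _)))
            (Dec.mul (hg2 h) (Dec.conj (hg2 h')))

end PreSys

end PolyConfig

namespace PolyConfig

/-- A shift-invariant mean on bounded sequences. -/
structure Mean where
  /-- the functional -/
  L : (ℕ → ℂ) →ₗ[ℂ] ℂ
  one : L (fun _ => 1) = 1
  norm_le : ∀ u : ℕ → ℂ, (∀ n, ‖u n‖ ≤ 1) → ‖L u‖ ≤ 1
  shift : ∀ u : ℕ → ℂ, (∀ n, ‖u n‖ ≤ 1) → L (fun n => u (n + 1)) = L u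
  cs : ∀ u v : ℕ → ℂ, (∀ n, ‖u n‖ ≤ 1) → (∀ n, ‖v n‖ ≤ 1) → (∀ n, ‖u n‖ ^ 2 ≤ (v n).re) →
    ‖L u‖ ^ 2 ≤ (L v).re

theorem Mean.shift_add (E : Mean) {u : ℕ → ℂ} (hu : ∀ n, ‖u n‖ ≤ 1) (h : ℕ) :
    E.L (fun n => u (n + h)) = E.L u := by
  induction h with
  | zero => rfl
  | succ h ih =>
    rw [← ih, ← E.shift (fun n => u (n + h)) (fun n => hu _)]
    congr 1
    funext n
    congr 1
    ring

theorem Mean.const (E : Mean) (c : ℂ) : E.L (fun _ => c) = c := by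
  have : (fun _ : ℕ => c) = c • fun _ => (1 : ℂ) := by
    funext
    simp
  rw [this, map_smul, E.one, smul_eq_mul, mul_one]

theorem Mean.const_mul (E : Mean) (c : ℂ) (u : ℕ → ℂ) :
    E.L (fun n => c * u n) = c * E.L u :=
  E.L.map_smul c u

namespace PreSys

variable {A : Type*} [CommRing A] [Algebra ℂ A] (S : PreSys A)

/-- Sequences of functions, integrated using a mean. -/
def seq (E : Mean) : PreSys (ℕ → A) where
  B := {a | ∀ n, a n ∈ S.B}
  conj := S.conj.compLeft ℕ
  m := E.L ∘ₗ S.m.compLeft ℕ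
  conj_conj a := funext fun n => S.conj_conj _
  conj_smul c a := funext fun n => S.conj_smul _ _
  one_mem _ := S.one_mem
  mul_mem ha hb n := S.mul_mem (ha n) (hb n)
  conj_mem ha n := S.conj_mem (ha n)
  avg_mem H c a hc ha n := by
    have := S.avg_mem H c (fun h => a h n) hc (fun h => ha h n)
    simpa using this
  norm_m_le ha := E.norm_le _ fun n => S.norm_m_le (ha n)
  cs hg ha := E.cs _ _ (fun n => S.norm_m_le (S.mul_mem (hg n) (ha n)))
    (fun n => S.norm_m_le (S.mul_mem (ha n) (S.conj_mem (ha n))))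
    (fun n => S.cs (hg n) (ha n))

theorem vdC (E : Mean) {f : A} {U : ℕ → A} (hf : f ∈ S.B) (hU : ∀ n, U n ∈ S.B) {H : ℕ}
    (hH : 0 < H) : ‖E.L fun n => S.m (f * U n)‖ ^ 2 ≤
      av H fun h => av H fun h' => ‖E.L fun n => S.m (U (n + h) * S.conj (U (n + h')))‖ := by
  have := (S.seq E).av_norm_sq_le H (fun h n => U (n + h)) (fun _ => f) (fun h n => hU _)
    (fun _ => hf)
  refine le_trans (le_of_eq ?_) this
  congr 1
  rw [← av_const hH (‖E.L fun n => S.m (f * U n)‖)]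
  congr 1
  funext h
  rw [← E.shift_add (fun n => S.norm_m_le (S.mul_mem hf (hU n))) h]
  rfl

end PreSys

/-- An invertible measure preserving system, seen through its algebra of functions. -/
structure Sys (A : Type*) [CommRing A] [Algebra ℂ A] extends PreSys A where
  /-- the powers of the Koopman operator -/
  τ : ℤ → A →ₐ[ℂ] A
  τ_zero : ∀ a, τ 0 a = a
  τ_add : ∀ i j a, τ (i + j) a = τ i (τ j a)
  τ_conj : ∀ i a, τ i (conj a) = conj (τ i a)
  τ_mem : ∀ i {a}, a ∈ B → τ i a ∈ B
  m_τ : ∀ i a, m (τ i a) = m a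
  m_conj : ∀ a, m (conj a) = star (m a)

namespace Sys

variable {A : Type*} [CommRing A] [Algebra ℂ A] (S : Sys A)

/-- The iterated differences of `f`. -/
def D (k l : List ℕ) (f : A) : A := cube S.conj (fun j => S.τ (j.sum : ℕ) f) k l

/-- Finitary Gowers–Host–Kra seminorms, with side lengths `l`. -/
noncomputable def V : List ℕ → A → ℝ
  | [], f => ‖S.m f‖
  | H :: l, f => av H fun h => av H fun i => V l (S.τ h f * S.conj (S.τ i f))

/-- The `t`-th seminorm of `f` is at least `c` at all scales. -/
def U (t : ℕ) (c : ℝ) (f : A) : Prop :=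
  ∀ l : List ℕ, l.length = t → (∀ H ∈ l, 0 < H) → c ≤ S.V l f

theorem D_cons (h h' : ℕ) (k k' : List ℕ) (f : A) :
    S.D (h :: k) (h' :: k') f = S.D k k' (S.τ h f * S.conj (S.τ h' f)) := by
  simp only [D, cube]
  congr 1
  funext j
  simp only [List.sum_cons, Nat.cast_add, map_mul, S.τ_conj, ← S.τ_add]
  rw [add_comm (h : ℤ), add_comm (h' : ℤ)]

theorem D_nil (k' : List ℕ) (f : A) : S.D [] k' f = f := by
  simp [D, cube, S.τ_zero]

theorem D_mem {f : A} (hf : f ∈ S.B) (k k' : List ℕ) : S.D k k' f ∈ S.B :=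
  S.cube_mem (fun _ => S.τ_mem _ hf) k k'

theorem D_mul (k k' : List ℕ) (f g : A) : S.D k k' (f * g) = S.D k k' f * S.D k k' g := by
  simp only [D, map_mul, S.cube_mul]

theorem D_one (k k' : List ℕ) : S.D k k' 1 = 1 := by
  induction k generalizing k' with
  | nil => exact S.D_nil _ _
  | cons h k ih =>
    cases k' with
    | nil => simp [D, cube]
    | cons h' k' => rw [D_cons]; simp [ih]

theorem D_prod {ι : Type*} (s : Finset ι) (k k' : List ℕ) (f : ι → A) :
    S.D k k' (∏ i ∈ s, f i) = ∏ i ∈ s, S.D k k' (f i) := by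
  classical
  induction s using Finset.induction_on with
  | empty => simp [D_one]
  | insert i s hi ih => rw [prod_insert hi, prod_insert hi, D_mul, ih]

theorem τ_comm (i j : ℤ) (f : A) : S.τ i (S.τ j f) = S.τ j (S.τ i f) := by
  rw [← S.τ_add, ← S.τ_add, add_comm]

theorem D_τ {k k' : List ℕ} (hk : k.length = k'.length) (i : ℤ) (f : A) :
    S.D k k' (S.τ i f) = S.τ i (S.D k k' f) := by
  induction k generalizing k' f with
  | nil => simp [D_nil]
  | cons h k ih =>
    cases k' with
    | nil => simp at hk
    | cons h' k' =>
      rw [D_cons, D_cons, ← ih (by simpa using hk), map_mul, S.τ_conj, S.τ_comm i h,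
        S.τ_comm i h']

theorem V_eq (l : List ℕ) (f : A) : S.V l f = Avg2 l fun k k' => ‖S.m (S.D k k' f)‖ := by
  induction l generalizing f with
  | nil => simp [V, Avg2, D_nil]
  | cons H l ih => simp only [V, Avg2, ih, D_cons]

theorem V_append (l : List ℕ) (K : ℕ) (f : A) :
    S.V (l ++ [K]) f = Avg2 l fun k k' => S.V [K] (S.D k k' f) := by
  induction l generalizing f with
  | nil => simp [Avg2, D_nil]
  | cons H l ih => rw [List.cons_append]; simp only [V, Avg2] at ih ⊢; simp only [ih, D_cons]

theorem V_nonneg (l : List ℕ) (f : A) : 0 ≤ S.V l f := by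
  rw [V_eq]
  exact Avg2_nonneg fun _ _ => norm_nonneg _

theorem V_le_one {l : List ℕ} (hl : ∀ H ∈ l, 0 < H) {f : A} (hf : f ∈ S.B) : S.V l f ≤ 1 := by
  rw [V_eq, ← Avg2_const hl 1]
  exact Avg2_mono fun k k' _ _ => S.norm_m_le (S.D_mem hf _ _)

theorem V_τ (l : List ℕ) (i : ℤ) (f : A) : S.V l (S.τ i f) = S.V l f := by
  induction l generalizing f with
  | nil => simp [V, S.m_τ]
  | cons H l ih =>
    simp only [V]
    simp only [fun h : ℕ => S.τ_comm h i, ← S.τ_conj, ← map_mul, ih]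

theorem V_conj (l : List ℕ) (f : A) : S.V l (S.conj f) = S.V l f := by
  induction l generalizing f with
  | nil => simp [V, S.m_conj]
  | cons H l ih =>
    simp only [V, S.τ_conj, ← map_mul, ih]

theorem U_τ {t : ℕ} {c : ℝ} {i : ℤ} {f : A} : S.U t c (S.τ i f) ↔ S.U t c f := by
  simp only [U, V_τ]

theorem U_conj {t : ℕ} {c : ℝ} {f : A} : S.U t c (S.conj f) ↔ S.U t c f := by
  simp only [U, V_conj]

theorem V_append_one_ge (l : List ℕ) {K : ℕ} (hK : 0 < K) {f : A} (hf : f ∈ S.B) :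
    S.V l f ^ 2 ≤ S.V (l ++ [K]) f := by
  rw [V_append, V_eq]
  have h1 : (Avg2 l fun k k' => ‖S.m (S.D k k' f)‖) ^ 2 ≤
      Avg2 l fun k k' => ‖S.m (S.D k k' f)‖ ^ 2 := by
    rw [Avg2_eq, Avg2_eq]
    exact (Avg_pow_le l (fun _ => Avg_nonneg fun _ => norm_nonneg _) 1).trans
      (Avg_mono fun _ _ => Avg_pow_le l (fun _ => norm_nonneg _) 1)
  refine h1.trans (Avg2_mono fun k k' _ _ => ?_)
  have := S.av_norm_sq_le K (fun h => S.τ h (S.D k k' f)) 1 (fun h => S.τ_mem _ (S.D_mem hf _ _))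
    S.one_mem
  simp only [one_mul, S.m_τ, av_const hK] at this
  exact this

theorem U_succ {t : ℕ} {c : ℝ} (hc : 0 ≤ c) {f : A} (hf : f ∈ S.B) (h : S.U t c f) :
    S.U (t + 1) (c ^ 2) f := by
  intro l hl hpos
  obtain rfl | ⟨l, K, rfl⟩ := l.eq_nil_or_concat
  · simp at hl
  · simp only [List.concat_eq_append, List.mem_append, List.mem_singleton, List.length_append,
      List.length_singleton] at hl hpos ⊢
    refine le_trans ?_ (S.V_append_one_ge l (hpos K (Or.inr rfl)) hf)
    exact pow_le_pow_left₀ hc (h l (by omega) fun H hH => hpos H (Or.inl hH)) 2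

theorem U_mono {t : ℕ} {c c' : ℝ} (hc : c' ≤ c) {f : A} (h : S.U t c f) : S.U t c' f :=
  fun l hl hpos => hc.trans (h l hl hpos)

theorem exists_U_of_le {s s' : ℕ} (hs : s ≤ s') {c : ℝ} (hc : 0 < c) :
    ∃ c' > 0, ∀ f ∈ S.B, S.U s c f → S.U s' c' f := by
  induction s', hs using Nat.le_induction with
  | base => exact ⟨c, hc, fun f _ h => h⟩
  | succ n _ ih =>
    obtain ⟨c', hc', h⟩ := ih
    exact ⟨c' ^ 2, by positivity, fun f hf hU => S.U_succ hc'.le hf (h f hf hU)⟩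

theorem exists_U_of_finset {ι : Type*} (T : Finset ι) (s : ι → ℕ) (c : ι → ℝ)
    (hc : ∀ i ∈ T, 0 < c i) :
    ∃ s₀, ∃ c₀ > 0, ∀ i ∈ T, ∀ f ∈ S.B, S.U (s i) (c i) f → S.U s₀ c₀ f := by
  classical
  induction T using Finset.induction_on with
  | empty => exact ⟨0, 1, one_pos, by simp⟩
  | insert i T _ ih =>
    obtain ⟨s₀, c₀, hc₀, h⟩ := ih fun j hj => hc j (mem_insert_of_mem hj)
    obtain ⟨c₁, hc₁, h₁⟩ := S.exists_U_of_le (le_max_left s₀ (s i)) hc₀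
    obtain ⟨c₂, hc₂, h₂⟩ := S.exists_U_of_le (le_max_right s₀ (s i)) (hc i (mem_insert_self _ _))
    refine ⟨max s₀ (s i), min c₁ c₂, lt_min hc₁ hc₂, fun j hj f hf hU => ?_⟩
    rw [mem_insert] at hj
    rcases hj with rfl | hj
    · exact S.U_mono (min_le_right _ _) (h₂ f hf hU)
    · exact S.U_mono (min_le_left _ _) (h₁ f hf (h j hj f hf hU))

end Sys

end PolyConfig

namespace PolyConfig

theorem exists_av_dilate_le {a H : ℕ} (ha : 0 < a) (hH : 0 < H) : ∃ K > 0, ∀ φ : ℕ → ℝ,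
    (∀ i, 0 ≤ φ i) → av K (fun h => φ (a * h)) ≤ a * av H φ := by
  refine ⟨(H + a - 1) / a, Nat.div_pos (by omega) ha, fun φ hφ => ?_⟩
  set K := (H + a - 1) / a with hK
  have hK0 : 0 < K := Nat.div_pos (by omega) ha
  have h1 : H ≤ a * K := by
    have := Nat.div_add_mod (H + a - 1) a
    have := Nat.mod_lt (H + a - 1) ha
    rw [← hK] at *
    omega
  have h2 : ∑ h ∈ range K, φ (a * h) ≤ ∑ i ∈ range H, φ i := by
    rw [← sum_image (f := φ) (g := fun h => a * h)
      (fun x _ y _ h => Nat.eq_of_mul_eq_mul_left ha h)]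
    refine sum_le_sum_of_subset_of_nonneg (fun i hi => ?_) fun i _ _ => hφ i
    simp only [mem_image, mem_range] at hi ⊢
    obtain ⟨h, hh, rfl⟩ := hi
    have h3 : a * (h + 1) ≤ a * K := Nat.mul_le_mul_left a hh
    have h4 : a * K ≤ H + a - 1 := Nat.mul_div_le _ _
    rw [Nat.mul_succ] at h3
    omega
  unfold av
  have hK' : (0 : ℝ) < K := by exact_mod_cast hK0
  have hH' : (0 : ℝ) < H := by exact_mod_cast hH
  have h1' : (H : ℝ) ≤ a * K := by exact_mod_cast h1
  have h5 : 0 ≤ ∑ i ∈ range H, φ i := sum_nonneg fun i _ => hφ i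
  rw [div_le_iff₀ hK', mul_div_assoc', div_mul_eq_mul_div, le_div_iff₀ hH']
  nlinarith

namespace Sys

variable {A : Type*} [CommRing A] [Algebra ℂ A] (S : Sys A)

theorem exists_dilate {a : ℤ} (ha : a ≠ 0) {H : ℕ} (hH : 0 < H) :
    ∃ K > 0, ∀ (l : List ℕ) (f : A), (av K fun h => av K fun h' =>
      S.V l (S.τ (a * h) f * S.conj (S.τ (a * h') f))) ≤ a ^ 2 * S.V (H :: l) f := by
  obtain ⟨K, hK, hle⟩ := exists_av_dilate_le (Int.natAbs_pos.2 ha) hH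
  refine ⟨K, hK, fun l f => ?_⟩
  have key : (av K fun h => av K fun h' => S.V l (S.τ ((a.natAbs * h : ℕ) : ℤ) f *
      S.conj (S.τ ((a.natAbs * h' : ℕ) : ℤ) f))) ≤ a ^ 2 * S.V (H :: l) f := by
    calc _ ≤ av K fun h => (a.natAbs : ℝ) * av H fun h' =>
          S.V l (S.τ ((a.natAbs * h : ℕ) : ℤ) f * S.conj (S.τ h' f)) :=
          av_mono fun h _ => hle (fun i => S.V l (S.τ ((a.natAbs * h : ℕ) : ℤ) f *
            S.conj (S.τ i f))) (fun i => S.V_nonneg _ _)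
      _ ≤ (a.natAbs : ℝ) * ((a.natAbs : ℝ) * S.V (H :: l) f) := by
          rw [av_mul_left]
          gcongr
          exact hle (fun i => av H fun h' => S.V l (S.τ i f * S.conj (S.τ h' f)))
            (fun i => av_nonneg fun _ => S.V_nonneg _ _)
      _ = _ := by
          rw [← mul_assoc, ← sq, Nat.cast_natAbs, ← Int.cast_pow, ← Int.cast_pow, sq_abs]
  refine le_trans (le_of_eq ?_) key
  rcases Int.natAbs_eq a with h | h
  · have e : ∀ i : ℕ, ((a.natAbs * i : ℕ) : ℤ) = a * i := fun i => by
      rw [Nat.cast_mul, ← h]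
    simp only [e]
  · have e : ∀ i : ℕ, ((a.natAbs * i : ℕ) : ℤ) = -(a * i) := fun i => by
      rw [Nat.cast_mul, ← neg_mul]
      congr 1
      omega
    rw [av_comm]
    congr 1
    funext h1
    congr 1
    funext h2
    rw [e, e, ← S.V_τ l (a * h1 + a * h2) (S.τ (-(a * h1)) f * _), map_mul, S.τ_conj, ← S.τ_add,
      ← S.τ_add]
    congr <;> ring

variable (E : Mean)

/-- Control of linear averages by seminorms. -/
theorem exists_linear_control (G : Finset ℤ) {a : ℤ} (ha : a ∈ G) : ∃ C > 0,
    ∀ f : ℤ → A, (∀ b, f b ∈ S.B) → ∀ l : List ℕ, l.length + 1 = #G → (∀ H ∈ l, 0 < H) →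
      ‖E.L fun n => S.m (∏ b ∈ G, S.τ (b * n) (f b))‖ ^ 2 ^ l.length ≤ C * S.V l (f a) := by
  generalize hN : #G = N
  induction N generalizing G a with
  | zero => simp_all
  | succ N ih =>
    rcases Nat.eq_zero_or_pos N with rfl | hNpos
    · obtain ⟨b, rfl⟩ := card_eq_one.1 hN
      obtain rfl := mem_singleton.1 ha
      refine ⟨1, one_pos, fun f hf l hl _ => ?_⟩
      obtain rfl : l = [] := List.length_eq_zero_iff.1 (by omega)
      simp [V, S.m_τ, E.const]
    · obtain ⟨r, hr, hra⟩ := exists_mem_ne (by omega : 1 < #G) a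
      obtain ⟨C, hC, hCle⟩ := ih (G.erase r) (a := a) (mem_erase.2 ⟨hra.symm, ha⟩)
        (by rw [card_erase_of_mem hr]; omega)
      have hd : a - r ≠ 0 := sub_ne_zero.2 hra.symm
      refine ⟨C * ((a - r : ℤ) : ℝ) ^ 2, by positivity, fun f hf l hl hpos => ?_⟩
      obtain _ | ⟨H, l⟩ := l
      · simp at hl; omega
      simp only [List.mem_cons, forall_eq_or_imp, List.length_cons] at hpos hl
      obtain ⟨K, hK, hdil⟩ := S.exists_dilate hd hpos.1
      set g : ℕ → ℕ → ℤ → A := fun h h' b =>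
        S.τ ((b - r) * h) (f b) * S.conj (S.τ ((b - r) * h') (f b)) with hg
      have hgB : ∀ h h' b, g h h' b ∈ S.B := fun h h' b =>
        S.mul_mem (S.τ_mem _ (hf b)) (S.conj_mem (S.τ_mem _ (hf b)))
      have e1 : (fun n : ℕ => S.m (∏ b ∈ G, S.τ (b * n) (f b))) =
          fun n : ℕ => S.m (f r * ∏ b ∈ G.erase r, S.τ ((b - r) * n) (f b)) := by
        funext n
        rw [← S.m_τ (-(r * n)), ← mul_prod_erase G _ hr, map_mul, map_prod, ← S.τ_add,
          neg_add_cancel, S.τ_zero]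
        congr! 3 with b _
        rw [← S.τ_add]
        congr 1
        ring_nf
      have hv := S.vdC E (hf r) (U := fun n => ∏ b ∈ G.erase r, S.τ ((b - r) * n) (f b))
        (fun n => S.prod_mem _ _ fun b _ => S.τ_mem _ (hf b)) hK
      rw [← e1] at hv
      have e2 : ∀ h h' : ℕ,
          (fun n : ℕ => S.m ((∏ b ∈ G.erase r, S.τ ((b - r) * (n + h : ℕ)) (f b)) *
          S.conj (∏ b ∈ G.erase r, S.τ ((b - r) * (n + h' : ℕ)) (f b)))) =
          fun n : ℕ => S.m (∏ b ∈ G.erase r, S.τ (b * n) (g h h' b)) := by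
        intro h h'
        funext n
        rw [← S.m_τ (r * n), map_prod, ← prod_mul_distrib, map_prod]
        congr! 2 with b _
        simp only [hg, map_mul, S.τ_conj, ← S.τ_add]
        push_cast
        ring_nf
      simp only [e2] at hv
      have hpow : 2 ^ l.length = 2 ^ l.length - 1 + 1 :=
        (Nat.sub_add_cancel Nat.one_le_two_pow).symm
      rw [List.length_cons, pow_succ' 2, pow_mul]
      calc _ ≤ (av K fun h => av K fun h' =>
            ‖E.L fun n => S.m (∏ b ∈ G.erase r, S.τ (b * n) (g h h' b))‖) ^ 2 ^ l.length :=
            pow_le_pow_left₀ (sq_nonneg _) hv _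
        _ ≤ av K fun h => av K fun h' =>
            ‖E.L fun n => S.m (∏ b ∈ G.erase r, S.τ (b * n) (g h h' b))‖ ^ 2 ^ l.length := by
            rw [hpow]
            exact (av_pow_le K (fun _ => av_nonneg fun _ => norm_nonneg _) _).trans
              (av_mono fun _ _ => av_pow_le K (fun _ => norm_nonneg _) _)
        _ ≤ av K fun h => av K fun h' => C * S.V l (g h h' a) :=
            av_mono fun h _ => av_mono fun h' _ => hCle _ (hgB h h') l (by omega)
            hpos.2
        _ ≤ _ := by
            simp only [av_mul_left]
            rw [mul_assoc]
            gcongr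
            exact hdil l (f a)

end Sys

end PolyConfig

namespace PolyConfig

open Polynomial

/-- The shifted polynomial `q (X + h) - q h`. -/
noncomputable def sh (h : ℤ) (q : ℤ[X]) : ℤ[X] := taylor h q - C (q.eval h)

theorem eval_sh (h n : ℤ) (q : ℤ[X]) : q.eval (n + h) = (sh h q).eval n + q.eval h := by
  simp [sh, taylor_eval]

theorem coeff_zero_sh (h : ℤ) (q : ℤ[X]) : (sh h q).coeff 0 = 0 := by
  simp [sh, taylor_coeff_zero]

theorem natDegree_sh (h : ℤ) (q : ℤ[X]) : (sh h q).natDegree = q.natDegree := by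
  rw [sh, natDegree_sub_C, natDegree_taylor]

theorem coeff_sh (h : ℤ) (q : ℤ[X]) {n : ℕ} (hn : n ≠ 0) :
    (sh h q).coeff n = (taylor h q).coeff n := by
  rw [sh, coeff_sub, coeff_C, if_neg hn, sub_zero]

theorem natDegree_pos_of_coeff_zero {q : ℤ[X]} (hq : q ≠ 0) (h0 : q.coeff 0 = 0) :
    0 < q.natDegree := by
  by_contra h
  rw [eq_C_of_natDegree_eq_zero (by omega : q.natDegree = 0), h0, C_0] at hq
  exact hq rfl

theorem leadingCoeff_sh (h : ℤ) {q : ℤ[X]} (hq : q ≠ 0) (h0 : q.coeff 0 = 0) :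
    (sh h q).leadingCoeff = q.leadingCoeff := by
  have := natDegree_pos_of_coeff_zero hq h0
  rw [leadingCoeff, natDegree_sh, coeff_sh _ _ this.ne', ← natDegree_taylor q h,
    coeff_natDegree, leadingCoeff_taylor]

theorem sh_ne_zero (h : ℤ) {q : ℤ[X]} (hq : q ≠ 0) (h0 : q.coeff 0 = 0) : sh h q ≠ 0 := by
  rw [← leadingCoeff_ne_zero, leadingCoeff_sh h hq h0]
  exact leadingCoeff_ne_zero.2 hq

theorem sh_inj (h : ℤ) {q q' : ℤ[X]} (h0 : q.coeff 0 = 0) (h0' : q'.coeff 0 = 0)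
    (he : sh h q = sh h q') : q = q' := by
  by_contra hne
  refine sh_ne_zero h (sub_ne_zero.2 hne) (by simp [h0, h0']) ?_
  rw [← sub_eq_zero.2 he]
  simp only [sh, map_sub, eval_sub]
  ring

theorem coeff_pred_sh (h : ℤ) {q : ℤ[X]} (hd : 2 ≤ q.natDegree) :
    (sh h q).coeff (q.natDegree - 1) =
      q.coeff (q.natDegree - 1) + q.natDegree * q.leadingCoeff * h := by
  obtain ⟨d, hd'⟩ : ∃ d, q.natDegree = d + 1 := ⟨q.natDegree - 1, by omega⟩
  rw [coeff_sh _ _ (by omega), taylor_coeff, eval_eq_sum_range' (n := 2)]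
  · rw [sum_range_succ, sum_range_one, hasseDeriv_coeff, hasseDeriv_coeff, leadingCoeff, hd']
    simp [add_comm 1 d]
  · have := natDegree_hasseDeriv_le q (q.natDegree - 1)
    omega

theorem sh_left_inj {q : ℤ[X]} (hd : 2 ≤ q.natDegree) {h h' : ℤ} (he : sh h q = sh h' q) :
    h = h' := by
  have := congrArg (fun p => coeff p (q.natDegree - 1)) he
  simp only [coeff_pred_sh _ hd] at this
  have hq : q.leadingCoeff ≠ 0 := by
    rw [leadingCoeff_ne_zero]
    rintro rfl
    simp at hd
  have h1 : (q.natDegree : ℤ) * q.leadingCoeff ≠ 0 := mul_ne_zero (by positivity) hq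
  exact mul_left_cancel₀ h1 (by linarith)

/-- The class of a polynomial: its degree and leading coefficient. -/
noncomputable def cls (q : ℤ[X]) : ℕ × ℤ := (q.natDegree, q.leadingCoeff)

theorem cls_sh (h : ℤ) {q : ℤ[X]} (hq : q ≠ 0) (h0 : q.coeff 0 = 0) : cls (sh h q) = cls q := by
  rw [cls, natDegree_sh, leadingCoeff_sh h hq h0, cls]

theorem natDegree_sub_lt_of_cls_eq {p r : ℤ[X]} (h : cls p = cls r) (hr : 0 < r.natDegree) :
    (p - r).natDegree < r.natDegree := by
  simp only [cls, Prod.mk.injEq] at h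
  by_cases hpr : p - r = 0
  · rwa [hpr, natDegree_zero]
  · rw [← h.1] at hr ⊢
    have hp0 : p ≠ 0 := by
      rintro rfl
      simp at hr
    have hr0 : r ≠ 0 := by
      rintro rfl
      rw [h.1] at hr
      simp at hr
    refine natDegree_lt_natDegree hpr (degree_sub_lt_left ?_ hp0 h.2)
    rw [degree_eq_natDegree hp0, degree_eq_natDegree hr0, h.1]

theorem cls_sub {p r : ℤ[X]} (hne : cls p ≠ cls r) (hle : r.natDegree ≤ p.natDegree) :
    cls (p - r) = if p.natDegree = r.natDegree then
      (p.natDegree, p.leadingCoeff - r.leadingCoeff) else cls p := by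
  split_ifs with h
  · have h1 : (p - r).coeff p.natDegree = p.leadingCoeff - r.leadingCoeff := by
      rw [coeff_sub, leadingCoeff, leadingCoeff, h]
    have h2 : p.leadingCoeff - r.leadingCoeff ≠ 0 := by
      rw [sub_ne_zero]
      intro h3
      exact hne (by simp [cls, h, h3])
    have h3 : (p - r).natDegree = p.natDegree := by
      refine le_antisymm ((natDegree_sub_le _ _).trans (by simp [h])) ?_
      exact le_natDegree_of_ne_zero (by rwa [h1])
    rw [cls, leadingCoeff, h3, h1]
  · have hlt : r.natDegree < p.natDegree := by omega
    rw [cls, cls, natDegree_sub_eq_left_of_natDegree_lt hlt, leadingCoeff_sub_of_degree_lt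
      (degree_lt_degree hlt)]

/-- The multiset of degrees of the classes of a family. -/
noncomputable def weight (G : Finset ℤ[X]) : Multiset ℕ :=
  (G.image cls).val.map Prod.fst

/-- The family obtained from `G` by a van der Corput step with shifts `h, h'` and pivot `r`. -/
noncomputable def vdCFamily (h h' : ℤ) (r : ℤ[X]) (G : Finset ℤ[X]) : Finset ℤ[X] :=
  ((G.image (sh h) ∪ G.image (sh h')).erase (sh h' r)).image fun p => p - sh h' r

theorem exists_of_mem_vdCFamily {h h' : ℤ} {r : ℤ[X]} {G : Finset ℤ[X]} {p : ℤ[X]}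
    (hp : p ∈ vdCFamily h h' r G) :
    ∃ q ∈ G, ∃ k, p = sh k q - sh h' r ∧ sh k q ≠ sh h' r := by
  simp only [vdCFamily, mem_image, mem_erase, mem_union] at hp
  obtain ⟨p', ⟨hne, hp'⟩, rfl⟩ := hp
  rcases hp' with ⟨q, hq, rfl⟩ | ⟨q, hq, rfl⟩
  · exact ⟨q, hq, h, rfl, hne⟩
  · exact ⟨q, hq, h', rfl, hne⟩

theorem weight_vdCFamily_lt {h h' : ℤ} {r : ℤ[X]} {G : Finset ℤ[X]}
    (hG : ∀ q ∈ G, q ≠ 0 ∧ q.coeff 0 = 0) (hr : r ∈ G)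
    (hmin : ∀ q ∈ G, r.natDegree ≤ q.natDegree) :
    Multiset.IsDershowitzMannaLT (weight (vdCFamily h h' r G)) (weight G) := by
  classical
  set e := r.natDegree with he
  have he0 : 0 < e := natDegree_pos_of_coeff_zero (hG r hr).1 (hG r hr).2
  set C2 := (vdCFamily h h' r G).image cls with hC2
  set CE := (G.image cls).erase (cls r) with hCE
  have hclsr : cls r ∈ G.image cls := mem_image_of_mem _ hr
  let φ : ℕ × ℤ → ℕ × ℤ := fun c => if c.1 = e then (c.1, c.2 - r.leadingCoeff) else c
  have hφ1 : ∀ c, (φ c).1 = c.1 := fun c => by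
    simp only [φ]
    split_ifs <;> rfl
  have hφ : Function.Injective φ := by
    intro c c' hcc
    have h1 := congrArg Prod.fst hcc
    rw [hφ1, hφ1] at h1
    simp only [φ, h1] at hcc
    split_ifs at hcc with h2
    · exact Prod.ext h1 (by simpa using hcc)
    · exact hcc
  have hsub : C2.filter (fun c => e ≤ c.1) ⊆ CE.image φ := by
    intro c hc
    simp only [mem_filter, hC2, mem_image] at hc
    obtain ⟨⟨p, hp, rfl⟩, hc⟩ := hc
    obtain ⟨q, hq, k, rfl, hne⟩ := exists_of_mem_vdCFamily hp
    have hq' := hG q hq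
    have hr' := hG r hr
    have h1 : cls (sh k q) = cls q := cls_sh k hq'.1 hq'.2
    have h2 : cls (sh h' r) = cls r := cls_sh h' hr'.1 hr'.2
    have hdr : (sh h' r).natDegree = e := natDegree_sh _ _
    have hdq : (sh k q).natDegree = q.natDegree := natDegree_sh _ _
    have hclsne : cls q ≠ cls r := by
      intro hcl
      have := natDegree_sub_lt_of_cls_eq (h1.trans (hcl.trans h2.symm)) (by omega)
      simp only [cls] at hc
      omega
    refine mem_image.2 ⟨cls q, mem_erase.2 ⟨hclsne, mem_image_of_mem _ hq⟩, ?_⟩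
    rw [cls_sub (by rwa [h1, h2]) (by rw [hdq, hdr]; exact hmin q hq), hdq, hdr, h1,
      leadingCoeff_sh k hq'.1 hq'.2, leadingCoeff_sh h' hr'.1 hr'.2]
    simp [φ, cls]
  have hX : ((C2.filter fun c => e ≤ c.1).val.map Prod.fst) ≤ CE.val.map Prod.fst := by
    have := Multiset.map_le_map (f := Prod.fst) (val_le_iff.2 hsub)
    rwa [image_val_of_injOn hφ.injOn, Multiset.map_map,
      show Prod.fst ∘ φ = Prod.fst from funext hφ1] at this
  have hW : weight G = e ::ₘ CE.val.map Prod.fst := by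
    rw [weight, ← insert_erase hclsr, insert_val_of_notMem (notMem_erase _ _), Multiset.map_cons]
    rfl
  obtain ⟨Y, hY⟩ := Multiset.le_iff_exists_add.1 hX
  refine ⟨(C2.filter fun c => e ≤ c.1).val.map Prod.fst,
    (C2.filter fun c => ¬ e ≤ c.1).val.map Prod.fst, e ::ₘ Y, Multiset.cons_ne_zero, ?_, ?_, ?_⟩
  · rw [← Multiset.map_add, filter_val, filter_val, Multiset.filter_add_not]
    rfl
  · rw [hW, hY, Multiset.add_cons]
  · intro y hy
    refine ⟨e, Multiset.mem_cons_self _ _, ?_⟩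
    simp only [filter_val, Multiset.mem_map, Multiset.mem_filter] at hy
    obtain ⟨c, hc, rfl⟩ := hy
    omega

theorem vdCFamily_zero {h h' : ℤ} {r : ℤ[X]} {G : Finset ℤ[X]} :
    ∀ q ∈ vdCFamily h h' r G, q ≠ 0 ∧ q.coeff 0 = 0 := by
  intro p hp
  obtain ⟨q, hq, k, rfl, hne⟩ := exists_of_mem_vdCFamily hp
  exact ⟨sub_ne_zero.2 hne, by simp [coeff_zero_sh]⟩

/-- A pivot of minimal degree such that the differences with `m` have maximal degree. -/
theorem exists_pivot {G : Finset ℤ[X]} (hG : ∀ q ∈ G, q ≠ 0 ∧ q.coeff 0 = 0) {m : ℤ[X]}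
    (hm : m ∈ G) (hmax : ∀ q ∈ G, q.natDegree ≤ m.natDegree) (hd : 2 ≤ m.natDegree) :
    ∃ r ∈ G, (∀ q ∈ G, r.natDegree ≤ q.natDegree) ∧ ∀ h h' : ℤ, h ≠ h' →
      ∀ q ∈ vdCFamily h h' r G, q.natDegree ≤ (sh h m - sh h' r).natDegree := by
  classical
  by_cases hall : ∀ q ∈ G, cls q = cls m
  · refine ⟨m, hm, fun q hq => ?_, fun h h' hne p hp => ?_⟩
    · have := congrArg Prod.fst (hall q hq)
      exact le_of_eq this.symm
    · obtain ⟨q, hq, k, rfl, -⟩ := exists_of_mem_vdCFamily hp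
      have h1 : cls (sh k q) = cls (sh h' m) := by
        rw [cls_sh k (hG q hq).1 (hG q hq).2, cls_sh h' (hG m hm).1 (hG m hm).2, hall q hq]
      have h2 := natDegree_sub_lt_of_cls_eq h1 (by rw [natDegree_sh]; omega)
      rw [natDegree_sh] at h2
      have h3 : m.natDegree - 1 ≤ (sh h m - sh h' m).natDegree := by
        refine le_natDegree_of_ne_zero ?_
        rw [coeff_sub, coeff_pred_sh _ hd, coeff_pred_sh _ hd]
        have : (m.natDegree : ℤ) * m.leadingCoeff * (h - h') ≠ 0 :=
          mul_ne_zero (mul_ne_zero (by positivity) (leadingCoeff_ne_zero.2 (hG m hm).1))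
            (sub_ne_zero.2 hne)
        intro h0
        apply this
        linarith
      omega
  · push Not at hall
    have hne : (G.filter fun q => cls q ≠ cls m).Nonempty := by
      obtain ⟨q, hq, hq'⟩ := hall
      exact ⟨q, mem_filter.2 ⟨hq, hq'⟩⟩
    obtain ⟨r, hr, hrmin⟩ := exists_min_image _ natDegree hne
    rw [mem_filter] at hr
    refine ⟨r, hr.1, fun q hq => ?_, fun h h' _ p hp => ?_⟩
    · by_cases hcl : cls q = cls m
      · have : q.natDegree = m.natDegree := congrArg Prod.fst hcl
        rw [this]
        exact hmax r hr.1
      · exact hrmin q (mem_filter.2 ⟨hq, hcl⟩)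
    · have h1 := cls_sh h (hG m hm).1 (hG m hm).2
      have h2 := cls_sh h' (hG r hr.1).1 (hG r hr.1).2
      have h3 := cls_sub (p := sh h m) (r := sh h' r) (by rw [h1, h2]; exact hr.2.symm)
        (by rw [natDegree_sh, natDegree_sh]; exact hmax r hr.1)
      have h4 : (sh h m - sh h' r).natDegree = m.natDegree := by
        have := congrArg Prod.fst h3
        rw [apply_ite Prod.fst] at this
        simpa [cls, natDegree_sh] using this
      rw [h4]
      obtain ⟨q, hq, k, rfl, -⟩ := exists_of_mem_vdCFamily hp
      refine (natDegree_sub_le _ _).trans ?_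
      rw [natDegree_sh, natDegree_sh]
      exact max_le (hmax q hq) (hmax r hr.1)

end PolyConfig

namespace PolyConfig

open Polynomial

namespace Sys

variable {A : Type*} [CommRing A] [Algebra ℂ A] (S : Sys A) (E : Mean)

/-- Averages of multicorrelations along a family of polynomials. -/
noncomputable def form (G : Finset ℤ[X]) (f₀ : A) (f : ℤ[X] → A) : ℂ :=
  E.L fun n => S.m (f₀ * ∏ q ∈ G, S.τ (q.eval (n : ℤ)) (f q))

theorem prod_eval_add (G : Finset ℤ[X]) (T : Finset ℤ[X]) (f : ℤ[X] → A) (h n : ℤ)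
    (hT : ∀ q ∈ G, sh h q ∈ T) :
    ∏ q ∈ G, S.τ (q.eval (n + h)) (f q) =
      ∏ p ∈ T, S.τ (p.eval n) (∏ q ∈ G with sh h q = p, S.τ (q.eval h) (f q)) := by
  classical
  rw [← prod_fiberwise_of_maps_to hT]
  refine prod_congr rfl fun p hp => ?_
  rw [map_prod]
  refine prod_congr rfl fun q hq => ?_
  rw [mem_filter] at hq
  rw [← S.τ_add, ← hq.2, ← eval_sh]

theorem exists_form_vdCFamily {G : Finset ℤ[X]} (hG : ∀ q ∈ G, q.coeff 0 = 0)
    {f : ℤ[X] → A} (hf : ∀ q, f q ∈ S.B) (h h' : ℕ) {r : ℤ[X]} (hr : r ∈ G) :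
    ∃ g₀ ∈ S.B, ∃ g : ℤ[X] → A, (∀ q, g q ∈ S.B) ∧
      (E.L fun n => S.m ((∏ q ∈ G, S.τ (q.eval ((n + h : ℕ) : ℤ)) (f q)) *
        S.conj (∏ q ∈ G, S.τ (q.eval ((n + h' : ℕ) : ℤ)) (f q)))) =
        S.form E (vdCFamily h h' r G) g₀ g ∧
      ∀ m ∈ G, (∀ q ∈ G, sh h m ≠ sh h' q) →
        g (sh h m - sh h' r) = S.τ (m.eval (h : ℤ)) (f m) := by
  classical
  set T := G.image (sh h) ∪ G.image (sh h') with hT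
  set F : ℤ[X] → A := fun p => (∏ q ∈ G with sh h q = p, S.τ (q.eval (h : ℤ)) (f q)) *
    S.conj (∏ q ∈ G with sh h' q = p, S.τ (q.eval (h' : ℤ)) (f q)) with hF
  have hFB : ∀ p, F p ∈ S.B := fun p => S.mul_mem (S.prod_mem _ _ fun q _ => S.τ_mem _ (hf q))
    (S.conj_mem (S.prod_mem _ _ fun q _ => S.τ_mem _ (hf q)))
  have hrT : sh h' r ∈ T := mem_union_right _ (mem_image_of_mem _ hr)
  refine ⟨F (sh h' r), hFB _, fun q => F (q + sh h' r), fun q => hFB _, ?_, ?_⟩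
  · unfold form
    congr 1
    funext n
    have e1 : (∏ q ∈ G, S.τ (q.eval ((n + h : ℕ) : ℤ)) (f q)) *
        S.conj (∏ q ∈ G, S.τ (q.eval ((n + h' : ℕ) : ℤ)) (f q)) =
        ∏ p ∈ T, S.τ (p.eval (n : ℤ)) (F p) := by
      push_cast
      rw [S.prod_eval_add G T f h n fun q hq => mem_union_left _ (mem_image_of_mem _ hq),
        S.prod_eval_add G T f h' n fun q hq => mem_union_right _ (mem_image_of_mem _ hq),
        map_prod, ← prod_mul_distrib]
      refine prod_congr rfl fun p _ => ?_
      rw [← S.τ_conj, ← map_mul]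
    rw [e1, ← S.m_τ (-(sh h' r).eval (n : ℤ)), ← mul_prod_erase T _ hrT, map_mul, ← S.τ_add,
      neg_add_cancel, S.τ_zero, vdCFamily, prod_image (fun a _ b _ hab => sub_left_injective hab),
      map_prod]
    congr 2
    refine prod_congr rfl fun p _ => ?_
    simp only
    rw [← S.τ_add, sub_add_cancel, eval_sub]
    ring_nf
  · intro m hm hne
    simp only [hF, sub_add_cancel]
    have e1 : (G.filter fun q => sh (h : ℤ) q = sh h m) = {m} := by
      ext q
      simp only [mem_filter, mem_singleton]
      constructor
      · rintro ⟨hq, he⟩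
        exact sh_inj h (hG q hq) (hG m hm) he
      · rintro rfl
        exact ⟨hm, rfl⟩
    have e2 : (G.filter fun q => sh (h' : ℤ) q = sh h m) = ∅ :=
      filter_eq_empty_iff.2 fun {q} hq he => hne q hq he.symm
    rw [e1, e2]
    simp

theorem exists_control_linear {G : Finset ℤ[X]} (hG : ∀ q ∈ G, q ≠ 0 ∧ q.coeff 0 = 0)
    {m : ℤ[X]} (hm : m ∈ G) (hmax : ∀ q ∈ G, q.natDegree ≤ 1) {ε : ℝ} (hε : 0 < ε) :
    ∃ s, ∃ c > 0, ∀ f₀ ∈ S.B, ∀ f : ℤ[X] → A, (∀ q, f q ∈ S.B) →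
      ε ≤ ‖S.form E G f₀ f‖ → S.U s c (f m) := by
  classical
  have hq : ∀ q ∈ G, q = C (q.coeff 1) * X := fun q hq => by
    conv_lhs => rw [eq_X_add_C_of_natDegree_le_one (hmax q hq), (hG q hq).2]
    simp
  have hq0 : ∀ q ∈ G, q.coeff 1 ≠ 0 := fun q hq' h0 => by
    have := hq q hq'
    rw [h0] at this
    exact (hG q hq').1 (by simpa using this)
  set T := G.image fun q => q.coeff 1 with hT
  have hT0 : (0 : ℤ) ∉ T := by
    simp only [hT, mem_image, not_exists, not_and]
    exact hq0
  have hinj : Set.InjOn (fun q : ℤ[X] => q.coeff 1) G := fun q hq1 q' hq2 he => by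
    rw [hq q hq1, hq q' hq2]
    simp only at he
    rw [he]
  obtain ⟨K, hK, hle⟩ := S.exists_linear_control E (insert 0 T) (a := m.coeff 1)
    (mem_insert_of_mem (mem_image_of_mem _ hm))
  refine ⟨#T, ε ^ 2 ^ #T / K, by positivity, fun f₀ hf₀ f hf hε' l hl hpos => ?_⟩
  rw [div_le_iff₀' hK]
  have := hle (fun a => if a = 0 then f₀ else f (C a * X)) (fun b => by
    split_ifs
    exacts [hf₀, hf _]) l (by rw [card_insert_of_notMem hT0, hl]) hpos
  rw [hl] at this
  simp only [if_neg (hq0 m hm), ← hq m hm] at this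
  refine le_trans ?_ this
  refine pow_le_pow_left₀ hε.le (hε'.trans (le_of_eq ?_)) _
  unfold form
  congr 2
  funext n
  rw [prod_insert hT0, hT, prod_image hinj]
  simp only [if_true, zero_mul, S.τ_zero]
  congr 2
  refine prod_congr rfl fun q hq1 => ?_
  rw [if_neg (hq0 q hq1), ← hq q hq1]
  have he := congrArg (eval (n : ℤ)) (hq q hq1)
  rw [eval_mul, eval_C, eval_X] at he
  rw [he]

/-- Polynomial averages are controlled by a seminorm of the function of maximal degree. -/
theorem exists_control (G : Finset ℤ[X]) (hG : ∀ q ∈ G, q ≠ 0 ∧ q.coeff 0 = 0)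
    {m : ℤ[X]} (hm : m ∈ G) (hmax : ∀ q ∈ G, q.natDegree ≤ m.natDegree) {ε : ℝ} (hε : 0 < ε) :
    ∃ s, ∃ c > 0, ∀ f₀ ∈ S.B, ∀ f : ℤ[X] → A, (∀ q, f q ∈ S.B) →
      ε ≤ ‖S.form E G f₀ f‖ → S.U s c (f m) := by
  classical
  have hwf : WellFounded (InvImage Multiset.IsDershowitzMannaLT weight) :=
    InvImage.wf _ Multiset.wellFounded_isDershowitzMannaLT
  induction G using hwf.induction generalizing m ε with
  | _ G ih =>
  rcases lt_or_ge m.natDegree 2 with hd | hd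
  · exact S.exists_control_linear E hG hm (fun q hq => by have := hmax q hq; omega) hε
  obtain ⟨r, hr, hmin, hpiv⟩ := exists_pivot hG hm hmax hd
  obtain ⟨H, hH⟩ := exists_nat_gt (2 * #G / ε ^ 2 : ℝ)
  have hH0' : (0 : ℝ) < H := lt_of_le_of_lt (by positivity) hH
  have hH0 : 0 < H := by exact_mod_cast hH0'
  let good : ℕ × ℕ → Prop := fun p => ∀ q ∈ G, sh (p.1 : ℤ) m ≠ sh (p.2 : ℤ) q
  have hstep : ∀ p : ℕ × ℕ, good p → ∃ s, ∃ c > 0, ∀ f₀ ∈ S.B, ∀ f : ℤ[X] → A,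
      (∀ q, f q ∈ S.B) → ε ^ 2 / 2 ≤ ‖S.form E (vdCFamily p.1 p.2 r G) f₀ f‖ →
        S.U s c (f (sh p.1 m - sh p.2 r)) := by
    intro p hp
    refine ih _ (weight_vdCFamily_lt hG hr hmin) vdCFamily_zero ?_ (hpiv _ _ ?_) (by positivity)
    · exact mem_image_of_mem _ (mem_erase.2 ⟨hp r hr, mem_union_left _ (mem_image_of_mem _ hm)⟩)
    · intro he
      exact hp m hm (by rw [he])
  choose! s c hc hsc using hstep
  obtain ⟨s₀, c₀, hc₀, hU⟩ := S.exists_U_of_finset ((range H ×ˢ range H).filter good) s c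
    (fun p hp => hc p (mem_filter.1 hp).2)
  refine ⟨s₀, c₀, hc₀, fun f₀ hf₀ f hf hle => ?_⟩
  set Φ : ℕ → ℕ → ℝ := fun h h' =>
    ‖E.L fun n => S.m ((∏ q ∈ G, S.τ (q.eval ((n + h : ℕ) : ℤ)) (f q)) *
        S.conj (∏ q ∈ G, S.τ (q.eval ((n + h' : ℕ) : ℤ)) (f q)))‖ with hΦ
  have hPB : ∀ n : ℕ, ∏ q ∈ G, S.τ (q.eval (n : ℤ)) (f q) ∈ S.B := fun n =>
    S.prod_mem _ _ fun q _ => S.τ_mem _ (hf q)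
  have hΦ1 : ∀ h h', Φ h h' ≤ 1 := fun h h' => E.norm_le _ fun n =>
    S.norm_m_le (S.mul_mem (hPB _) (S.conj_mem (hPB _)))
  have hv : ε ^ 2 ≤ av H fun h' => av H fun h => Φ h h' := by
    rw [av_comm]
    exact (pow_le_pow_left₀ hε.le hle 2).trans (S.vdC E hf₀ hPB hH0)
  have hbad : (av H fun h' => av H fun h => if good (h, h') then 0 else (1 : ℝ)) ≤ #G / H := by
    rw [← av_const hH0 (#G / H : ℝ)]
    refine av_mono fun h' _ => ?_
    unfold av
    gcongr
    simp only [good]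
    calc ∑ h ∈ range H, (if ∀ q ∈ G, sh (h : ℤ) m ≠ sh (h' : ℤ) q then 0 else (1 : ℝ))
        ≤ ∑ h ∈ range H, ∑ q ∈ G, if sh (h : ℤ) m = sh (h' : ℤ) q then (1 : ℝ) else 0 := by
          refine sum_le_sum fun h _ => ?_
          split_ifs with hgood
          · exact sum_nonneg fun q _ => by split_ifs <;> norm_num
          · push Not at hgood
            obtain ⟨q, hq, he⟩ := hgood
            exact (le_of_eq (if_pos he).symm).trans
              (single_le_sum (f := fun q => if sh (h : ℤ) m = sh (h' : ℤ) q then (1 : ℝ) else 0)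
                (fun q _ => by split_ifs <;> norm_num) hq)
      _ = ∑ q ∈ G, ∑ h ∈ range H, if sh (h : ℤ) m = sh (h' : ℤ) q then (1 : ℝ) else 0 :=
          sum_comm
      _ ≤ ∑ q ∈ G, 1 := by
          refine sum_le_sum fun q _ => ?_
          rw [sum_boole]
          norm_cast
          refine card_le_one.2 fun a ha b hb => ?_
          rw [mem_filter] at ha hb
          exact_mod_cast sh_left_inj hd (ha.2.trans hb.2.symm)
      _ = #G := by simp
  have hsmall : (#G / H : ℝ) < ε ^ 2 / 2 := by
    rw [div_lt_iff₀ (by positivity)] at hH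
    rw [div_lt_iff₀ hH0']
    linarith
  obtain ⟨h, hh, h', hh', hgood, hbig⟩ :
      ∃ h < H, ∃ h' < H, good (h, h') ∧ ε ^ 2 / 2 ≤ Φ h h' := by
    by_contra! hcon
    have : (av H fun h' => av H fun h => Φ h h') ≤
        av H fun h' => av H fun h => (ε ^ 2 / 2 + if good (h, h') then 0 else (1 : ℝ)) := by
      refine av_mono fun h' hh' => av_mono fun h hh => ?_
      split_ifs with hg
      · linarith [hcon h hh h' hh' hg]
      · linarith [hΦ1 h h', sq_nonneg ε]
    simp only [av_add, av_const hH0] at this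
    linarith
  obtain ⟨g₀, hg₀, g, hg, hform, hgm⟩ :=
    S.exists_form_vdCFamily E (fun q hq => (hG q hq).2) hf h h' hr
  have := hsc (h, h') hgood g₀ hg₀ g hg (by rw [← hform]; exact hbig)
  rw [hgm m hm hgood, S.U_τ] at this
  exact hU (h, h') (mem_filter.2 ⟨mem_product.2 ⟨mem_range.2 hh, mem_range.2 hh'⟩, hgood⟩) _
    (hf m) this

end Sys

end PolyConfig

namespace PolyConfig

namespace Sys

variable {A : Type*} [CommRing A] [Algebra ℂ A] (S : Sys A)

/-- `χ` is an eigenfunction of modulus one with eigenvalue `z`. -/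
def Eig (χ : A) (z : ℂ) : Prop :=
  χ ∈ S.B ∧ χ * S.conj χ = 1 ∧ ‖z‖ = 1 ∧ ∀ n : ℤ, S.τ n χ = z ^ n • χ

end Sys

/-- An ergodic system, seen through its algebra of functions. -/
structure ErgSys (A : Type*) [CommRing A] [Algebra ℂ A] extends Sys A where
  /-- the nonnegative functions -/
  Pos : Set A
  m_one : m 1 = 1
  faithful : ∀ a ∈ B, m (a * conj a) = 0 → a = 0
  pos_τ : ∀ i, ∀ a ∈ Pos, τ i a ∈ Pos
  dual : ∀ Φ : (ℕ → ℂ) →ₗ[ℂ] ℂ, (∀ u : ℕ → ℂ, (∀ n, ‖u n‖ ≤ 1) → ‖Φ u‖ ≤ 1) →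
    Φ (fun _ => 1) = 1 → ∀ F : ℕ → A, (∀ n, F n ∈ B) →
      ∃ f ∈ B, ((∀ n, F n ∈ Pos) → f ∈ Pos) ∧ ∀ a ∈ B, m (f * a) = Φ fun n => m (F n * a)
  pow_le : ∀ a ∈ B, a ∈ Pos → ∀ k : ℕ, (m a).re ^ (k + 1) ≤ (m (a ^ (k + 1))).re
  ergodic : ∀ a ∈ B, (∀ n, τ n a = a) → ∃ c : ℂ, a = c • 1
  inverse : ∀ f ∈ B, ∀ c > 0, (∃ᶠ i : ℕ in atTop, c ≤ toSys.V [i.factorial] f) →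
    ∃ χ z, toSys.Eig χ z ∧ c / 2 ≤ ‖m (f * χ)‖

namespace Sys

variable {A : Type*} [CommRing A] [Algebra ℂ A] {S : Sys A}

theorem Eig.mul {χ χ' : A} {z z' : ℂ} (h : S.Eig χ z) (h' : S.Eig χ' z') :
    S.Eig (χ * χ') (z * z') := by
  obtain ⟨h1, h2, h3, h4⟩ := h
  obtain ⟨h1', h2', h3', h4'⟩ := h'
  refine ⟨S.mul_mem h1 h1', ?_, by rw [norm_mul, h3, h3', one_mul], fun n => ?_⟩
  · rw [map_mul]
    calc χ * χ' * (S.conj χ * S.conj χ') = (χ * S.conj χ) * (χ' * S.conj χ') := by ring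
      _ = 1 := by rw [h2, h2', one_mul]
  · rw [map_mul, h4, h4', smul_mul_smul_comm, mul_zpow]

theorem Eig.conj {χ : A} {z : ℂ} (h : S.Eig χ z) : S.Eig (S.conj χ) (star z) := by
  obtain ⟨h1, h2, h3, h4⟩ := h
  refine ⟨S.conj_mem h1, by rw [S.conj_conj, mul_comm, h2], by rwa [norm_star], fun n => ?_⟩
  rw [S.τ_conj, h4, S.conj_smul, star_zpow₀]

theorem Eig.one : S.Eig 1 1 :=
  ⟨S.one_mem, by simp, by simp, by simp⟩

theorem Eig.τ {χ : A} {z : ℂ} (h : S.Eig χ z) (i : ℤ) : S.Eig (S.τ i χ) z := by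
  obtain ⟨h1, h2, h3, h4⟩ := h
  refine ⟨S.τ_mem _ h1, by rw [← S.τ_conj, ← map_mul, h2, map_one], h3, fun n => ?_⟩
  rw [S.τ_comm, h4, map_smul]

theorem Eig.prod {ι : Type*} (s : Finset ι) {χ : ι → A} {z : ι → ℂ}
    (h : ∀ i ∈ s, S.Eig (χ i) (z i)) : S.Eig (∏ i ∈ s, χ i) (∏ i ∈ s, z i) := by
  classical
  induction s using Finset.induction_on with
  | empty => simpa using Eig.one
  | insert i s hi ih =>
    rw [prod_insert hi, prod_insert hi]
    exact (h i (mem_insert_self _ _)).mul (ih fun j hj => h j (mem_insert_of_mem hj))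

theorem Eig.D {χ : A} {z : ℂ} (h : S.Eig χ z) {k k' : List ℕ} (hk : k.length = k'.length) :
    ∃ w, S.Eig (S.D k k' χ) w := by
  induction k generalizing χ z k' with
  | nil => exact ⟨z, by rwa [D_nil]⟩
  | cons i k ih =>
    cases k' with
    | nil => simp at hk
    | cons i' k' =>
      rw [D_cons]
      exact ih ((h.τ i).mul (h.τ i').conj) (by simpa using hk)

theorem eig_or_zero_cube {u : List ℕ → A} (h : ∀ k, (∃ z, S.Eig (u k) z) ∨ u k = 0)
    (k k' : List ℕ) : (∃ z, S.Eig (cube S.conj u k k') z) ∨ cube S.conj u k k' = 0 := by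
  induction k generalizing u k' with
  | nil => exact h _
  | cons i k ih =>
    cases k' with
    | nil => exact h _
    | cons i' k' =>
      refine ih (fun j => ?_) k'
      rcases h (i :: j) with ⟨z, hz⟩ | h1
      · rcases h (i' :: j) with ⟨z', hz'⟩ | h1'
        · exact Or.inl ⟨_, hz.mul hz'.conj⟩
        · exact Or.inr (by simp [h1'])
      · exact Or.inr (by simp [h1])

theorem cube_seq (E : Mean) (u : List ℕ → ℕ → A) (k k' : List ℕ) :
    cube (S.seq E).conj u k k' = fun n => cube S.conj (fun j => u j n) k k' := by
  induction k generalizing u k' with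
  | nil => rfl
  | cons i k ih =>
    cases k' with
    | nil => rfl
    | cons i' k' => exact ih _ _

theorem dec_seq (E : Mean) {t : ℕ} {g : List ℕ → A} (hg : Dec S.B t g) :
    Dec (S.seq E).B t fun k _ => g k := by
  induction t generalizing g with
  | zero => exact funext fun _ => hg
  | succ t ih =>
    obtain ⟨G, g', hG, h1, h2⟩ := hg
    exact ⟨fun k _ => G k, fun h k _ => g' h k, fun k _ => hG k,
      fun h k => funext fun _ => h1 h k, fun h => ih (h2 h)⟩

theorem zero_mem : (0 : A) ∈ S.B := by
  simpa using S.smul_mem (c := 0) (by simp) S.one_mem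

end Sys

/-- The roots of unity of order at most `R`. -/
noncomputable def rootsLE (R : ℕ) : Finset ℂ :=
  (Icc 1 R).biUnion fun r => Polynomial.nthRootsFinset r (1 : ℂ)

theorem mem_rootsLE {R : ℕ} {z : ℂ} : z ∈ rootsLE R ↔ ∃ r, 1 ≤ r ∧ r ≤ R ∧ z ^ r = 1 := by
  simp only [rootsLE, mem_biUnion, mem_Icc, and_assoc]
  refine exists_congr fun r => and_congr_right fun hr => ?_
  rw [Polynomial.mem_nthRootsFinset hr]

namespace ErgSys

variable {A : Type*} [CommRing A] [Algebra ℂ A] (S : ErgSys A)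

theorem algebra_one_ne_zero (S : ErgSys A) : (1 : A) ≠ 0 := fun h =>
  zero_ne_one ((map_zero S.m).symm.trans ((congrArg S.m h.symm).trans S.m_one))

theorem Eig.eq_smul {χ ψ : A} {z : ℂ} (h : S.Eig χ z) (h' : S.Eig ψ z) :
    ∃ a : ℂ, ‖a‖ = 1 ∧ χ = a • ψ := by
  have h1 := h.mul h'.conj
  have hz : z * star z = 1 := by
    rw [Complex.star_def, Complex.mul_conj', h.2.2.1]
    simp
  rw [hz] at h1
  obtain ⟨a, ha⟩ := S.ergodic _ h1.1 fun n => by simpa using h1.2.2.2 n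
  refine ⟨a, ?_, ?_⟩
  · have h2 := h1.2.1
    rw [ha, S.conj_smul, map_one, smul_mul_smul_comm, one_mul] at h2
    have h3 := congrArg S.m h2
    rw [map_smul, S.m_one, smul_eq_mul, mul_one, Complex.star_def, Complex.mul_conj'] at h3
    have h4 : ‖a‖ ^ 2 = 1 := by exact_mod_cast h3
    exact (pow_eq_one_iff_of_nonneg (norm_nonneg _) two_ne_zero).1 h4
  · calc χ = (χ * S.conj ψ) * ψ := by rw [mul_assoc, mul_comm (S.conj ψ), h'.2.1, mul_one]
      _ = a • ψ := by rw [ha, smul_mul_assoc, one_mul]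

theorem degree_lowering (E : Mean) (R : ℝ → ℕ) (t : ℕ) {c : ℝ} (hc : 0 < c) :
    ∃ c' > 0, ∀ (F : ℕ → A) (f : A), (∀ n, F n ∈ S.B) → f ∈ S.B →
      (∀ a ∈ S.B, S.m (f * a) = E.L fun n => S.m (F n * a)) →
      (∀ η > 0, ∀ (k k' : List ℕ) (χ : A) (z : ℂ), k.length = k'.length → S.Eig χ z →
        η ≤ ‖E.L fun n => S.m (S.D k k' (F n) * χ)‖ → ∃ r, 1 ≤ r ∧ r ≤ R η ∧ z ^ r = 1) →
      S.U (t + 2) c f → S.U (t + 1) c' f := by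
  classical
  set η : ℝ := (c / 2 * (c / 4)) ^ 2 ^ (t + 1) / 2 with hη
  have hη0 : 0 < η := by positivity
  set N : ℝ := #(rootsLE (R η)) + 1 with hN
  have hN0 : 0 < N := by positivity
  refine ⟨(c / 4 * (η / N)) ^ 2 ^ (t + 1), by positivity, ?_⟩
  intro F f hF hf hdual harith hU l hl hpos
  let good : List ℕ → List ℕ → Prop := fun k k' =>
    ∃ᶠ i : ℕ in atTop, c / 2 ≤ S.V [i.factorial] (S.D k k' f)
  have h1 : c / 2 ≤ Avg2 l fun k k' => if good k k' then 1 else 0 := by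
    have h2 : ∀ i : ℕ, c / 2 ≤
        Avg2 l fun k k' => if c / 2 ≤ S.V [i.factorial] (S.D k k' f) then 1 else 0 := by
      intro i
      refine Avg2_indicator hpos hc.le
        (fun k k' => S.V_le_one (by simp [Nat.factorial_pos]) (S.D_mem hf k k')) ?_
        (fun k k' _ _ h => h)
      rw [← S.V_append]
      exact hU _ (by simp [hl]) (by
        intro H hH
        rw [List.mem_append, List.mem_singleton] at hH
        rcases hH with hH | rfl
        exacts [hpos H hH, Nat.factorial_pos i])
    have h3 : ∀ᶠ i : ℕ in atTop,
        (Avg2 l fun k k' => if c / 2 ≤ S.V [i.factorial] (S.D k k' f) then (1 : ℝ) else 0) ≤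
          Avg2 l fun k k' => if good k k' then 1 else 0 := by
      refine Avg2_eventually fun k k' => ?_
      by_cases hg : good k k'
      · refine Eventually.of_forall fun i => ?_
        rw [if_pos hg]
        split_ifs <;> norm_num
      · filter_upwards [not_frequently.1 hg] with i hi
        rw [if_neg hi, if_neg hg]
    obtain ⟨i, hi⟩ := h3.exists
    exact (h2 i).trans hi
  have h4 : ∀ k k', ∃ χ : A, (good k k' → (∃ z, S.Eig χ z) ∧ c / 4 ≤ ‖S.m (S.D k k' f * χ)‖) ∧
      (¬ good k k' → χ = 0) := by
    intro k k'
    by_cases hg : good k k'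
    · obtain ⟨χ, z, hχ, hle⟩ := S.inverse _ (S.D_mem hf k k') (c / 2) (by positivity) hg
      exact ⟨χ, fun _ => ⟨⟨z, hχ⟩, by linarith⟩, fun h => absurd hg h⟩
    · exact ⟨0, fun h => absurd h hg, fun _ => rfl⟩
  choose χ hχ1 hχ0 using h4
  have h5 : c / 2 * (c / 4) ≤ Avg2 l fun k k' => ‖S.m (S.D k k' f * χ k k')‖ := by
    calc c / 2 * (c / 4) = c / 4 * (c / 2) := mul_comm _ _
      _ ≤ c / 4 * Avg2 l fun k k' => if good k k' then 1 else 0 := by gcongr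
      _ = Avg2 l fun k k' => c / 4 * if good k k' then 1 else 0 := (Avg2_mul_left _ _ _).symm
      _ ≤ _ := Avg2_mono fun k k' _ _ => by
          split_ifs with hg
          · rw [mul_one]
            exact (hχ1 k k' hg).2
          · rw [mul_zero]
            exact norm_nonneg _
  rw [Avg2_eq] at h5
  obtain ⟨k', hk', h6⟩ := exists_le_of_le_Avg (by positivity) h5
  have hχe : ∀ k, (∃ z, S.Eig (χ k k') z) ∨ χ k k' = 0 := fun k => by
    by_cases hg : good k k'
    · exact Or.inl (hχ1 k k' hg).1
    · exact Or.inr (hχ0 k k' hg)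
  have hχB : ∀ k, χ k k' ∈ S.B := fun k => by
    rcases hχe k with ⟨z, hz⟩ | h
    · exact hz.1
    · rw [h]
      exact Sys.zero_mem
  obtain ⟨g, hg, hDg⟩ := S.cube_eq_mul_dec (u := fun j => S.τ (j.sum : ℕ) f)
    (fun j => S.τ_mem _ hf) k'
  rw [hk'] at hg
  have hbox := (S.seq E).box_le l (u := fun k n => S.τ (k.sum : ℕ) (F n) * χ k k')
    (fun k n => S.mul_mem (S.τ_mem _ (hF n)) (hχB k)) (Sys.dec_seq E hg)
  have h7 : Avg l (fun k => ‖S.m (S.D k k' f * χ k k')‖) ≤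
      Avg l fun k => ‖(S.seq E).m ((fun n => S.τ (k.sum : ℕ) (F n) * χ k k') * fun _ => g k)‖ := by
    refine Avg_mono fun k hk => le_of_eq ?_
    congr 1
    have hgB : g k ∈ S.B := PreSys.Dec.mem hg hk
    calc S.m (S.D k k' f * χ k k')
        = S.m (f * S.τ (-(k.sum : ℕ)) (g k * χ k k')) := by
          rw [Sys.D, hDg k (by rw [hk, hk']), ← S.m_τ (-(k.sum : ℕ)), mul_assoc, map_mul,
            ← S.τ_add, neg_add_cancel, S.τ_zero]
      _ = E.L fun n => S.m (F n * S.τ (-(k.sum : ℕ)) (g k * χ k k')) :=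
          hdual _ (S.τ_mem _ (S.mul_mem hgB (hχB k)))
      _ = E.L fun n => S.m (S.τ (k.sum : ℕ) (F n) * χ k k' * g k) := by
          congr 1
          funext n
          rw [← S.m_τ (k.sum : ℕ), map_mul, ← S.τ_add, add_neg_cancel, S.τ_zero]
          congr 1
          ring
  have h8 : η * 2 ≤ Avg2 l fun k k'' =>
      ‖E.L fun n => S.m (S.D k k'' (F n) * cube S.conj (fun j => χ j k') k k'')‖ := by
    calc η * 2 = (c / 2 * (c / 4)) ^ 2 ^ l.length := by rw [hη, hl]; ring
      _ ≤ _ := (pow_le_pow_left₀ (by positivity) (h6.trans h7) _).trans hbox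
      _ = _ := by
        congr! 5 with k k''
        rw [Sys.cube_seq]
        simp only [S.cube_mul]
        rfl
  have h9 := Avg2_indicator hpos (by positivity) (fun k k'' => E.norm_le _ fun n =>
    S.norm_m_le (S.mul_mem (S.D_mem (hF n) k k'') (S.cube_mem hχB k k''))) h8
    (p := fun k k'' => ∃ ρ ∈ rootsLE (R η), S.Eig (cube S.conj (fun j => χ j k') k k'') ρ) (by
      intro k k'' hk hk'' hle
      rcases Sys.eig_or_zero_cube hχe k k'' with ⟨z, hz⟩ | h
      · refine ⟨z, mem_rootsLE.2 ?_, hz⟩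
        exact harith η hη0 k k'' _ z (hk.trans hk''.symm) hz (by linarith)
      · rw [h] at hle
        simp only [mul_zero, map_zero, E.const, norm_zero] at hle
        linarith)
  have h10 : η ≤ ∑ ρ ∈ rootsLE (R η), Avg2 l fun k k'' =>
      if S.Eig (cube S.conj (fun j => χ j k') k k'') ρ then 1 else 0 := by
    rw [← Avg2_sum]
    refine le_trans (by linarith) (h9.trans (Avg2_mono fun k k'' _ _ => ?_))
    split_ifs with h
    · obtain ⟨ρ, hρ, hρ'⟩ := h
      refine le_trans (le_of_eq (if_pos hρ').symm) (single_le_sum (f := fun ρ =>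
        if S.Eig (cube S.conj (fun j => χ j k') k k'') ρ then (1 : ℝ) else 0)
        (fun ρ _ => ?_) hρ)
      split_ifs <;> norm_num
    · exact sum_nonneg fun ρ _ => by split_ifs <;> norm_num
  obtain ⟨ρ, -, h11⟩ : ∃ ρ ∈ rootsLE (R η), η / N ≤ Avg2 l fun k k'' =>
      if S.Eig (cube S.conj (fun j => χ j k') k k'') ρ then 1 else 0 := by
    by_contra! hcon
    have := sum_le_sum fun ρ hρ => (hcon ρ hρ).le
    rw [sum_const, nsmul_eq_mul] at this
    have h12 : (#(rootsLE (R η)) : ℝ) * (η / N) < η := by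
      rw [mul_div_assoc', div_lt_iff₀ hN0, hN]
      linarith
    linarith
  rw [Avg2_eq] at h11
  obtain ⟨k'', hk'', h12⟩ := exists_le_of_le_Avg (by positivity) h11
  obtain ⟨g', hg', hχg⟩ := S.cube_eq_mul_dec (u := fun j => χ j k') hχB k''
  rw [hk''] at hg'
  obtain ⟨k₀, -, hk₀⟩ := exists_le_of_le_Avg (by positivity) h12
  set Ψ := cube S.conj (fun j => χ j k') k₀ k'' with hΨ
  have hΨe : S.Eig Ψ ρ := by
    by_contra h
    rw [if_neg h] at hk₀
    have : 0 < η / N := by positivity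
    linarith
  have hdec : Dec S.B l.length fun k => Ψ * (g k * S.conj (g' k)) := by
    rw [hl] at hg hg' ⊢
    exact PreSys.Dec.const_mul (PreSys.Dec.mul hg (PreSys.Dec.conj hg')) hΨe.1
  have hbox2 := S.box_le l (u := fun j => S.τ (j.sum : ℕ) f) (fun j => S.τ_mem _ hf) hdec
  have hgoal : c / 4 * (η / N) ≤
      Avg l fun k => ‖S.m (S.τ (k.sum : ℕ) f * (Ψ * (g k * S.conj (g' k))))‖ := by
    calc c / 4 * (η / N) ≤ c / 4 * Avg l fun k =>
          if S.Eig (cube S.conj (fun j => χ j k') k k'') ρ then 1 else 0 := by gcongr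
      _ = Avg l fun k => c / 4 *
          if S.Eig (cube S.conj (fun j => χ j k') k k'') ρ then 1 else 0 :=
          (Avg_mul_left _ _ _).symm
      _ ≤ _ := Avg_mono fun k hk => by
          split_ifs with he
          · obtain ⟨a, ha, hae⟩ := Eig.eq_smul S he hΨe
            have hcg := hχg k (hk.trans hk''.symm)
            have hgd : good k k' := by
              by_contra hng
              have h13 := he.2.1
              rw [hcg, hχ0 k k' hng, zero_mul, zero_mul] at h13
              exact S.algebra_one_ne_zero h13.symm
            obtain ⟨⟨z, hz⟩, hle⟩ := hχ1 k k' hgd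
            have hgg : g' k * S.conj (g' k) = 1 := by
              have h13 := he.2.1
              rw [hcg, map_mul] at h13
              calc g' k * S.conj (g' k)
                  = (χ k k' * S.conj (χ k k')) * (g' k * S.conj (g' k)) := by
                    rw [hz.2.1, one_mul]
                _ = 1 := by rw [← h13]; ring
            have hχk : χ k k' = a • (Ψ * S.conj (g' k)) := by
              rw [← smul_mul_assoc, ← hae, hcg, mul_assoc, hgg, mul_one]
            rw [mul_one]
            refine hle.trans (le_of_eq ?_)
            rw [hχk, Sys.D, hDg k (by rw [hk, hk']), mul_smul_comm, map_smul, norm_smul, ha,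
              one_mul]
            congr 2
            ring
          · rw [mul_zero]
            exact norm_nonneg _
  rw [S.V_eq, ← hl]
  exact (pow_le_pow_left₀ (by positivity) hgoal _).trans hbox2

end ErgSys

end PolyConfig

namespace PolyConfig

open Polynomial

/-- The additive character `x ↦ exp (2πix)`. -/
noncomputable def ex (x : ℝ) : ℂ := Complex.exp (x * (2 * Real.pi * Complex.I))

theorem ex_add (x y : ℝ) : ex (x + y) = ex x * ex y := by
  rw [ex, ex, ex, ← Complex.exp_add]
  congr 1
  push_cast
  ring

theorem norm_ex (x : ℝ) : ‖ex x‖ = 1 := by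
  rw [ex, show (x : ℂ) * (2 * Real.pi * Complex.I) = ((x * (2 * Real.pi) : ℝ) : ℂ) * Complex.I by
    push_cast; ring, Complex.norm_exp_ofReal_mul_I]

theorem ex_neg (x : ℝ) : ex (-x) = star (ex x) := by
  rw [ex, ex, Complex.star_def, ← Complex.exp_conj]
  congr 1
  simp [Complex.conj_ofNat]

theorem ex_eq_one_iff {x : ℝ} : ex x = 1 ↔ x ∈ (Int.castRingHom ℝ).range := by
  rw [ex, Complex.exp_eq_one_iff]
  refine exists_congr fun n => ?_
  have h : (2 * Real.pi * Complex.I : ℂ) ≠ 0 := Complex.two_pi_I_ne_zero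
  constructor
  · intro hx
    have := mul_right_cancel₀ h hx
    exact_mod_cast this.symm
  · intro hx
    rw [← hx]
    simp

theorem ex_int_mul (n : ℤ) (x : ℝ) : ex (n * x) = ex x ^ n := by
  rw [ex, ex, ← Complex.exp_int_mul]
  congr 1
  push_cast
  ring

theorem ex_sum {ι : Type*} (s : Finset ι) (x : ι → ℝ) : ex (∑ i ∈ s, x i) = ∏ i ∈ s, ex (x i) := by
  rw [ex, Complex.ofReal_sum, sum_mul, Complex.exp_sum]
  rfl

theorem exists_ex_eq {z : ℂ} (hz : ‖z‖ = 1) : ∃ x, ex x = z := by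
  refine ⟨z.arg / (2 * Real.pi), ?_⟩
  have h := Complex.norm_mul_exp_arg_mul_I z
  rw [hz, Complex.ofReal_one, one_mul] at h
  rw [ex, ← h]
  have : (Real.pi : ℂ) ≠ 0 := by exact_mod_cast Real.pi_ne_zero
  congr 1
  rw [h]
  push_cast
  field_simp

/-- The one point system. -/
noncomputable def PreSys.point : PreSys ℂ where
  B := {z | ‖z‖ ≤ 1}
  conj := starRingEnd ℂ
  m := LinearMap.id
  conj_conj := Complex.conj_conj
  conj_smul c a := by simp
  one_mem := by simp
  mul_mem ha hb := by
    simp only [Set.mem_ofPred_eq, norm_mul] at *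
    exact mul_le_one₀ ha (norm_nonneg _) hb
  conj_mem ha := by simpa using ha
  avg_mem H c a hc ha := by
    simp only [Set.mem_ofPred_eq, smul_eq_mul] at *
    rw [norm_mul, norm_inv, Complex.norm_natCast]
    have : ‖∑ h ∈ range H, c h * a h‖ ≤ H := by
      refine (norm_sum_le _ _).trans ?_
      calc ∑ h ∈ range H, ‖c h * a h‖ ≤ ∑ h ∈ range H, (1 : ℝ) := sum_le_sum fun h _ => by
            rw [norm_mul]
            exact mul_le_one₀ (hc h) (norm_nonneg _) (ha h)
        _ = H := by simp
    rcases H.eq_zero_or_pos with rfl | hH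
    · simp
    · rw [inv_mul_le_iff₀ (by positivity)]
      simpa using this
  norm_m_le ha := ha
  cs {g a} hg ha := by
    simp only [Set.mem_ofPred_eq, LinearMap.id_apply, norm_mul] at *
    rw [Complex.mul_conj']
    norm_cast
    rw [mul_pow]
    have := pow_le_one₀ (n := 2) (norm_nonneg _) hg
    nlinarith [sq_nonneg ‖a‖]

theorem exists_ne_of_le_av {H : ℕ} {c : ℝ} {φ : ℕ → ℕ → ℝ} (hφ : ∀ h h', φ h h' ≤ 1)
    (hH : 1 < c / 2 * H) (h : c ≤ av H fun h => av H fun h' => φ h h') :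
    ∃ h < H, ∃ h' < H, h ≠ h' ∧ c / 2 ≤ φ h h' := by
  by_contra! hcon
  have hH0 : 0 < H := Nat.pos_of_ne_zero fun h => by simp [h] at hH; linarith
  have hH1 : (0 : ℝ) < H := by exact_mod_cast hH0
  have h1 : (av H fun h => av H fun h' => φ h h') ≤
      av H fun h => av H fun h' => c / 2 + if h = h' then 1 else 0 := by
    refine av_mono fun h hh => av_mono fun h' hh' => ?_
    split_ifs with he
    · have hc : 0 < c / 2 := by
        by_contra! hc
        nlinarith
      linarith [hφ h h']
    · rw [add_zero]
      exact (hcon h hh h' hh' he).le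
  have h2 : (av H fun h => av H fun h' => c / 2 + if h = h' then 1 else 0) = c / 2 + 1 / H := by
    rw [← av_const hH0 (c / 2 + 1 / H)]
    refine le_antisymm (av_mono fun h hh => ?_) (av_mono fun h hh => ?_) <;>
    · rw [av_add, av_const hH0]
      simp [av, hh]
  have h3 : (1 : ℝ) / H < c / 2 := by rwa [div_lt_iff₀ hH1]
  linarith

theorem coeff_taylor_sub {d : ℕ} {Q : ℝ[X]} (hQ : Q.natDegree ≤ d + 1) (x y : ℝ) (n : ℕ) :
    (taylor x Q - taylor y Q).coeff n =
      ∑ i ∈ range (d + 1), (n + i + 1).choose n * Q.coeff (n + i + 1) *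
        (x ^ (i + 1) - y ^ (i + 1)) := by
  have h : ∀ z, (taylor z Q).coeff n =
      ∑ i ∈ range (d + 2), (n + i).choose n * Q.coeff (n + i) * z ^ i := fun z => by
    rw [taylor_coeff, eval_eq_sum_range' (n := d + 2)]
    · refine sum_congr rfl fun i _ => ?_
      rw [hasseDeriv_coeff, add_comm i n]
    · have := natDegree_hasseDeriv_le Q n
      omega
  rw [coeff_sub, h, h, ← sum_sub_distrib, sum_range_succ']
  simp only [pow_zero, sub_self, add_zero]
  refine sum_congr rfl fun i _ => ?_
  rw [← mul_sub]
  rfl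

theorem natDegree_taylor_sub_le {d : ℕ} {Q : ℝ[X]} (hQ : Q.natDegree ≤ d + 1) (x y : ℝ) :
    (taylor x Q - taylor y Q).natDegree ≤ d := by
  rw [natDegree_le_iff_coeff_eq_zero]
  intro n hn
  rw [coeff_taylor_sub hQ]
  refine sum_eq_zero fun i _ => ?_
  rw [coeff_eq_zero_of_natDegree_lt (p := Q) (by omega)]
  simp

theorem ints_of_taylor_sub {d : ℕ} {Q : ℝ[X]} (hQ : Q.natDegree ≤ d + 1) {h h' : ℕ}
    {q : ℕ} (hq : ∀ l, 1 ≤ l → q * (taylor (h : ℝ) Q - taylor (h' : ℝ) Q).coeff l ∈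
      (Int.castRingHom ℝ).range) (k j : ℕ) (hj : 2 ≤ j) (hjk : d + 2 ≤ j + k) :
    ((q * (d + 1).factorial * ((h - h' : ℤ).natAbs) : ℕ) : ℝ) ^ k * Q.coeff j ∈
      (Int.castRingHom ℝ).range := by
  induction k generalizing j with
  | zero =>
    rw [coeff_eq_zero_of_natDegree_lt (by omega), mul_zero]
    exact zero_mem _
  | succ k ih =>
    rcases lt_or_ge (d + 1) j with hd | hd
    · rw [coeff_eq_zero_of_natDegree_lt (by omega), mul_zero]
      exact zero_mem _
    obtain ⟨n, rfl⟩ := Nat.exists_eq_add_of_le' hj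
    set M : ℕ := q * (d + 1).factorial * ((h - h' : ℤ).natAbs) with hM
    have h1 := hq (n + 1) (by omega)
    rw [coeff_taylor_sub hQ, sum_range_succ'] at h1
    have hintg : ∀ z : ℤ, (z : ℝ) ∈ (Int.castRingHom ℝ).range := fun z => ⟨z, rfl⟩
    have h2 : ∑ i ∈ range d, ((n + 1 + (i + 1) + 1).choose (n + 1) : ℝ) *
        ((M : ℝ) ^ k * Q.coeff (n + 1 + (i + 1) + 1)) *
          ((h : ℝ) ^ (i + 1 + 1) - (h' : ℝ) ^ (i + 1 + 1)) ∈ (Int.castRingHom ℝ).range := by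
      refine sum_mem fun i _ => mul_mem (mul_mem ?_ (ih _ (by omega) (by omega))) ?_
      · exact_mod_cast hintg ((n + 1 + (i + 1) + 1).choose (n + 1) : ℕ)
      · exact_mod_cast hintg ((h : ℤ) ^ (i + 1 + 1) - (h' : ℤ) ^ (i + 1 + 1))
    have h3 := sub_mem (mul_mem (hintg ((M : ℤ) ^ k)) h1) (mul_mem (hintg q) h2)
    obtain ⟨e, he⟩ : n + 2 ∣ (d + 1).factorial := Nat.dvd_factorial (by omega) hd
    have h4 := mul_mem (hintg (e * (h - h' : ℤ).sign)) h3
    have habs : (((h - h' : ℤ).natAbs : ℕ) : ℝ) = ((h - h' : ℤ).sign : ℤ) * ((h : ℝ) - h') := by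
      have h5 := congrArg (Int.cast : ℤ → ℝ) (Int.sign_mul_self_eq_natAbs (h - h' : ℤ))
      push_cast at h5
      rw [Nat.cast_natAbs, h5]
      push_cast
      rfl
    have hch : (n + 1 + 0 + 1).choose (n + 1) = n + 2 := by
      simp [Nat.choose_succ_self_right]
    have hMr : (M : ℝ) = q * ((n + 2) * e) * (((h - h' : ℤ).sign : ℤ) * ((h : ℝ) - h')) := by
      rw [hM, he, ← habs]
      push_cast
      ring
    have hS : ∑ i ∈ range d, ((n + 1 + (i + 1) + 1).choose (n + 1) : ℝ) *
        ((M : ℝ) ^ k * Q.coeff (n + 1 + (i + 1) + 1)) *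
          ((h : ℝ) ^ (i + 1 + 1) - (h' : ℝ) ^ (i + 1 + 1)) =
        (M : ℝ) ^ k * ∑ i ∈ range d, ((n + 1 + (i + 1) + 1).choose (n + 1) : ℝ) *
        Q.coeff (n + 1 + (i + 1) + 1) *
          ((h : ℝ) ^ (i + 1 + 1) - (h' : ℝ) ^ (i + 1 + 1)) := by
      rw [mul_sum]
      exact sum_congr rfl fun i _ => by ring
    rw [hS, hch] at h4
    convert h4 using 1
    push_cast
    linear_combination (M : ℝ) ^ k * Q.coeff (n + 2) * hMr

/-- A weak form of Weyl's theorem for shift-invariant means. -/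
theorem weyl (E : Mean) (d : ℕ) {ε : ℝ} (hε : 0 < ε) :
    ∃ R : ℕ, ∀ Q : ℝ[X], Q.natDegree ≤ d → ε ≤ ‖E.L fun n => ex (Q.eval (n : ℝ))‖ →
      ∃ q : ℕ, 1 ≤ q ∧ q ≤ R ∧ ∀ l, 1 ≤ l → q * Q.coeff l ∈ (Int.castRingHom ℝ).range := by
  induction d generalizing ε with
  | zero =>
    refine ⟨1, fun Q hQ _ => ⟨1, le_rfl, le_rfl, fun l hl => ?_⟩⟩
    rw [coeff_eq_zero_of_natDegree_lt (by omega), mul_zero]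
    exact zero_mem _
  | succ d ih =>
    obtain ⟨R, hR⟩ := ih (ε := ε ^ 2 / 2) (by positivity)
    obtain ⟨H, hH⟩ := exists_nat_gt (1 / (ε ^ 2 / 2))
    rw [div_lt_iff₀' (by positivity)] at hH
    refine ⟨(R * (d + 1).factorial * H) ^ d, fun Q hQ hle => ?_⟩
    have hH0 : 0 < H := Nat.pos_of_ne_zero fun h => by simp [h] at hH; linarith
    have hvdc := PreSys.point.vdC E (f := 1) (U := fun n => ex (Q.eval (n : ℝ)))
      PreSys.point.one_mem (fun n => (norm_ex _).le) hH0
    simp only [one_mul] at hvdc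
    obtain ⟨h, hh, h', hh', hne, hle'⟩ := exists_ne_of_le_av (fun h h' => E.norm_le _ fun n => by
      refine PreSys.point.norm_m_le (PreSys.point.mul_mem ?_ (PreSys.point.conj_mem ?_)) <;>
      exact (norm_ex _).le) hH ((pow_le_pow_left₀ hε.le hle 2).trans hvdc)
    obtain ⟨q, hq1, hqR, hq⟩ := hR (taylor (h : ℝ) Q - taylor (h' : ℝ) Q)
      (natDegree_taylor_sub_le hQ _ _) (by
        refine hle'.trans (le_of_eq ?_)
        congr 3
        funext n
        rw [eval_sub, taylor_eval, taylor_eval, sub_eq_add_neg, ex_add, ex_neg]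
        push_cast
        rfl)
    set M : ℕ := q * (d + 1).factorial * ((h - h' : ℤ).natAbs) with hM
    have hintg := ints_of_taylor_sub hQ hq d
    rw [← hM] at hintg
    have hM1 : 1 ≤ M := by
      have : 0 < (h - h' : ℤ).natAbs := by omega
      have := Nat.factorial_pos (d + 1)
      rw [hM]
      exact Nat.succ_le_of_lt (by positivity)
    refine ⟨M ^ d, Nat.one_le_pow _ _ hM1, Nat.pow_le_pow_left ?_ d, fun l hl => ?_⟩
    · rw [hM]
      gcongr
      omega
    rcases Nat.lt_or_ge l 2 with hl2 | hl2
    swap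
    · exact_mod_cast hintg l hl2 (by omega)
    obtain rfl : l = 1 := by omega
    set K : ℕ := M ^ d with hK
    have hper : ∀ n : ℕ, ex (Q.eval ((n + K : ℕ) : ℝ)) =
        ex (K * Q.coeff 1) * ex (Q.eval (n : ℝ)) := by
      intro n
      have : ex (Q.eval ((n + K : ℕ) : ℝ) - Q.eval (n : ℝ) - K * Q.coeff 1) = 1 := by
        rw [ex_eq_one_iff, eval_eq_sum_range' (n := d + 2) (by omega),
          eval_eq_sum_range' (n := d + 2) (by omega), ← sum_sub_distrib, sum_range_succ',
          sum_range_succ']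
        have h2 : ∑ i ∈ range d, (Q.coeff (i + 1 + 1) * ((n + K : ℕ) : ℝ) ^ (i + 1 + 1) -
            Q.coeff (i + 1 + 1) * (n : ℝ) ^ (i + 1 + 1)) ∈ (Int.castRingHom ℝ).range := by
          refine sum_mem fun i _ => ?_
          obtain ⟨z, hz⟩ := sub_dvd_pow_sub_pow ((n + K : ℕ) : ℤ) n (i + 1 + 1)
          have hz' := congrArg (Int.cast : ℤ → ℝ) hz
          push_cast at hz'
          have h3 := mul_mem (hintg (i + 1 + 1) (by omega) (by omega))
            (⟨z, rfl⟩ : (z : ℝ) ∈ (Int.castRingHom ℝ).range)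
          convert h3 using 1
          push_cast
          rw [← mul_sub, hz', hK]
          push_cast
          ring
        convert h2 using 1
        push_cast
        ring
      rw [← one_mul (_ * _), ← this, ← ex_add, ← ex_add]
      congr 1
      ring
    have hs := E.shift_add (u := fun n => ex (Q.eval (n : ℝ))) (fun n => (norm_ex _).le) K
    simp only [hper] at hs
    rw [E.const_mul] at hs
    have h0 : (E.L fun n => ex (Q.eval (n : ℝ))) ≠ 0 := by
      intro h0
      rw [h0, norm_zero] at hle
      linarith
    exact ex_eq_one_iff.1 (mul_right_cancel₀ h0 (hs.trans (one_mul _).symm))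

end PolyConfig

namespace PolyConfig

open Polynomial

/-- A polynomial family without integer affine relations. -/
def AffIndep {ι : Type*} [Fintype ι] (P : ι → ℤ[X]) : Prop :=
  (∀ i, (P i).coeff 0 = 0) ∧
    ∀ c : ι → ℤ, ∑ i, c i = 0 → ∑ i, c i • P i = 0 → c = 0

theorem AffIndep.injective {ι : Type*} [Fintype ι] {P : ι → ℤ[X]} (hP : AffIndep P) :
    Function.Injective P := by
  classical
  intro a b hab
  by_contra hne
  have := congrFun (hP.2 (fun i => (if i = a then 1 else 0) - if i = b then 1 else 0)
    (by simp [sum_sub_distrib]) (by simp [sub_smul, sum_sub_distrib, ite_smul, hab])) a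
  simp [hne] at this

theorem exists_int_dual {J : Type*} [Fintype J] [DecidableEq J] {K : ℕ} {v : J → Fin K → ℤ}
    (hv : ∀ c : J → ℤ, (∀ l, ∑ j, c j * v j l = 0) → c = 0) :
    ∃ D : ℕ, 1 ≤ D ∧ ∃ b : J → Fin K → ℤ, ∀ i j,
      ∑ l, b i l * v j l = if i = j then (D : ℤ) else 0 := by
  let w : J → Fin K → ℚ := fun j l => v j l
  have hw : LinearIndependent ℚ w := by
    rw [← LinearIndependent.iff_fractionRing ℤ ℚ, Fintype.linearIndependent_iff]
    intro c hc
    refine congrFun (hv c fun l => ?_)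
    have := congrFun hc l
    simp only [Finset.sum_apply, w, zsmul_eq_mul, Pi.zero_apply, Pi.mul_apply,
      Pi.intCast_apply] at this
    exact_mod_cast this
  obtain ⟨g, hg⟩ := LinearMap.exists_leftInverse_of_injective (Fintype.linearCombination ℚ w)
    (LinearMap.ker_eq_bot.2 (hw.fintypeLinearCombination_injective))
  have hgw : ∀ i j, ∑ l, g (Pi.single l 1) i * v j l = if i = j then 1 else 0 := by
    intro i j
    have h1 := congrFun (LinearMap.congr_fun hg (Pi.single j 1)) i
    rw [LinearMap.comp_apply, Fintype.linearCombination_apply_single, one_smul,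
      LinearMap.id_apply, Pi.single_apply, LinearMap.pi_apply_eq_sum_univ g, Finset.sum_apply] at h1
    rw [← h1]
    refine sum_congr rfl fun l _ => ?_
    rw [Pi.smul_apply, smul_eq_mul, mul_comm]
    congr 1
    refine congrFun (congrArg g (funext fun l' => ?_)) i
    simp [Pi.single_apply, eq_comm]
  obtain ⟨D, hD⟩ := IsLocalization.exist_integer_multiples_of_finite (nonZeroDivisors ℤ)
    fun x : J × Fin K => g (Pi.single x.2 1) x.1
  choose b hb using hD
  have hD0 : (D : ℤ) ≠ 0 := nonZeroDivisors.ne_zero D.2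
  refine ⟨(D : ℤ).natAbs, by omega, fun i l => (D : ℤ).sign * b (i, l), fun i j => ?_⟩
  have h2 : ∀ i l, ((b (i, l) : ℤ) : ℚ) = (D : ℤ) * g (Pi.single l 1) i := fun i l => by
    have := hb (i, l)
    rw [algebraMap_int_eq, eq_intCast] at this
    rw [this, zsmul_eq_mul]
  have h3 : ∑ l, b (i, l) * v j l = if i = j then (D : ℤ) else 0 := by
    have : ((∑ l, b (i, l) * v j l : ℤ) : ℚ) = (D : ℤ) * if i = j then 1 else 0 := by
      rw [← hgw i j, mul_sum]
      push_cast
      exact sum_congr rfl fun l _ => by rw [h2, mul_assoc]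
    split_ifs at this ⊢ with h
    · exact_mod_cast this.trans (mul_one _)
    · exact_mod_cast this.trans (mul_zero _)
  simp only [mul_assoc, ← mul_sum, h3]
  split_ifs
  · rw [Int.sign_mul_self_eq_natAbs]
  · rw [mul_zero]

theorem AffIndep.exists_dual {ι : Type*} [Fintype ι] [DecidableEq ι] {P : ι → ℤ[X]}
    (hP : AffIndep P) (e : ι) :
    ∃ D : ℕ, 1 ≤ D ∧ ∃ K, ∃ b : ι → ℕ → ℤ, ∀ i ≠ e, ∀ j ≠ e,
      ∑ l ∈ range K, b i l * (P j - P e).coeff (l + 1) = if i = j then (D : ℤ) else 0 := by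
  obtain ⟨d, hd⟩ : ∃ d, ∀ j, (P j - P e).natDegree ≤ d :=
    ⟨univ.sup fun j => (P j - P e).natDegree, fun j => le_sup (f := fun j =>
      (P j - P e).natDegree) (mem_univ j)⟩
  obtain ⟨D, hD, b, hb⟩ := exists_int_dual (J := {j // j ≠ e}) (K := d)
    (v := fun j l => (P j - P e).coeff (l + 1)) (by
    intro c hc
    have h0 : ∑ j : {j // j ≠ e}, c j • (P j - P e) = 0 := by
      ext l
      rw [finsetSum_coeff, coeff_zero]
      rcases l with _ | l
      · exact sum_eq_zero fun j _ => by simp [hP.1]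
      · rcases lt_or_ge l d with hl | hl
        · simpa using hc ⟨l, hl⟩
        · refine sum_eq_zero fun j _ => ?_
          rw [coeff_smul, coeff_eq_zero_of_natDegree_lt (by have := hd j; omega), smul_zero]
    have hsum : ∀ {M : Type} [AddCommMonoid M] (g : ι → M),
        ∑ j, g j = g e + ∑ j : {j // j ≠ e}, g j := fun g => by
      rw [← add_sum_erase _ _ (mem_univ e)]
      congr 1
      exact sum_subtype (univ.erase e) (fun j => by simp) g
    obtain ⟨c', hce, hcj⟩ : ∃ c' : ι → ℤ, c' e = -∑ j, c j ∧ ∀ j : {j // j ≠ e}, c' j = c j :=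
      ⟨fun i => if h : i = e then -∑ j, c j else c ⟨i, h⟩, by simp, fun j => by simp [j.2]⟩
    have h1 := hP.2 c' (by simp only [hsum, hce, hcj, neg_add_cancel]) (by
      simp only [smul_sub, sum_sub_distrib, ← sum_smul, sub_eq_zero] at h0
      simp only [hsum, hce, hcj, h0, neg_smul, neg_add_cancel])
    ext j
    rw [← hcj, h1]
    rfl)
  refine ⟨D, hD, d, fun i l => if h : i ≠ e ∧ l < d then b ⟨i, h.1⟩ ⟨l, h.2⟩ else 0,
    fun i hi j hj => ?_⟩
  have := hb ⟨i, hi⟩ ⟨j, hj⟩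
  simp only [Subtype.mk.injEq] at this
  rw [← this, Finset.sum_range]
  refine sum_congr rfl fun l _ => ?_
  beta_reduce
  rw [dif_pos ⟨hi, l.2⟩]

variable {A : Type*} [CommRing A] [Algebra ℂ A] {ι : Type*} [Fintype ι] [DecidableEq ι]

namespace Sys

variable (S : Sys A) (E : Mean)

/-- Averages of multicorrelations along an indexed family of polynomials. -/
noncomputable def corr (P : ι → ℤ[X]) (f : ι → A) : ℂ :=
  E.L fun n => S.m (∏ i, S.τ ((P i).eval (n : ℤ)) (f i))

/-- The product of all functions but one, seen from the frame of that one. -/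
noncomputable def rest (P : ι → ℤ[X]) (e : ι) (f : ι → A) (n : ℕ) : A :=
  ∏ i ∈ univ.erase e, S.τ ((P i - P e).eval (n : ℤ)) (f i)

theorem rest_mem (P : ι → ℤ[X]) (e : ι) {f : ι → A} (hf : ∀ i, f i ∈ S.B) (n : ℕ) :
    S.rest P e f n ∈ S.B :=
  S.prod_mem _ _ fun _ _ => S.τ_mem _ (hf _)

theorem m_prod_eq (P : ι → ℤ[X]) (e : ι) (f : ι → A) (n : ℕ) :
    S.m (∏ i, S.τ ((P i).eval (n : ℤ)) (f i)) = S.m (S.rest P e f n * f e) := by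
  rw [← S.m_τ ((P e).eval (n : ℤ)) (S.rest P e f n * f e), map_mul, rest, map_prod (S.τ _),
    ← prod_erase_mul univ _ (mem_univ e)]
  congr 2
  refine prod_congr rfl fun i _ => ?_
  rw [← S.τ_add, eval_sub, add_sub_cancel]

theorem corr_eq (P : ι → ℤ[X]) (e : ι) (f : ι → A) :
    S.corr E P f = E.L fun n => S.m (S.rest P e f n * f e) := by
  simp only [corr, S.m_prod_eq P e]

theorem rest_update (P : ι → ℤ[X]) (e : ι) (f : ι → A) (a : A) (n : ℕ) :
    S.rest P e (Function.update f e a) n = S.rest P e f n :=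
  prod_congr rfl fun i hi => by rw [Function.update_of_ne (ne_of_mem_erase hi)]

theorem corr_update (P : ι → ℤ[X]) (e : ι) (f : ι → A) (a : A) :
    S.corr E P (Function.update f e a) = E.L fun n => S.m (S.rest P e f n * a) := by
  simp only [S.corr_eq E P e, rest_update, Function.update_self]

theorem exists_corr_control {P : ι → ℤ[X]} (hP : Function.Injective P)
    (hP0 : ∀ i, (P i).coeff 0 = 0) {i j : ι} (hij : j ≠ i) {ε : ℝ} (hε : 0 < ε) :
    ∃ s, ∃ c > 0, ∀ f : ι → A, (∀ j, f j ∈ S.B) → ε ≤ ‖S.corr E P f‖ → S.U s c (f i) := by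
  classical
  obtain ⟨e, he, hmax⟩ := exists_max_image (univ.erase i) (fun j => (P i - P j).natDegree)
    ⟨j, mem_erase.2 ⟨hij, mem_univ _⟩⟩
  set Q : ι → ℤ[X] := fun j => P j - P e with hQ
  have hQi : Function.Injective Q := fun a b hab => hP (sub_left_injective hab)
  have hie : i ≠ e := (ne_of_mem_erase he).symm
  obtain ⟨s, c, hc, h⟩ := S.exists_control E ((univ.erase e).image Q) (m := Q i) (by
      intro q hq
      obtain ⟨j, hj, rfl⟩ := mem_image.1 hq
      exact ⟨sub_ne_zero.2 fun h => ne_of_mem_erase hj (hP h), by simp [hQ, hP0]⟩)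
    (mem_image_of_mem _ (mem_erase.2 ⟨hie, mem_univ _⟩)) (by
      intro q hq
      obtain ⟨j, hj, rfl⟩ := mem_image.1 hq
      rcases eq_or_ne j i with rfl | hji
      · rfl
      · have h1 : Q j = (P i - P e) - (P i - P j) := by rw [hQ]; ring
        rw [h1]
        exact (natDegree_sub_le _ _).trans
          (max_le le_rfl (hmax j (mem_erase.2 ⟨hji, mem_univ _⟩)))) hε
  refine ⟨s, c, hc, fun f hf hle => ?_⟩
  have h1 := h (f e) (hf e) (Function.extend Q f 1) (fun q => by
    by_cases hq : ∃ j, Q j = q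
    · obtain ⟨j, rfl⟩ := hq
      rw [hQi.extend_apply]
      exact hf j
    · rw [Function.extend_apply' _ _ _ hq]
      exact S.one_mem) (by
    refine hle.trans (le_of_eq ?_)
    rw [S.corr_eq E P e, form]
    congr 2
    funext n
    rw [mul_comm, rest, prod_image fun a _ b _ hab => hQi hab]
    congr 2
    exact prod_congr rfl fun j _ => by rw [hQi.extend_apply])
  rwa [hQi.extend_apply] at h1

variable {S}

theorem Eig.eq_one {χ : A} {z : ℂ} (h : S.Eig χ z) (h0 : S.m χ ≠ 0) : z = 1 := by
  have h1 := S.m_τ 1 χ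
  rw [h.2.2.2, zpow_one, map_smul, smul_eq_mul] at h1
  exact mul_right_cancel₀ h0 (h1.trans (one_mul _).symm)

end Sys

namespace ErgSys

variable (S : ErgSys A) (E : Mean)

theorem degree_lowering_iterate (R : ℝ → ℕ) (t : ℕ) {c : ℝ} (hc : 0 < c) :
    ∃ c' > 0, ∀ (F : ℕ → A) (f : A), (∀ n, F n ∈ S.B) → f ∈ S.B →
      (∀ a ∈ S.B, S.m (f * a) = E.L fun n => S.m (F n * a)) →
      (∀ η > 0, ∀ (k k' : List ℕ) (χ : A) (z : ℂ), k.length = k'.length → S.Eig χ z →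
        η ≤ ‖E.L fun n => S.m (S.D k k' (F n) * χ)‖ → ∃ r, 1 ≤ r ∧ r ≤ R η ∧ z ^ r = 1) →
      S.U (t + 1) c f → S.U 1 c' f := by
  induction t generalizing c with
  | zero => exact ⟨c, hc, fun F f _ _ _ _ h => h⟩
  | succ t ih =>
    obtain ⟨c₁, hc₁, h₁⟩ := S.degree_lowering E R t hc
    obtain ⟨c₂, hc₂, h₂⟩ := ih hc₁
    exact ⟨c₂, hc₂, fun F f hF hf hd ha hU => h₂ F f hF hf hd ha (h₁ F f hF hf hd ha hU)⟩

/-- If the correlation is large and all functions but one are eigenfunctions, then the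
eigenvalues have bounded order. -/
theorem exists_ratEig_base {P : ι → ℤ[X]} (hP : AffIndep P) (e i : ι) {ε : ℝ} (hε : 0 < ε) :
    ∃ R : ℕ, ∀ f : ι → A, (∀ j, f j ∈ S.B) → (∀ j ≠ e, ∃ z, S.Eig (f j) z) →
      ε ≤ ‖S.corr E P f‖ →
      ∃ χ z r, S.Eig χ z ∧ 1 ≤ r ∧ r ≤ R ∧ z ^ r = 1 ∧ S.m (f i * χ) ≠ 0 := by
  obtain ⟨D, hD, K, b, hb⟩ := hP.exists_dual e
  obtain ⟨d, hd⟩ : ∃ d, ∀ j, (P j - P e).natDegree ≤ d :=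
    ⟨univ.sup fun j => (P j - P e).natDegree, fun j => le_sup (f := fun j =>
      (P j - P e).natDegree) (mem_univ j)⟩
  obtain ⟨R, hR⟩ := weyl E d hε
  refine ⟨R * D, fun f hf hfe hle => ?_⟩
  choose! z hz using hfe
  have hx : ∀ j, ∃ x, j ≠ e → ex x = z j := fun j => by
    by_cases hj : j = e
    · exact ⟨0, fun h => absurd hj h⟩
    · obtain ⟨x, hx⟩ := exists_ex_eq (hz j hj).2.2.1
      exact ⟨x, fun _ => hx⟩
  choose x hx using hx
  set Q : ℝ[X] := ∑ j ∈ univ.erase e, C (x j) * (P j - P e).map (Int.castRingHom ℝ) with hQ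
  have hQd : Q.natDegree ≤ d := natDegree_sum_le_of_forall_le _ _ fun j _ =>
    (natDegree_C_mul_le _ _).trans (natDegree_map_le.trans (hd j))
  have hQc : ∀ l, Q.coeff l = ∑ j ∈ univ.erase e, x j * ((P j - P e).coeff l : ℤ) := by
    intro l
    rw [hQ, finsetSum_coeff]
    refine sum_congr rfl fun j _ => ?_
    rw [coeff_C_mul, coeff_map]
    rfl
  set χ : A := ∏ j ∈ univ.erase e, f j with hχ
  have hrest : ∀ n : ℕ, S.rest P e f n = ex (Q.eval (n : ℝ)) • χ := by
    intro n
    rw [Sys.rest, hQ, eval_finsetSum, ex_sum, hχ, ← prod_smul]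
    refine prod_congr rfl fun j hj => ?_
    have hj := ne_of_mem_erase hj
    rw [(hz j hj).2.2.2, ← hx j hj, ← ex_int_mul, eval_mul, eval_C, mul_comm]
    congr 3
    rw [eval_natCast_map]
    simp
  have hcorr : S.corr E P f = S.m (χ * f e) * E.L fun n => ex (Q.eval (n : ℝ)) := by
    rw [S.corr_eq E P e, ← E.const_mul]
    congr 1
    funext n
    rw [hrest, smul_mul_assoc, map_smul, smul_eq_mul, mul_comm]
  rw [hcorr, norm_mul] at hle
  have hχe : S.Eig χ (∏ j ∈ univ.erase e, z j) :=
    Sys.Eig.prod _ fun j hj => hz j (ne_of_mem_erase hj)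
  have hm0 : S.m (χ * f e) ≠ 0 := fun h0 => by
    rw [h0, norm_zero, zero_mul] at hle
    linarith
  obtain ⟨q, hq1, hqR, hq⟩ := hR Q hQd (hle.trans (mul_le_of_le_one_left (norm_nonneg _)
    (S.norm_m_le (S.mul_mem hχe.1 (hf e)))))
  have hz1 : ∀ j ≠ e, z j ^ (q * D) = 1 := by
    intro j hj
    have h1 : ∑ l ∈ range K, (b j l : ℝ) * (q * Q.coeff (l + 1)) ∈ (Int.castRingHom ℝ).range :=
      sum_mem fun l _ => mul_mem ⟨b j l, rfl⟩ (hq _ (by omega))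
    have h2 : ∑ l ∈ range K, (b j l : ℝ) * (q * Q.coeff (l + 1)) = ((q * D : ℕ) : ℤ) * x j := by
      simp only [hQc, mul_sum]
      rw [sum_comm]
      have h3 : ∀ j' ∈ univ.erase e, ∑ l ∈ range K,
          (b j l : ℝ) * (q * (x j' * ((P j' - P e).coeff (l + 1) : ℤ))) =
          if j = j' then q * x j' * D else 0 := by
        intro j' hj'
        have h4 := congrArg (Int.cast : ℤ → ℝ) (hb j hj j' (ne_of_mem_erase hj'))
        push_cast at h4
        calc _ = q * x j' * ∑ l ∈ range K, (b j l : ℝ) * ((P j' - P e).coeff (l + 1) : ℤ) := by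
              rw [mul_sum]
              exact sum_congr rfl fun l _ => by ring
          _ = _ := by
              rw [h4]
              split_ifs <;> ring
      rw [sum_congr rfl h3, sum_ite_eq, if_pos (mem_erase.2 ⟨hj, mem_univ _⟩)]
      push_cast
      ring
    rw [h2, ← ex_eq_one_iff, ex_int_mul, hx j hj] at h1
    exact_mod_cast h1
  have hqD : 1 ≤ q * D ∧ q * D ≤ R * D := ⟨Nat.mul_pos hq1 hD, Nat.mul_le_mul_right _ hqR⟩
  by_cases hie : i = e
  · subst hie
    refine ⟨χ, _, q * D, hχe, hqD.1, hqD.2, ?_, by rwa [mul_comm]⟩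
    rw [← prod_pow]
    exact prod_eq_one fun j hj => hz1 j (ne_of_mem_erase hj)
  · refine ⟨_, _, q * D, (hz i hie).conj, hqD.1, hqD.2, ?_, ?_⟩
    · rw [← star_pow, hz1 i hie, star_one]
    · rw [(hz i hie).2.1, S.m_one]
      exact one_ne_zero

/-- Large correlations detect eigenfunctions of bounded order. -/
theorem exists_ratEig {P : ι → ℤ[X]} (hP : AffIndep P) {T : Finset ι} (hT : T.Nonempty) (i : ι)
    {ε : ℝ} (hε : 0 < ε) :
    ∃ R : ℕ, ∀ f : ι → A, (∀ j, f j ∈ S.B) → (∀ j ∉ T, ∃ z, S.Eig (f j) z) →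
      ε ≤ ‖S.corr E P f‖ →
      ∃ χ z r, S.Eig χ z ∧ 1 ≤ r ∧ r ≤ R ∧ z ^ r = 1 ∧ S.m (f i * χ) ≠ 0 := by
  induction hT using Finset.Nonempty.strong_induction generalizing i ε with
  | h₀ e =>
    obtain ⟨R, hR⟩ := S.exists_ratEig_base E hP e i hε
    exact ⟨R, fun f hf hfe => hR f hf fun j hj => hfe j (by simpa using hj)⟩
  | @h₁ T hT ih =>
    obtain ⟨e, heT, hei⟩ := hT.exists_ne i
    have hTe : (T.erase e).Nonempty := hT.erase_nonempty
    replace ih := fun i (ε : ℝ) (hε : 0 < ε) => ih (T.erase e) hTe (erase_ssubset heT) i hε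
    have hR : ∀ η : ℝ, ∃ R : ℕ, 0 < η → ∀ f : ι → A, (∀ j, f j ∈ S.B) →
        (∀ j ∉ T.erase e, ∃ z, S.Eig (f j) z) → η ≤ ‖S.corr E P f‖ →
        ∃ χ z r, S.Eig χ z ∧ 1 ≤ r ∧ r ≤ R ∧ z ^ r = 1 ∧ S.m (f e * χ) ≠ 0 := fun η => by
      by_cases hη : 0 < η
      · obtain ⟨R, hR⟩ := ih e η hη
        exact ⟨R, fun _ => hR⟩
      · exact ⟨0, fun h => absurd h hη⟩
    choose R hR using hR
    obtain ⟨s, c, hc, hcontrol⟩ := S.exists_corr_control E hP.injective hP.1 hei.symm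
      (pow_pos hε 2)
    obtain ⟨c₁, hc₁, hraise⟩ := S.exists_U_of_le (Nat.le_succ s) hc
    obtain ⟨c₂, hc₂, hlower⟩ := S.degree_lowering_iterate E R s hc₁
    obtain ⟨R', hR'⟩ := ih i (c₂ / 2) (by positivity)
    refine ⟨R', fun f hf hfT hle => ?_⟩
    obtain ⟨g, hg, -, hgm⟩ := S.dual E.L E.norm_le E.one (S.rest P e f) (S.rest_mem P e hf)
    have hcorr : ∀ a ∈ S.B, S.m (g * a) = S.corr E P (Function.update f e a) := fun a ha => by
      rw [hgm a ha, S.corr_update]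
    have h1 : ε ^ 2 ≤ ‖S.corr E P (Function.update f e (S.conj g))‖ := by
      rw [← hcorr _ (S.conj_mem hg)]
      refine le_trans ?_ (Complex.re_le_norm _)
      refine le_trans (pow_le_pow_left₀ hε.le ?_ 2) (S.cs (hf e) hg)
      rwa [mul_comm, hcorr _ (hf e), Function.update_eq_self]
    have h2 := hcontrol _ (fun j => by
      rcases eq_or_ne j e with rfl | hj
      · rw [Function.update_self]
        exact S.conj_mem hg
      · rw [Function.update_of_ne hj]
        exact hf j) h1
    rw [Function.update_self, S.U_conj] at h2
    have h3 := hlower _ g (S.rest_mem P e hf) hg hgm (by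
      intro η hη k k' χ z hk hχ hle
      have hD : ∀ n, S.D k k' (S.rest P e f n) = S.rest P e (fun j => S.D k k' (f j)) n := by
        intro n
        rw [Sys.rest, S.D_prod]
        exact prod_congr rfl fun j _ => S.D_τ hk _ _
      simp only [hD] at hle
      rw [← S.corr_update] at hle
      obtain ⟨χ', z', r, hχ', hr1, hrR, hz', hm⟩ := hR η hη _ (fun j => by
        rcases eq_or_ne j e with rfl | hj
        · rw [Function.update_self]
          exact hχ.1
        · rw [Function.update_of_ne hj]
          exact S.D_mem (hf j) k k') (fun j hjT => by
        rcases eq_or_ne j e with rfl | hj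
        · rw [Function.update_self]
          exact ⟨z, hχ⟩
        · rw [Function.update_of_ne hj]
          obtain ⟨w, hw⟩ := hfT j fun h => hjT (mem_erase.2 ⟨hj, h⟩)
          exact hw.D hk) hle
      rw [Function.update_self] at hm
      have h4 := (hχ.mul hχ').eq_one hm
      refine ⟨r, hr1, hrR, ?_⟩
      have h5 := congrArg (· ^ r) h4
      simpa [mul_pow, hz'] using h5) (hraise g hg h2)
    obtain ⟨χ, z, hχ, hle'⟩ := S.inverse g hg c₂ hc₂ (Frequently.of_forall fun n =>
      h3 _ rfl (by simp [Nat.factorial_pos]))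
    rw [hcorr χ hχ.1] at hle'
    obtain ⟨χ', z', r, h⟩ := hR' _ (fun j => by
        rcases eq_or_ne j e with rfl | hj
        · rw [Function.update_self]
          exact hχ.1
        · rw [Function.update_of_ne hj]
          exact hf j) (fun j hjT => by
        rcases eq_or_ne j e with rfl | hj
        · rw [Function.update_self]
          exact ⟨z, hχ⟩
        · rw [Function.update_of_ne hj]
          exact hfT j fun h => hjT (mem_erase.2 ⟨hj, h⟩)) hle'
    rw [Function.update_of_ne hei.symm] at h
    exact ⟨χ', z', r, h⟩

/-- The correlation vanishes if one of the functions is orthogonal to all eigenfunctions whose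
eigenvalues are roots of unity. -/
theorem corr_eq_zero {P : ι → ℤ[X]} (hP : AffIndep P) {f : ι → A} (hf : ∀ j, f j ∈ S.B) (i : ι)
    (h : ∀ χ z r, S.Eig χ z → 1 ≤ r → z ^ r = 1 → S.m (f i * χ) = 0) : S.corr E P f = 0 := by
  by_contra h0
  obtain ⟨R, hR⟩ := S.exists_ratEig E hP ⟨i, mem_univ i⟩ i (norm_pos_iff.2 h0)
  obtain ⟨χ, z, r, h1, h2, -, h3, h4⟩ := hR f hf (fun j hj => absurd (mem_univ j) hj) le_rfl
  exact h4 (h χ z r h1 h2 h3)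

end ErgSys

end PolyConfig

namespace PolyConfig

open Polynomial Topology

theorem Mean.norm_le_of_le (E : Mean) {u : ℕ → ℂ} {c : ℝ} (hc : 0 < c) (h : ∀ n, ‖u n‖ ≤ c) :
    ‖E.L u‖ ≤ c := by
  have h1 := E.norm_le (fun n => (c : ℂ)⁻¹ * u n) fun n => by
    rw [norm_mul, norm_inv, Complex.norm_real, Real.norm_of_nonneg hc.le, inv_mul_le_iff₀ hc,
      mul_one]
    exact h n
  rwa [E.const_mul, norm_mul, norm_inv, Complex.norm_real, Real.norm_of_nonneg hc.le,
    inv_mul_le_iff₀ hc, mul_one] at h1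

theorem Mean.sub (E : Mean) (u v : ℕ → ℂ) : E.L (fun n => u n - v n) = E.L u - E.L v :=
  map_sub E.L u v

theorem Mean.eq_of_tendsto (E : Mean) {u : ℕ → ℂ} (hu : ∀ n, ‖u n‖ ≤ 1) {c : ℂ}
    (h : Tendsto u atTop (𝓝 c)) : E.L u = c := by
  rw [← sub_eq_zero, ← norm_le_zero_iff]
  refine le_of_forall_pos_le_add fun η hη => ?_
  obtain ⟨N, hN⟩ := Metric.tendsto_atTop.1 h η hη
  rw [zero_add, ← E.shift_add hu N]
  have hc := E.sub (fun n => u (n + N)) fun _ => c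
  rw [E.const] at hc
  rw [← hc]
  refine E.norm_le_of_le hη fun n => ?_
  rw [← dist_eq_norm]
  exact (hN _ (Nat.le_add_left _ _)).le

namespace PreSys

variable {A : Type*} [CommRing A] [Algebra ℂ A] (S : PreSys A)

theorem half_sub_mem {a b : A} (ha : a ∈ S.B) (hb : b ∈ S.B) : (2 : ℂ)⁻¹ • (a - b) ∈ S.B := by
  have := S.avg_mem 2 (fun h => if h = 0 then 1 else -1) (fun h => if h = 0 then a else b)
    (fun h => by split_ifs <;> simp) (fun h => by split_ifs <;> assumption)
  simpa [sum_range_succ, sub_eq_add_neg] using this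

theorem m_mul_conj_nonneg {a : A} (ha : a ∈ S.B) : 0 ≤ (S.m (a * S.conj a)).re :=
  (sq_nonneg _).trans (S.cs S.one_mem ha)

theorem m_sub_mul_conj (a b : A) :
    S.m ((2 : ℂ)⁻¹ • (a - b) * S.conj ((2 : ℂ)⁻¹ • (a - b))) =
      (S.m (a * S.conj a) - S.m (a * S.conj b) - S.m (b * S.conj a) + S.m (b * S.conj b)) / 4 := by
  rw [S.conj_smul, smul_mul_smul_comm, map_smul, map_sub S.conj,
    show (a - b) * (S.conj a - S.conj b) =
      a * S.conj a - a * S.conj b - b * S.conj a + b * S.conj b by ring, map_add, map_sub, map_sub]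
  simp
  ring

theorem norm_m_mul_sub_le {a b : A} (ha : a ∈ S.B) (hb : b ∈ S.B) {β : ℝ} (hβ : 0 ≤ β)
    (h : (S.m (a * S.conj a) - S.m (a * S.conj b) - S.m (b * S.conj a) +
      S.m (b * S.conj b)).re ≤ β ^ 2) {d : A} (hd : d ∈ S.B) : ‖S.m (d * (a - b))‖ ≤ β := by
  have h1 := S.cs hd (S.half_sub_mem ha hb)
  rw [m_sub_mul_conj, mul_smul_comm, map_smul, norm_smul] at h1
  rw [Complex.div_ofNat_re] at h1
  rw [norm_inv, Complex.norm_ofNat] at h1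
  refine le_of_sq_le_sq ?_ hβ
  nlinarith

theorem norm_m_prod_sub_le {ι : Type*} (s : Finset ι) {b c : ι → A} (hb : ∀ i, b i ∈ S.B)
    (hc : ∀ i, c i ∈ S.B) {β : ℝ} (h : ∀ i, ∀ d ∈ S.B, ‖S.m (d * (b i - c i))‖ ≤ β) {d : A}
    (hd : d ∈ S.B) : ‖S.m (d * (∏ i ∈ s, b i - ∏ i ∈ s, c i))‖ ≤ #s * β := by
  classical
  induction s using Finset.induction_on generalizing d with
  | empty => simp
  | insert i s hi ih =>
    rw [prod_insert hi, prod_insert hi, card_insert_of_notMem hi,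
      show d * (b i * ∏ i ∈ s, b i - c i * ∏ i ∈ s, c i) =
        (d * ∏ i ∈ s, b i) * (b i - c i) + (d * c i) * (∏ i ∈ s, b i - ∏ i ∈ s, c i) by ring,
      map_add]
    refine (norm_add_le _ _).trans ?_
    have h1 := h i _ (S.mul_mem hd (S.prod_mem s b fun i _ => hb i))
    have h2 := ih (S.mul_mem hd (hc i))
    push_cast
    linarith

end PreSys

variable {A : Type*} [CommRing A] [Algebra ℂ A]

theorem Sys.τ_mul_of_invariant (S : Sys A) {r : ℤ} {a : A} (h : S.τ r a = a) (j : ℤ) :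
    S.τ (r * j) a = a := by
  have hneg : S.τ (-r) a = a := by
    nth_rewrite 1 [← h]
    rw [← S.τ_add, neg_add_cancel, S.τ_zero]
  induction j using Int.induction_on with
  | zero => rw [mul_zero, S.τ_zero]
  | succ i ih => rw [mul_add, mul_one, S.τ_add, h, ih]
  | pred i ih => rw [mul_sub, mul_one, sub_eq_add_neg, S.τ_add, hneg, ih]

namespace ErgSys

variable (S : ErgSys A)

theorem eq_of_m_mul {a b : A} (ha : a ∈ S.B) (hb : b ∈ S.B)
    (h : ∀ c ∈ S.B, S.m (a * c) = S.m (b * c)) : a = b := by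
  have h1 := S.faithful _ (S.half_sub_mem ha hb) (by
    rw [S.m_sub_mul_conj, h _ (S.conj_mem ha), h _ (S.conj_mem hb)]
    ring)
  rw [smul_eq_zero] at h1
  rcases h1 with h1 | h1
  · simp at h1
  · exact sub_eq_zero.1 h1

/-- The projection on functions invariant under a power of the transformation. -/
theorem exists_projection (E : Mean) {f : A} (hf : f ∈ S.B) (r : ℤ) :
    ∃ g ∈ S.B, (f ∈ S.Pos → g ∈ S.Pos) ∧ S.τ r g = g ∧
      ∀ a ∈ S.B, S.τ r a = a → S.m (g * a) = S.m (f * a) := by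
  obtain ⟨g, hg, hpos, hgm⟩ := S.dual E.L E.norm_le E.one (fun n => S.τ (r * n) f)
    (fun n => S.τ_mem _ hf)
  refine ⟨g, hg, fun h => hpos fun n => S.pos_τ _ _ h, ?_, fun a ha har => ?_⟩
  · refine S.eq_of_m_mul (S.τ_mem _ hg) hg fun c hc => ?_
    rw [hgm c hc, ← E.shift _ fun n => S.norm_m_le (S.mul_mem (S.τ_mem _ hf) hc),
      ← S.m_τ (-r), map_mul (S.τ _), ← S.τ_add, neg_add_cancel, S.τ_zero, hgm _ (S.τ_mem _ hc)]
    congr 1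
    funext n
    rw [← S.m_τ r, map_mul (S.τ _), ← S.τ_add, ← S.τ_add, add_neg_cancel, S.τ_zero]
    congr 4
    push_cast
    ring
  · rw [hgm a ha, ← E.const (S.m (f * a))]
    congr 1
    funext n
    rw [← S.m_τ (r * n) (f * a), map_mul (S.τ _), S.τ_mul_of_invariant har]

variable {ι : Type*} [Fintype ι] [DecidableEq ι]

/-- In a correlation, a function may be replaced by another one having the same correlations with
eigenfunctions whose eigenvalues are roots of unity. -/
theorem corr_congr (E : Mean) {P : ι → ℤ[X]} (hP : AffIndep P) {f g : A} (hf : f ∈ S.B)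
    (hg : g ∈ S.B) (h : ∀ χ z r, S.Eig χ z → 1 ≤ r → z ^ r = 1 → S.m (f * χ) = S.m (g * χ)) :
    (S.corr E P fun _ => f) = S.corr E P fun _ => g := by
  suffices hs : ∀ s : Finset ι, (S.corr E P fun _ => f) = S.corr E P fun i =>
      if i ∈ s then g else f by simpa using hs univ
  intro s
  induction s using Finset.induction_on with
  | empty => simp
  | insert e s he ih =>
    have hB : ∀ j, (if j ∈ s then g else f) ∈ S.B := fun j => by split_ifs <;> assumption
    have h1 : (fun i => if i ∈ insert e s then g else f) =
        Function.update (fun i => if i ∈ s then g else f) e g := by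
      funext i
      rcases eq_or_ne i e with rfl | hi
      · simp
      · simp [hi]
    have h2 : S.corr E P (Function.update (fun i => if i ∈ s then g else f) e
        ((2 : ℂ)⁻¹ • (f - g))) = 0 := by
      refine S.corr_eq_zero E hP (fun j => ?_) e fun χ z r hχ hr hz => ?_
      · rcases eq_or_ne j e with rfl | hj
        · rw [Function.update_self]
          exact S.half_sub_mem hf hg
        · rw [Function.update_of_ne hj]
          exact hB j
      · rw [Function.update_self, smul_mul_assoc, map_smul, sub_mul, map_sub, h χ z r hχ hr hz,
          sub_self, smul_zero]
    rw [S.corr_update] at h2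
    have h3 : ∀ x : A, S.m (x * ((2 : ℂ)⁻¹ • (f - g))) =
        (2 : ℂ)⁻¹ * (S.m (x * f) - S.m (x * g)) := fun x => by
      rw [mul_smul_comm, map_smul, mul_sub, map_sub, smul_eq_mul]
    simp only [h3] at h2
    rw [E.const_mul, E.sub, ← S.corr_update, ← S.corr_update, mul_eq_zero] at h2
    rw [ih, h1]
    rcases h2 with h2 | h2
    · simp at h2
    · rw [sub_eq_zero] at h2
      rw [← h2]
      congr 1
      funext i
      rcases eq_or_ne i e with rfl | hi
      · simp [he]
      · simp [hi]

/-- The lower bound for polynomial correlations along multiples of a highly divisible number. -/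
theorem le_corr (E₀ : Mean) {k : ℕ} (hk : Fintype.card ι = k + 1) {P : ℕ → ι → ℤ[X]}
    (hP : ∀ W, AffIndep (P W)) (hdvd : ∀ W i n, (W.factorial : ℤ) ∣ (P W i).eval n) {f : A}
    (hf : f ∈ S.B) (hpos : f ∈ S.Pos) {η : ℝ} (hη : 0 < η) :
    ∃ W₀, ∀ W ≥ W₀, ∀ E : Mean,
      (S.m f).re ^ (k + 1) - η ≤ (S.corr E (P W) fun _ => f).re := by
  choose g hg hgpos hginv hgm using fun W : ℕ => S.exists_projection E₀ hf W.factorial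
  obtain ⟨G, hG, -, hGm⟩ := S.dual E₀.L E₀.norm_le E₀.one g hg
  have hinv : ∀ {V W : ℕ}, V ≤ W → S.τ W.factorial (g V) = g V := fun {V W} hVW => by
    obtain ⟨c, hc⟩ := Nat.factorial_dvd_factorial hVW
    rw [hc, Nat.cast_mul]
    exact S.τ_mul_of_invariant (hginv V) c
  set a : ℕ → ℝ := fun W => (S.m (g W * S.conj (g W))).re with ha
  have haC : ∀ W, S.m (g W * S.conj (g W)) = (a W : ℂ) := fun W => by
    have h := S.m_conj (g W * S.conj (g W))
    rw [map_mul S.conj, S.conj_conj, mul_comm] at h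
    exact (Complex.conj_eq_iff_re.1 h.symm).symm
  have hga : ∀ V W, V ≤ W → S.m (g W * S.conj (g V)) = a V := fun V W h => by
    rw [← haC, hgm W _ (S.conj_mem (hg V)) (by rw [S.τ_conj, hinv h]),
      hgm V _ (S.conj_mem (hg V)) (by rw [S.τ_conj, hinv le_rfl])]
  have hflip : ∀ x y, S.m (x * S.conj y) = star (S.m (y * S.conj x)) := fun x y => by
    rw [← S.m_conj, map_mul S.conj, S.conj_conj, mul_comm]
  have hga' : ∀ V W, V ≤ W → S.m (g V * S.conj (g W)) = a V := fun V W h => by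
    rw [hflip, hga V W h]
    exact Complex.conj_ofReal _
  have hmono : Monotone a := fun V W h => by
    have h1 := S.m_mul_conj_nonneg (S.half_sub_mem (hg W) (hg V))
    rw [S.m_sub_mul_conj, haC, haC, hga V W h, hga' V W h, Complex.div_ofNat_re] at h1
    simp only [Complex.sub_re, Complex.add_re, Complex.ofReal_re] at h1
    linarith
  have hbdd : BddAbove (Set.range a) := ⟨1, by
    rintro _ ⟨W, rfl⟩
    exact (Complex.re_le_norm _).trans (S.norm_m_le (S.mul_mem (hg W) (S.conj_mem (hg W))))⟩
  have hlim := tendsto_atTop_ciSup hmono hbdd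
  set ℓ : ℝ := ⨆ W, a W
  have hGg : ∀ V, S.m (G * S.conj (g V)) = a V := fun V => by
    rw [hGm _ (S.conj_mem (hg V))]
    refine E₀.eq_of_tendsto (fun W => S.norm_m_le (S.mul_mem (hg W) (S.conj_mem (hg V)))) ?_
    refine tendsto_const_nhds.congr' ?_
    filter_upwards [eventually_ge_atTop V] with W hW
    rw [hga V W hW]
  have hgG : ∀ V, S.m (g V * S.conj G) = a V := fun V => by
    rw [hflip, hGg]
    exact Complex.conj_ofReal _
  have hGG : S.m (G * S.conj G) = ℓ := by
    rw [hGm _ (S.conj_mem hG)]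
    refine E₀.eq_of_tendsto (fun W => S.norm_m_le (S.mul_mem (hg W) (S.conj_mem hG))) ?_
    simp only [hgG]
    exact (Complex.continuous_ofReal.tendsto _).comp hlim
  have hGf : ∀ χ z r, S.Eig χ z → 1 ≤ r → z ^ r = 1 → S.m (f * χ) = S.m (G * χ) := by
    intro χ z r hχ hr hz
    rw [hGm _ hχ.1]
    refine (E₀.eq_of_tendsto (fun W => S.norm_m_le (S.mul_mem (hg W) hχ.1)) ?_).symm
    refine tendsto_const_nhds.congr' ?_
    filter_upwards [eventually_ge_atTop r] with W hW
    refine (hgm W χ hχ.1 ?_).symm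
    obtain ⟨c, hc⟩ := Nat.dvd_factorial hr hW
    rw [hχ.2.2.2, zpow_natCast, hc, pow_mul, hz, one_pow, one_smul]
  set β : ℝ := η / (k + 1) with hβ
  have hβ0 : 0 < β := by positivity
  obtain ⟨W₀, hW₀⟩ := Metric.tendsto_atTop.1 hlim (β ^ 2) (by positivity)
  refine ⟨W₀, fun W hW E => ?_⟩
  have hclose : ∀ d ∈ S.B, ‖S.m (d * (G - g W))‖ ≤ β := fun d hd => by
    refine S.norm_m_mul_sub_le hG (hg W) hβ0.le ?_ hd
    rw [hGG, hGg, hgG, haC]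
    simp only [Complex.sub_re, Complex.add_re, Complex.ofReal_re]
    have := hW₀ W hW
    rw [Real.dist_eq, abs_lt] at this
    linarith
  have hW1 : (S.corr E (P W) fun _ => g W) = S.m (g W ^ (k + 1)) := by
    rw [Sys.corr, ← E.const (S.m (g W ^ (k + 1)))]
    congr 1
    funext n
    rw [prod_congr rfl fun i _ => by
      obtain ⟨c, hc⟩ := hdvd W i n
      rw [hc, S.τ_mul_of_invariant (hinv le_rfl)], prod_const, card_univ, hk]
  have hdiff : ‖(S.corr E (P W) fun _ => G) - S.corr E (P W) fun _ => g W‖ ≤ η := by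
    rw [Sys.corr, Sys.corr, ← E.sub]
    refine E.norm_le_of_le hη fun n => ?_
    rw [← map_sub]
    have := S.norm_m_prod_sub_le univ (b := fun i => S.τ ((P W i).eval (n : ℤ)) G)
      (c := fun i => S.τ ((P W i).eval (n : ℤ)) (g W)) (fun i => S.τ_mem _ hG)
      (fun i => S.τ_mem _ (hg W)) (β := β) (fun i d hd => by
        rw [← map_sub, ← S.m_τ (-(P W i).eval (n : ℤ)), map_mul (S.τ _), ← S.τ_add, neg_add_cancel,
          S.τ_zero]
        exact hclose _ (S.τ_mem _ hd)) S.one_mem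
    rw [one_mul, card_univ, hk] at this
    refine this.trans (le_of_eq ?_)
    rw [hβ]
    push_cast
    field_simp
  have hpow := S.pow_le (g W) (hg W) (hgpos W hpos) k
  have hmean : S.m (g W) = S.m f := by
    simpa using hgm W 1 S.one_mem (map_one _)
  rw [hmean, ← hW1] at hpow
  rw [S.corr_congr E (hP W) hf hG hGf]
  have h1 := (abs_le.1 ((Complex.abs_re_le_norm _).trans hdiff)).1
  rw [Complex.sub_re] at h1
  linarith

end ErgSys

end PolyConfig

namespace PolyConfig

open Topology

/-- Cesàro averages. -/
noncomputable def cesaro (u : ℕ → ℂ) (N : ℕ) : ℂ := (N : ℂ)⁻¹ * ∑ n ∈ range N, u n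

theorem norm_cesaro_le {u : ℕ → ℂ} {C : ℝ} (hC : 0 ≤ C) (h : ∀ n, ‖u n‖ ≤ C) (N : ℕ) :
    ‖cesaro u N‖ ≤ C := by
  rcases Nat.eq_zero_or_pos N with rfl | hN
  · simpa [cesaro] using hC
  · have hN' : (0 : ℝ) < N := by exact_mod_cast hN
    rw [cesaro, norm_mul, norm_inv, Complex.norm_natCast, inv_mul_le_iff₀ hN']
    refine (norm_sum_le_of_le _ fun n _ => h n).trans ?_
    simp

theorem cesaro_add (u v : ℕ → ℂ) (N : ℕ) : cesaro (u + v) N = cesaro u N + cesaro v N := by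
  simp [cesaro, sum_add_distrib, mul_add]

theorem cesaro_smul (c : ℂ) (u : ℕ → ℂ) (N : ℕ) : cesaro (c • u) N = c * cesaro u N := by
  simp only [cesaro, Pi.smul_apply, smul_eq_mul, ← mul_sum]
  ring

theorem cesaro_one {N : ℕ} (hN : N ≠ 0) : cesaro (fun _ => 1) N = 1 := by
  simp [cesaro, hN]

theorem norm_cesaro_sq_le (u : ℕ → ℂ) {v : ℕ → ℂ} (h : ∀ n, ‖u n‖ ^ 2 ≤ (v n).re) (N : ℕ) :
    ‖cesaro u N‖ ^ 2 ≤ (cesaro v N).re := by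
  rcases Nat.eq_zero_or_pos N with rfl | hN
  · simp [cesaro]
  have hN' : (0 : ℝ) < N := by exact_mod_cast hN
  have h1 : ‖∑ n ∈ range N, u n‖ ^ 2 ≤ N * ∑ n ∈ range N, (v n).re := by
    calc ‖∑ n ∈ range N, u n‖ ^ 2 ≤ (∑ n ∈ range N, ‖u n‖) ^ 2 := by
          gcongr
          exact norm_sum_le _ _
      _ ≤ N * ∑ n ∈ range N, ‖u n‖ ^ 2 := by
          simpa using sq_sum_le_card_mul_sum_sq (s := range N) (f := fun n => ‖u n‖)
      _ ≤ _ := by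
          gcongr with n
          exact h n
  have h2 : (cesaro v N).re = (N : ℝ)⁻¹ * ∑ n ∈ range N, (v n).re := by
    rw [cesaro, ← Complex.ofReal_natCast, ← Complex.ofReal_inv, Complex.re_ofReal_mul,
      Complex.re_sum]
  rw [h2, cesaro, norm_mul, mul_pow, norm_inv, Complex.norm_natCast]
  calc (N : ℝ)⁻¹ ^ 2 * ‖∑ n ∈ range N, u n‖ ^ 2
      ≤ (N : ℝ)⁻¹ ^ 2 * (N * ∑ n ∈ range N, (v n).re) := by gcongr
    _ = _ := by field_simp

theorem norm_cesaro_shift_sub_le {u : ℕ → ℂ} (h : ∀ n, ‖u n‖ ≤ 1) (N : ℕ) :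
    ‖cesaro (fun n => u (n + 1)) N - cesaro u N‖ ≤ 2 / N := by
  have h1 : ∑ n ∈ range N, u (n + 1) - ∑ n ∈ range N, u n = u N - u 0 := by
    rw [← sum_sub_distrib, sum_range_sub]
  rw [cesaro, cesaro, ← mul_sub, h1, norm_mul, norm_inv, Complex.norm_natCast, div_eq_inv_mul]
  gcongr
  exact (norm_sub_le _ _).trans (by linarith [h N, h 0])

/-- The submodule of bounded sequences. -/
def boundedSeq : Submodule ℂ (ℕ → ℂ) where
  carrier := {u | ∃ C, 0 ≤ C ∧ ∀ n, ‖u n‖ ≤ C}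
  zero_mem' := ⟨0, le_rfl, fun n => by simp⟩
  add_mem' := by
    rintro u v ⟨C, hC, hu⟩ ⟨D, hD, hv⟩
    exact ⟨C + D, add_nonneg hC hD, fun n => norm_add_le_of_le (hu n) (hv n)⟩
  smul_mem' := by
    rintro c u ⟨C, hC, hu⟩
    refine ⟨‖c‖ * C, by positivity, fun n => ?_⟩
    rw [Pi.smul_apply, norm_smul]
    gcongr
    exact hu n

/-- Limits of Cesàro averages along an ultrafilter are means. -/
theorem exists_mean (F : Ultrafilter ℕ) (hF : (F : Filter ℕ) ≤ atTop) :
    ∃ E : Mean, ∀ u : ℕ → ℂ, (∀ n, ‖u n‖ ≤ 1) → Tendsto (cesaro u) F (𝓝 (E.L u)) := by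
  have hex : ∀ u : boundedSeq, ∃ c, Tendsto (cesaro u.1) F (𝓝 c) := by
    rintro ⟨u, C, hC, hu⟩
    obtain ⟨c, -, hc⟩ := (isCompact_closedBall (0 : ℂ) C).ultrafilter_le_nhds (F.map (cesaro u))
      (by
        rw [Ultrafilter.coe_map, le_principal_iff, Filter.mem_map]
        exact Eventually.of_forall fun N => by simpa using norm_cesaro_le hC hu N)
    exact ⟨c, hc⟩
  choose ℓ hℓ using hex
  let L₀ : boundedSeq →ₗ[ℂ] ℂ :=
    { toFun := ℓ
      map_add' := fun u v => tendsto_nhds_unique (hℓ (u + v)) (((hℓ u).add (hℓ v)).congr fun N =>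
        (cesaro_add _ _ _).symm)
      map_smul' := fun c u => tendsto_nhds_unique (hℓ (c • u))
        (((hℓ u).const_mul c).congr fun N => (cesaro_smul _ _ _).symm) }
  obtain ⟨L, hL⟩ := L₀.exists_extend
  have hlim : ∀ u : ℕ → ℂ, (∀ n, ‖u n‖ ≤ 1) → Tendsto (cesaro u) F (𝓝 (L u)) := fun u hu => by
    have h1 := hℓ ⟨u, 1, zero_le_one, hu⟩
    rwa [show ℓ ⟨u, 1, zero_le_one, hu⟩ = L u from (LinearMap.congr_fun hL _).symm] at h1
  refine ⟨⟨L, ?_, fun u hu => ?_, fun u hu => ?_, fun u v hu hv huv => ?_⟩, hlim⟩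
  · refine tendsto_nhds_unique (hlim _ (by simp)) (tendsto_const_nhds.congr' ?_)
    filter_upwards [hF (eventually_ne_atTop 0)] with N hN
    exact (cesaro_one hN).symm
  · exact le_of_tendsto (hlim u hu).norm (Eventually.of_forall fun N =>
      norm_cesaro_le zero_le_one hu N)
  · rw [← sub_eq_zero, ← norm_le_zero_iff]
    refine le_of_tendsto_of_tendsto ((hlim _ fun n => hu _).sub (hlim u hu)).norm
      (tendsto_const_div_atTop_nhds_zero_nat (𝕜 := ℝ) 2 |>.mono_left hF)
      (Eventually.of_forall fun N => norm_cesaro_shift_sub_le hu N)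
  · exact le_of_tendsto_of_tendsto ((hlim u hu).norm.pow 2)
      ((Complex.continuous_re.tendsto _).comp (hlim v hv))
      (Eventually.of_forall fun N => norm_cesaro_sq_le u huv N)

end PolyConfig

namespace PolyConfig

open Topology

/-- A measure-preserving action of the integers. -/
structure IntAction {Y : Type*} [MeasurableSpace Y] (μ : Measure Y) where
  /-- the powers of the transformation -/
  T : ℤ → Y → Y
  zero : T 0 = id
  add : ∀ i j, T (i + j) = T i ∘ T j
  mp : ∀ i, MeasurePreserving (T i) μ μ

/-- The algebra of bounded measurable functions. -/
def bddFun (Y : Type*) [MeasurableSpace Y] : Subalgebra ℂ (Y → ℂ) where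
  carrier := {f | Measurable f ∧ ∃ C, 0 ≤ C ∧ ∀ y, ‖f y‖ ≤ C}
  mul_mem' := by
    rintro f g ⟨hf, C, hC, hfC⟩ ⟨hg, D, hD, hgD⟩
    refine ⟨hf.mul hg, C * D, mul_nonneg hC hD, fun y => ?_⟩
    rw [Pi.mul_apply, norm_mul]
    exact mul_le_mul (hfC y) (hgD y) (norm_nonneg _) hC
  add_mem' := by
    rintro f g ⟨hf, C, hC, hfC⟩ ⟨hg, D, hD, hgD⟩
    exact ⟨hf.add hg, C + D, add_nonneg hC hD, fun y => norm_add_le_of_le (hfC y) (hgD y)⟩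
  algebraMap_mem' c := ⟨measurable_const, ‖c‖, norm_nonneg _, fun _ => le_rfl⟩

variable {Y : Type*} [MeasurableSpace Y]

namespace bddFun

theorem measurable (f : bddFun Y) : Measurable f.1 := f.2.1

theorem integrable (f : bddFun Y) (μ : Measure Y) [IsFiniteMeasure μ] : Integrable f.1 μ := by
  obtain ⟨C, -, hC⟩ := f.2.2
  exact Integrable.of_bound (bddFun.measurable f).aestronglyMeasurable C (Eventually.of_forall hC)

/-- A function bounded by one. -/
def mk (f : Y → ℂ) (hf : Measurable f) (h : ∀ y, ‖f y‖ ≤ 1) : bddFun Y :=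
  ⟨f, hf, 1, zero_le_one, h⟩

/-- Pointwise conjugation. -/
def conj : bddFun Y →+* bddFun Y where
  toFun f := ⟨fun y => starRingEnd ℂ (f.1 y), Complex.continuous_conj.measurable.comp f.2.1, by
    obtain ⟨C, hC, h⟩ := f.2.2
    exact ⟨C, hC, fun y => by rw [RCLike.norm_conj]; exact h y⟩⟩
  map_one' := by ext; simp
  map_mul' f g := by ext; simp
  map_zero' := by ext; simp
  map_add' f g := by ext; simp

@[simp] theorem conj_apply (f : bddFun Y) (y : Y) : (conj f).1 y = starRingEnd ℂ (f.1 y) := rfl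

/-- Composition with a measurable map. -/
def comp (T : Y → Y) (hT : Measurable T) : bddFun Y →ₐ[ℂ] bddFun Y where
  toFun f := ⟨f.1 ∘ T, f.2.1.comp hT, by
    obtain ⟨C, hC, h⟩ := f.2.2
    exact ⟨C, hC, fun y => h _⟩⟩
  map_one' := rfl
  map_mul' _ _ := rfl
  map_zero' := rfl
  map_add' _ _ := rfl
  commutes' _ := rfl

@[simp] theorem comp_apply {T : Y → Y} (hT : Measurable T) (f : bddFun Y) (y : Y) :
    (comp T hT f).1 y = f.1 (T y) := rfl

end bddFun

/-- The ideal of functions vanishing almost everywhere. -/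
def nullIdeal (μ : Measure Y) : Ideal (bddFun Y) where
  carrier := {f | f.1 =ᵐ[μ] 0}
  zero_mem' := by
    change (0 : bddFun Y).1 =ᵐ[μ] 0
    exact EventuallyEq.rfl
  add_mem' := by
    intro f g hf hg
    change (f + g).1 =ᵐ[μ] 0
    change f.1 =ᵐ[μ] 0 at hf
    change g.1 =ᵐ[μ] 0 at hg
    filter_upwards [hf, hg] with y h h'
    change f.1 y + g.1 y = 0
    rw [h, h']
    simp
  smul_mem' := by
    intro f g hg
    change (f * g).1 =ᵐ[μ] 0
    change g.1 =ᵐ[μ] 0 at hg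
    filter_upwards [hg] with y h
    change f.1 y * g.1 y = 0
    rw [h]
    simp

/-- Bounded measurable functions up to almost everywhere equality. -/
abbrev FunAlg (μ : Measure Y) := bddFun Y ⧸ nullIdeal μ

namespace FunAlg

variable (μ : Measure Y)

/-- The class of a function. -/
def ofFun : bddFun Y →ₐ[ℂ] FunAlg μ := Ideal.Quotient.mkₐ ℂ (nullIdeal μ)

variable {μ}

theorem ofFun_surjective (a : FunAlg μ) : ∃ f, ofFun μ f = a := Ideal.Quotient.mk_surjective a

theorem ofFun_eq {f g : bddFun Y} : ofFun μ f = ofFun μ g ↔ f.1 =ᵐ[μ] g.1 := by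
  refine Ideal.Quotient.eq.trans ?_
  constructor <;> intro h
  · filter_upwards [h] with y hy
    exact sub_eq_zero.1 hy
  · change (f - g).1 =ᵐ[μ] 0
    filter_upwards [h] with y hy
    exact sub_eq_zero.2 hy

/-- Complex conjugation. -/
def conj : FunAlg μ →+* FunAlg μ :=
  Ideal.Quotient.lift (nullIdeal μ) ((ofFun μ : bddFun Y →+* FunAlg μ).comp bddFun.conj)
    fun f hf => by
    refine (ofFun_eq (g := 0)).2 ?_ |>.trans (map_zero _)
    filter_upwards [hf] with y hy
    change starRingEnd ℂ (f.1 y) = 0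
    rw [hy]
    simp

@[simp] theorem conj_ofFun (f : bddFun Y) : conj (ofFun μ f) = ofFun μ (bddFun.conj f) := rfl

/-- The Koopman representation. -/
def koopman (S : IntAction μ) (n : ℤ) : FunAlg μ →ₐ[ℂ] FunAlg μ :=
  Ideal.Quotient.liftₐ (nullIdeal μ) ((ofFun μ).comp (bddFun.comp (S.T n) (S.mp n).measurable))
    fun f hf => by
      refine (ofFun_eq (g := 0)).2 ?_ |>.trans (map_zero _)
      exact (S.mp n).quasiMeasurePreserving.ae_eq_comp hf

@[simp] theorem koopman_ofFun (S : IntAction μ) (n : ℤ) (f : bddFun Y) :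
    koopman S n (ofFun μ f) = ofFun μ (bddFun.comp (S.T n) (S.mp n).measurable f) := rfl

variable [IsProbabilityMeasure μ]

theorem int_exists (μ : Measure Y) [IsProbabilityMeasure μ] :
    ∃ m : FunAlg μ →ₗ[ℂ] ℂ, ∀ f, m (ofFun μ f) = ∫ y, f.1 y ∂μ := by
  have h : ∀ f, ∫ y, (Function.surjInv (ofFun_surjective (μ := μ)) (ofFun μ f)).1 y ∂μ =
      ∫ y, f.1 y ∂μ := fun f =>
    integral_congr_ae (ofFun_eq.1 (Function.surjInv_eq ofFun_surjective _))
  refine ⟨⟨⟨fun a => ∫ y, (Function.surjInv ofFun_surjective a).1 y ∂μ, fun a b => ?_⟩,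
    fun c a => ?_⟩, h⟩
  · obtain ⟨f, rfl⟩ := ofFun_surjective a
    obtain ⟨g, rfl⟩ := ofFun_surjective b
    rw [← map_add, h, h, h, ← integral_add (bddFun.integrable f μ) (bddFun.integrable g μ)]
    rfl
  · obtain ⟨f, rfl⟩ := ofFun_surjective a
    simp only
    rw [← map_smul, h, h, RingHom.id_apply, ← integral_smul]
    rfl

/-- The integral. -/
noncomputable def int (μ : Measure Y) [IsProbabilityMeasure μ] : FunAlg μ →ₗ[ℂ] ℂ :=
  (int_exists μ).choose

@[simp] theorem int_ofFun (f : bddFun Y) : int μ (ofFun μ f) = ∫ y, f.1 y ∂μ :=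
  (int_exists μ).choose_spec f

end FunAlg

theorem pow_integral_le (μ : Measure Y) [IsProbabilityMeasure μ] {g : Y → ℝ} (hg : Measurable g)
    (h0 : ∀ y, 0 ≤ g y) {C : ℝ} (hC : ∀ y, g y ≤ C) (k : ℕ) :
    (∫ y, g y ∂μ) ^ k ≤ ∫ y, g y ^ k ∂μ := by
  refine (convexOn_pow k).map_integral_le (continuous_pow k).continuousOn isClosed_Ici
    (Eventually.of_forall h0) ?_ ?_
  · refine Integrable.of_bound hg.aestronglyMeasurable C (Eventually.of_forall fun y => ?_)
    rw [Real.norm_of_nonneg (h0 y)]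
    exact hC y
  · refine Integrable.of_bound (hg.pow_const k).aestronglyMeasurable (C ^ k)
      (Eventually.of_forall fun y => ?_)
    rw [Function.comp, Real.norm_of_nonneg (pow_nonneg (h0 y) k)]
    exact pow_le_pow_left₀ (h0 y) (hC y) k

open FunAlg in
/-- The algebra of functions of a measure-preserving system. -/
noncomputable def IntAction.sys {μ : Measure Y} [IsProbabilityMeasure μ] (S : IntAction μ) :
    Sys (FunAlg μ) where
  B := {a | ∃ f, (∀ y, ‖f.1 y‖ ≤ 1) ∧ ofFun μ f = a}
  conj := conj
  m := int μ
  conj_conj a := by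
    obtain ⟨f, rfl⟩ := ofFun_surjective a
    rw [conj_ofFun, conj_ofFun]
    congr 1
    ext y
    simp
  conj_smul c a := by
    obtain ⟨f, rfl⟩ := ofFun_surjective a
    rw [← map_smul, conj_ofFun, conj_ofFun, ← map_smul]
    congr 1
    ext y
    exact map_mul (starRingEnd ℂ) _ _
  one_mem := ⟨1, fun y => by simp, map_one _⟩
  mul_mem := by
    rintro _ _ ⟨f, hf, rfl⟩ ⟨g, hg, rfl⟩
    refine ⟨f * g, fun y => ?_, map_mul _ _ _⟩
    change ‖f.1 y * g.1 y‖ ≤ 1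
    rw [norm_mul]
    exact mul_le_one₀ (hf y) (norm_nonneg _) (hg y)
  conj_mem := by
    rintro _ ⟨f, hf, rfl⟩
    exact ⟨bddFun.conj f, fun y => by simpa using hf y, rfl⟩
  avg_mem := by
    intro H c a hc ha
    choose f hf hfa using ha
    refine ⟨(H : ℂ)⁻¹ • ∑ h ∈ range H, c h • f h, fun y => ?_, ?_⟩
    · have : ((H : ℂ)⁻¹ • ∑ h ∈ range H, c h • f h : bddFun Y).1 y =
          (H : ℂ)⁻¹ * ∑ h ∈ range H, c h * (f h).1 y := by
        simp [Finset.sum_apply]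
      rw [this]
      rcases Nat.eq_zero_or_pos H with rfl | hH
      · simp
      have hH' : (0 : ℝ) < H := by exact_mod_cast hH
      rw [norm_mul, norm_inv, Complex.norm_natCast, inv_mul_le_iff₀ hH']
      refine (norm_sum_le_of_le _ fun h _ => ?_).trans (b := ∑ h ∈ range H, (1 : ℝ)) (by simp)
      rw [norm_mul]
      exact mul_le_one₀ (hc h) (norm_nonneg _) (hf h y)
    · simp [hfa]
  norm_m_le := by
    rintro _ ⟨f, hf, rfl⟩
    rw [int_ofFun]
    refine (norm_integral_le_of_norm_le_const (Eventually.of_forall hf)).trans ?_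
    simp
  cs := by
    rintro _ _ ⟨g, hg, rfl⟩ ⟨f, hf, rfl⟩
    rw [conj_ofFun, ← map_mul, ← map_mul, int_ofFun, int_ofFun]
    have h1 : ∀ y, (f * bddFun.conj f).1 y = ((‖f.1 y‖ ^ 2 : ℝ) : ℂ) := fun y => by
      change f.1 y * starRingEnd ℂ (f.1 y) = _
      rw [Complex.mul_conj, Complex.normSq_eq_norm_sq]
    simp only [h1]
    rw [integral_complex_ofReal, Complex.ofReal_re]
    refine le_trans ?_ (pow_integral_le μ (bddFun.measurable f).norm (fun y => norm_nonneg _) hf 2)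
    gcongr
    refine (norm_integral_le_integral_norm _).trans
      (integral_mono (bddFun.integrable (g * f) μ).norm
      (bddFun.integrable f μ).norm fun y => ?_)
    change ‖g.1 y * f.1 y‖ ≤ _
    rw [norm_mul]
    exact mul_le_of_le_one_left (norm_nonneg _) (hg y)
  τ := koopman S
  τ_zero a := by
    obtain ⟨f, rfl⟩ := ofFun_surjective a
    rw [koopman_ofFun]
    congr 1
    ext y
    rw [bddFun.comp_apply, S.zero, id]
  τ_add i j a := by
    obtain ⟨f, rfl⟩ := ofFun_surjective a
    rw [koopman_ofFun, koopman_ofFun, koopman_ofFun]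
    congr 1
    ext y
    rw [bddFun.comp_apply, add_comm, S.add]
    rfl
  τ_conj i a := by
    obtain ⟨f, rfl⟩ := ofFun_surjective a
    rfl
  τ_mem := by
    rintro i _ ⟨f, hf, rfl⟩
    exact ⟨bddFun.comp (S.T i) (S.mp i).measurable f, fun y => hf _, rfl⟩
  m_τ i a := by
    obtain ⟨f, rfl⟩ := ofFun_surjective a
    rw [koopman_ofFun, int_ofFun, int_ofFun]
    refine Eq.trans ?_ (congrArg (fun ν => ∫ y, f.1 y ∂ν) (S.mp i).map_eq)
    exact (integral_map (S.mp i).measurable.aemeasurable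
      (bddFun.measurable f).aestronglyMeasurable).symm
  m_conj a := by
    obtain ⟨f, rfl⟩ := ofFun_surjective a
    rw [conj_ofFun, int_ofFun, int_ofFun]
    exact integral_conj

end PolyConfig

namespace PolyConfig

open Topology

section Functional

variable {Φ : (ℕ → ℂ) →ₗ[ℂ] ℂ}

theorem norm_functional_le (hΦ : ∀ u : ℕ → ℂ, (∀ n, ‖u n‖ ≤ 1) → ‖Φ u‖ ≤ 1)
    {u : ℕ → ℂ} {c : ℝ} (hc : 0 ≤ c) (h : ∀ n, ‖u n‖ ≤ c) :
    ‖Φ u‖ ≤ c := by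
  refine le_of_forall_pos_le_add fun η hη => ?_
  have hd : 0 < c + η := by linarith
  have h1 := hΦ (((c + η : ℝ) : ℂ)⁻¹ • u) fun n => by
    rw [Pi.smul_apply, norm_smul, norm_inv, Complex.norm_real, Real.norm_of_nonneg hd.le,
      inv_mul_le_iff₀ hd, mul_one]
    linarith [h n]
  rwa [map_smul, norm_smul, norm_inv, Complex.norm_real, Real.norm_of_nonneg hd.le,
    inv_mul_le_iff₀ hd, mul_one] at h1

theorem functional_nonneg (hΦ : ∀ u : ℕ → ℂ, (∀ n, ‖u n‖ ≤ 1) → ‖Φ u‖ ≤ 1)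
    (h1 : Φ (fun _ => 1) = 1) {u : ℕ → ℝ} (h0 : ∀ n, 0 ≤ u n)
    (hu : ∀ n, u n ≤ 1) : 0 ≤ (Φ fun n => (u n : ℂ)).re ∧ (Φ fun n => (u n : ℂ)).im = 0 := by
  set z := Φ fun n => (u n : ℂ) with hz
  constructor
  · have h2 := hΦ ((fun _ => 1) - fun n => (u n : ℂ)) fun n => by
      rw [Pi.sub_apply, ← Complex.ofReal_one, ← Complex.ofReal_sub, Complex.norm_real,
        Real.norm_of_nonneg (by linarith [hu n])]
      linarith [h0 n]
    rw [map_sub, h1] at h2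
    have h3 := (Complex.re_le_norm _).trans h2
    rw [Complex.sub_re, Complex.one_re] at h3
    linarith
  · have key : ∀ t : ℝ, z.im ^ 2 + 2 * t * z.im ≤ 1 := fun t => by
      have h2 := norm_functional_le hΦ
        (u := (fun n => (u n : ℂ)) + (t * Complex.I : ℂ) • fun _ => 1)
        (Real.sqrt_nonneg (1 + t ^ 2)) fun n => by
          refine Real.le_sqrt_of_sq_le ?_
          simp only [Pi.add_apply, Pi.smul_apply, smul_eq_mul, mul_one]
          rw [← Complex.normSq_eq_norm_sq, Complex.normSq_add_mul_I]
          nlinarith [h0 n, hu n]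
      rw [map_add, map_smul, h1, ← hz, smul_eq_mul, mul_one] at h2
      have h3 := pow_le_pow_left₀ (norm_nonneg _) h2 2
      rw [Real.sq_sqrt (by positivity), ← Complex.normSq_eq_norm_sq, Complex.normSq_apply] at h3
      simp only [Complex.add_re, Complex.add_im, Complex.mul_re, Complex.mul_im, Complex.ofReal_re,
        Complex.ofReal_im, Complex.I_re, Complex.I_im] at h3
      nlinarith [sq_nonneg z.re]
    by_contra hne
    have := key (1 / z.im)
    rw [mul_assoc, one_div_mul_cancel hne] at this
    nlinarith [sq_nonneg z.im]

theorem exists_weak_limit (hΦ : ∀ u : ℕ → ℂ, (∀ n, ‖u n‖ ≤ 1) → ‖Φ u‖ ≤ 1)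
    {H : Type*} [NormedAddCommGroup H] [InnerProductSpace ℂ H]
    [CompleteSpace H] {v : ℕ → H} (hv : ∀ n, ‖v n‖ ≤ 1) :
    ∃ w : H, ∀ h, inner ℂ w h = Φ fun n => inner ℂ (v n) h := by
  let ℓ : H →ₗ[ℂ] ℂ :=
    { toFun := fun h => Φ fun n => inner ℂ (v n) h
      map_add' := fun h h' => by
        rw [← map_add]
        congr 1
        funext n
        exact inner_add_right _ _ _
      map_smul' := fun c h => by
        rw [RingHom.id_apply, ← map_smul]
        congr 1
        funext n
        exact inner_smul_right _ _ _ }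
  refine ⟨(InnerProductSpace.toDual ℂ H).symm (ℓ.mkContinuous 1 fun h => ?_), fun h => ?_⟩
  · rw [one_mul]
    refine norm_functional_le hΦ (norm_nonneg _) fun n => ?_
    refine (norm_inner_le_norm _ _).trans ?_
    exact mul_le_of_le_one_left (norm_nonneg _) (hv n)
  · rw [InnerProductSpace.toDual_symm_apply]
    rfl

end Functional

variable {Y : Type*} [MeasurableSpace Y] {μ : Measure Y} [IsProbabilityMeasure μ]

theorem bddFun.memLp (f : bddFun Y) : MemLp f.1 2 μ := by
  obtain ⟨C, -, hC⟩ := f.2.2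
  exact MemLp.of_bound (bddFun.measurable f).aestronglyMeasurable C (Eventually.of_forall hC)

theorem norm_toLp_le {f : bddFun Y} {C : ℝ} (hC : 0 ≤ C) (hf : ∀ y, ‖f.1 y‖ ≤ C) :
    ‖(bddFun.memLp (μ := μ) f).toLp f.1‖ ≤ C := by
  have h := Lp.norm_le_of_ae_bound (f := (bddFun.memLp (μ := μ) f).toLp f.1) hC (by
    filter_upwards [(bddFun.memLp (μ := μ) f).coeFn_toLp] with y hy
    rw [hy]
    exact hf y)
  simpa [measureUnivNNReal] using h

open FunAlg

theorem exists_dual_fun {Φ : (ℕ → ℂ) →ₗ[ℂ] ℂ} (hΦ : ∀ u : ℕ → ℂ, (∀ n, ‖u n‖ ≤ 1) → ‖Φ u‖ ≤ 1)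
    {F : ℕ → bddFun Y} (hF : ∀ n y, ‖(F n).1 y‖ ≤ 1) :
    ∃ f : bddFun Y, (∀ y, ‖f.1 y‖ ≤ 1) ∧
      ∀ a : bddFun Y, ∫ y, f.1 y * a.1 y ∂μ = Φ fun n => ∫ y, (F n).1 y * a.1 y ∂μ := by
  obtain ⟨w, hw⟩ := exists_weak_limit hΦ
    (v := fun n => (bddFun.memLp (μ := μ) (bddFun.conj (F n))).toLp _) fun n =>
      norm_toLp_le zero_le_one (by simpa using hF n)
  set g : Y → ℂ := fun y => starRingEnd ℂ (w y) with hg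
  have hgm : Measurable g :=
    Complex.continuous_conj.measurable.comp (Lp.stronglyMeasurable w).measurable
  have hgL : MemLp g 2 μ := (Lp.memLp w).star
  have hgi : Integrable g μ := hgL.integrable (by norm_num)
  have key : ∀ a : bddFun Y, ∫ y, g y * a.1 y ∂μ = Φ fun n => ∫ y, (F n).1 y * a.1 y ∂μ := by
    intro a
    have h1 := hw ((bddFun.memLp (μ := μ) a).toLp _)
    rw [L2.inner_def] at h1
    have h2 : ∀ v : Lp ℂ 2 μ, ∫ y, inner ℂ (v y) ((bddFun.memLp (μ := μ) a).toLp a.1 y) ∂μ =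
        ∫ y, starRingEnd ℂ (v y) * a.1 y ∂μ := fun v => by
      refine integral_congr_ae ?_
      filter_upwards [(bddFun.memLp (μ := μ) a).coeFn_toLp] with y hy
      rw [hy, RCLike.inner_apply, mul_comm]
    rw [h2] at h1
    rw [h1]
    congr 1
    funext n
    rw [L2.inner_def, h2]
    refine integral_congr_ae ?_
    filter_upwards [(bddFun.memLp (μ := μ) (bddFun.conj (F n))).coeFn_toLp] with y hy
    rw [hy]
    simp
  have hs : MeasurableSet {y | 1 < ‖g y‖} := measurableSet_lt measurable_const hgm.norm
  set s := {y | 1 < ‖g y‖} with hs_def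
  let a : bddFun Y := ⟨s.indicator fun y => starRingEnd ℂ (g y) / ‖g y‖,
    ((Complex.continuous_conj.measurable.comp hgm).div
      (Complex.continuous_ofReal.measurable.comp hgm.norm)).indicator hs,
      1, zero_le_one, fun y => by
    rw [Set.indicator_apply]
    split_ifs
    · rw [norm_div, RCLike.norm_conj, Complex.norm_real, norm_norm]
      exact div_self_le_one _
    · simp⟩
  have ha : ∀ y, ‖a.1 y‖ ≤ s.indicator (fun _ => (1 : ℝ)) y := fun y => by
    change ‖s.indicator (fun y => starRingEnd ℂ (g y) / ‖g y‖) y‖ ≤ _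
    rw [Set.indicator_apply, Set.indicator_apply]
    split_ifs
    · rw [norm_div, RCLike.norm_conj, Complex.norm_real, norm_norm]
      exact div_self_le_one _
    · simp
  have hga : ∀ y, g y * a.1 y = ((s.indicator (fun y => ‖g y‖) y : ℝ) : ℂ) := fun y => by
    change g y * s.indicator (fun y => starRingEnd ℂ (g y) / ‖g y‖) y = _
    rw [Set.indicator_apply, Set.indicator_apply]
    split_ifs with hy
    · have : (‖g y‖ : ℂ) ≠ 0 := by
        have : ‖g y‖ ≠ 0 := (zero_lt_one.trans hy).ne'
        exact_mod_cast this
      rw [← mul_div_assoc, Complex.mul_conj, Complex.normSq_eq_norm_sq, div_eq_iff this]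
      push_cast
      ring
    · simp
  have hle : ∫ y, s.indicator (fun y => ‖g y‖) y ∂μ ≤ ∫ y, s.indicator (fun _ => (1 : ℝ)) y ∂μ := by
    have h1 := key a
    simp only [hga] at h1
    rw [integral_complex_ofReal] at h1
    have h2 := norm_functional_le hΦ (u := fun n => ∫ y, (F n).1 y * a.1 y ∂μ)
      (c := ∫ y, s.indicator (fun _ => (1 : ℝ)) y ∂μ)
      (integral_nonneg fun y => Set.indicator_nonneg (by simp) y) fun n => by
        refine norm_integral_le_of_norm_le ((integrable_const _).indicator hs)
          (Eventually.of_forall fun y => ?_)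
        rw [norm_mul]
        exact (mul_le_of_le_one_left (norm_nonneg _) (hF n y)).trans (ha y)
    rw [← h1, Complex.norm_real] at h2
    exact (le_abs_self _).trans h2
  have hzero : ∀ᵐ y ∂μ, ‖g y‖ ≤ 1 := by
    have hintg : Integrable (s.indicator fun y => ‖g y‖ - 1) μ :=
      (hgi.norm.sub (integrable_const _)).indicator hs
    have hnn : 0 ≤ s.indicator fun y => ‖g y‖ - 1 := fun y =>
      Set.indicator_nonneg (fun y hy => sub_nonneg.2 (le_of_lt hy)) y
    have h1 : ∫ y, s.indicator (fun y => ‖g y‖ - 1) y ∂μ = 0 := by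
      refine le_antisymm ?_ (integral_nonneg hnn)
      have : (s.indicator fun y => ‖g y‖ - 1) =
          fun y => s.indicator (fun y => ‖g y‖) y - s.indicator (fun _ => (1 : ℝ)) y := by
        funext y
        rw [Set.indicator_apply, Set.indicator_apply, Set.indicator_apply]
        split_ifs <;> simp
      rw [this, integral_sub (hgi.norm.indicator hs) ((integrable_const _).indicator hs)]
      linarith
    have h2 := (integral_eq_zero_iff_of_nonneg hnn hintg).1 h1
    filter_upwards [h2] with y hy
    by_contra hlt
    push Not at hlt
    rw [Set.indicator_of_mem (show y ∈ s from hlt)] at hy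
    simp only [Pi.zero_apply] at hy
    linarith
  refine ⟨bddFun.mk (fun y => if ‖g y‖ ≤ 1 then g y else 0)
    (Measurable.ite (measurableSet_le hgm.norm measurable_const) hgm measurable_const) fun y => ?_,
    fun y => ?_, fun a => ?_⟩
  · split_ifs with h
    · exact h
    · simp
  · change ‖if ‖g y‖ ≤ 1 then g y else 0‖ ≤ 1
    split_ifs with h
    · exact h
    · simp
  · rw [← key a]
    refine integral_congr_ae ?_
    filter_upwards [hzero] with y hy
    change (if ‖g y‖ ≤ 1 then g y else 0) * _ = _
    rw [if_pos hy]

theorem ae_nonneg_of_integral {f : bddFun Y}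
    (h : ∀ s, MeasurableSet s → 0 ≤ (∫ y in s, f.1 y ∂μ).re ∧ (∫ y in s, f.1 y ∂μ).im = 0) :
    ∀ᵐ y ∂μ, 0 ≤ (f.1 y).re ∧ (f.1 y).im = 0 := by
  have hf := bddFun.integrable f μ
  have h1 : ∀ᵐ y ∂μ, 0 ≤ (f.1 y).re := by
    refine ae_nonneg_of_forall_setIntegral_nonneg hf.re fun s hs _ => ?_
    have := (h s hs).1
    rwa [← RCLike.re_eq_complex_re, ← integral_re hf.integrableOn] at this
  have h2 : ∀ᵐ y ∂μ, (f.1 y).im = 0 := by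
    refine Integrable.ae_eq_zero_of_forall_setIntegral_eq_zero hf.im fun s hs _ => ?_
    have := (h s hs).2
    rwa [← RCLike.im_eq_complex_im, ← integral_im hf.integrableOn] at this
  filter_upwards [h1, h2] with y hy hy' using ⟨hy, hy'⟩

end PolyConfig

namespace PolyConfig

open Topology

theorem sum_norm_sq_dft {q : ℕ} [NeZero q] (b : ZMod q → ℂ) :
    ∑ j, ‖ZMod.dft b j‖ ^ 2 = q * ∑ d, ‖b d‖ ^ 2 := by
  have h1 : ∀ d, ∑ j, ZMod.stdAddChar (d * j) * ZMod.dft b j = q * b d := fun d => by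
    have h := congrFun (ZMod.dft_dft b) (-d)
    rw [ZMod.dft_apply, neg_neg, smul_eq_mul] at h
    rw [← h]
    refine sum_congr rfl fun j _ => ?_
    rw [smul_eq_mul]
    congr 2
    ring
  have h2 : ∑ j, starRingEnd ℂ (ZMod.dft b j) * ZMod.dft b j =
      q * ∑ d, starRingEnd ℂ (b d) * b d := by
    calc ∑ j, starRingEnd ℂ (ZMod.dft b j) * ZMod.dft b j
        = ∑ j, ∑ d, starRingEnd ℂ (b d) * (ZMod.stdAddChar (d * j) * ZMod.dft b j) := by
          refine sum_congr rfl fun j _ => ?_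
          nth_rewrite 1 [ZMod.dft_apply]
          rw [map_sum, sum_mul]
          refine sum_congr rfl fun d _ => ?_
          rw [smul_eq_mul, map_mul, ← AddChar.map_neg_eq_conj, neg_neg]
          ring
      _ = _ := by
          rw [sum_comm, mul_sum]
          refine sum_congr rfl fun d _ => ?_
          rw [← mul_sum, h1]
          ring
  simp only [Complex.conj_mul', ← Complex.ofReal_pow] at h2
  exact_mod_cast h2

theorem norm_sum_of_eq {α : Type*} (s : Finset α) (g : α → ℂ) (h : ∀ x ∈ s, ∀ y ∈ s, g x = g y) :
    ‖∑ x ∈ s, g x‖ = ∑ x ∈ s, ‖g x‖ := by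
  rcases s.eq_empty_or_nonempty with rfl | ⟨x, hx⟩
  · simp
  · rw [sum_congr rfl fun y hy => h y hy x hx,
      sum_congr (g := fun _ => ‖g x‖) rfl fun y hy => congrArg norm (h y hy x hx)]
    simp

section

variable {H : Type*} [NormedAddCommGroup H] [InnerProductSpace ℂ H] (U : H →ₗᵢ[ℂ] H)

/-- Twisted averages along an orbit. -/
noncomputable def twist (z : ℂ) (K : ℕ) (v : H) : H :=
  (K : ℂ)⁻¹ • ∑ h ∈ range K, z ^ h • U^[h] v

theorem inner_iterate (v w : H) (t : ℕ) : inner ℂ (U^[t] v) (U^[t] w) = inner ℂ v w := by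
  induction t with
  | zero => rfl
  | succ t ih =>
    rw [Function.iterate_succ_apply', Function.iterate_succ_apply', U.inner_map_map, ih]

theorem norm_iterate (v : H) (t : ℕ) : ‖U^[t] v‖ = ‖v‖ := by
  induction t with
  | zero => rfl
  | succ t ih => rw [Function.iterate_succ_apply', U.norm_map, ih]

theorem inner_iterate_congr (v : H) {h h' k k' : ℕ} (e : h + k' = k + h') :
    inner ℂ (U^[h'] v) (U^[h] v) = inner ℂ (U^[k'] v) (U^[k] v) := by
  wlog hle : h' ≤ k' generalizing h h' k k'
  · exact (this e.symm (by omega)).symm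
  obtain ⟨t, rfl⟩ := Nat.exists_eq_add_of_le hle
  obtain rfl : k = t + h := by omega
  rw [add_comm h' t, Function.iterate_add_apply, Function.iterate_add_apply, inner_iterate]

theorem inner_twist (z z' : ℂ) (K : ℕ) (v w : H) :
    inner ℂ (twist U z K v) (twist U z' K w) = ∑ x ∈ range K ×ˢ range K,
      (starRingEnd ℂ z ^ x.2 * z' ^ x.1) *
        (((K : ℂ) ^ 2)⁻¹ * inner ℂ (U^[x.2] v) (U^[x.1] w)) := by
  rw [twist, twist, inner_smul_left, inner_smul_right, sum_inner, sum_product_right]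
  simp only [inner_sum, inner_smul_left, inner_smul_right, mul_sum]
  refine sum_congr rfl fun h _ => sum_congr rfl fun h' _ => ?_
  rw [map_inv₀, Complex.conj_natCast, map_pow]
  ring

theorem exists_twist {v : H} (hv : ‖v‖ ≤ 1) {c : ℝ} (hc : 0 ≤ c) {K : ℕ} (hK : 0 < K)
    (h : c ≤ av K fun h => av K fun h' => ‖inner ℂ (U^[h'] v) (U^[h] v)‖) :
    ∃ z : ℂ, ‖z‖ = 1 ∧ c ^ 2 / 2 ≤ ‖twist U z K v‖ ^ 2 := by
  have hKr : (0 : ℝ) < K := by exact_mod_cast hK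
  have : NeZero (2 * K) := ⟨by omega⟩
  let a : ℕ × ℕ → ℂ := fun x => ((K : ℂ) ^ 2)⁻¹ * inner ℂ (U^[x.2] v) (U^[x.1] v)
  let π : ℕ × ℕ → ZMod (2 * K) := fun x => (x.1 : ZMod (2 * K)) - x.2
  set s := range K ×ˢ range K with hs
  let b : ZMod (2 * K) → ℂ := fun d => ∑ x ∈ s with π x = d, a x
  let ζ : ZMod (2 * K) → ℂ := fun j => ZMod.stdAddChar (-j)
  have hζ : ∀ j, ‖ζ j‖ = 1 := fun j => AddChar.norm_apply _ _
  have hfib : ∀ x ∈ s, ∀ y ∈ s, π x = π y → a x = a y := by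
    intro x hx y hy hxy
    simp only [hs, mem_product, mem_range] at hx hy
    have h1 : ((x.1 + y.2 : ℕ) : ZMod (2 * K)) = ((y.1 + x.2 : ℕ) : ZMod (2 * K)) := by
      push_cast
      linear_combination hxy
    rw [ZMod.natCast_eq_natCast_iff', Nat.mod_eq_of_lt (by omega), Nat.mod_eq_of_lt (by omega)]
      at h1
    simp only [a]
    rw [inner_iterate_congr U v h1]
  have hdft : ∀ j, ZMod.dft b j = ((‖twist U (ζ j) K v‖ ^ 2 : ℝ) : ℂ) := by
    intro j
    have h1 : ((‖twist U (ζ j) K v‖ ^ 2 : ℝ) : ℂ) =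
        inner ℂ (twist U (ζ j) K v) (twist U (ζ j) K v) := by
      rw [inner_self_eq_norm_sq_to_K]
      push_cast
      rfl
    rw [h1, inner_twist, ZMod.dft_apply, ← hs, ← sum_fiberwise s π]
    refine sum_congr rfl fun d _ => ?_
    rw [smul_eq_mul, mul_sum]
    refine sum_congr rfl fun x hx => ?_
    rw [← (mem_filter.1 hx).2]
    change _ * a x = _ * a x
    congr 1
    simp only [ζ, π]
    rw [← AddChar.map_neg_eq_conj, ← AddChar.map_nsmul_eq_pow, ← AddChar.map_nsmul_eq_pow,
      ← AddChar.map_add_eq_mul]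
    congr 1
    simp only [nsmul_eq_mul]
    ring
  have hb1 : c ≤ ∑ d, ‖b d‖ := by
    have h1 : ∑ d, ‖b d‖ = ∑ x ∈ s, ‖a x‖ := by
      rw [← sum_fiberwise s π]
      refine sum_congr rfl fun d _ => norm_sum_of_eq _ _ fun x hx y hy => ?_
      rw [mem_filter] at hx hy
      exact hfib x hx.1 y hy.1 (hx.2.trans hy.2.symm)
    rw [h1]
    refine h.trans (le_of_eq ?_)
    rw [hs, sum_product, av, sum_div]
    refine sum_congr rfl fun h _ => ?_
    rw [av, sum_div, sum_div]
    refine sum_congr rfl fun h' _ => ?_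
    simp only [a]
    rw [norm_mul, norm_inv, norm_pow, Complex.norm_natCast]
    field_simp
  have hb2 : c ^ 2 ≤ (2 * K : ℕ) * ∑ d, ‖b d‖ ^ 2 := by
    refine (pow_le_pow_left₀ hc hb1 2).trans ?_
    have := sq_sum_le_card_mul_sum_sq (s := (univ : Finset (ZMod (2 * K)))) (f := fun d => ‖b d‖)
    rwa [card_univ, ZMod.card] at this
  have hb0 : ∑ j, ‖twist U (ζ j) K v‖ ^ 2 ≤ 2 := by
    have h1 := congrFun (ZMod.dft_dft b) 0
    rw [ZMod.dft_apply_zero, neg_zero, smul_eq_mul] at h1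
    simp only [hdft] at h1
    have h2 : b 0 = (K : ℂ)⁻¹ * ((‖v‖ ^ 2 : ℝ) : ℂ) := by
      have h3 : b 0 = ∑ x ∈ s with π x = 0, ((K : ℂ) ^ 2)⁻¹ * ((‖v‖ ^ 2 : ℝ) : ℂ) := by
        refine sum_congr rfl fun x hx => ?_
        rw [mem_filter] at hx
        rw [hfib x hx.1 (0, 0) (by simp [hs, hK]) (by simpa [π] using hx.2)]
        simp only [a, Function.iterate_zero, id]
        rw [inner_self_eq_norm_sq_to_K]
        push_cast
        rfl
      have h4 : (s.filter fun x => π x = 0) = (range K).image fun h => (h, h) := by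
        ext ⟨x, y⟩
        simp only [hs, mem_filter, mem_product, mem_range, mem_image, Prod.mk.injEq, π, sub_eq_zero]
        constructor
        · rintro ⟨⟨hx, hy⟩, hxy⟩
          rw [ZMod.natCast_eq_natCast_iff', Nat.mod_eq_of_lt (by omega),
            Nat.mod_eq_of_lt (by omega)] at hxy
          exact ⟨x, hx, rfl, hxy⟩
        · rintro ⟨z, hz, rfl, rfl⟩
          exact ⟨⟨hz, hz⟩, rfl⟩
      rw [h3, h4, sum_const, card_image_of_injective _ fun x y hxy => (Prod.mk.inj hxy).1,
        card_range, nsmul_eq_mul]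
      have : (K : ℂ) ≠ 0 := by exact_mod_cast hK.ne'
      field_simp
    have h5 : ∑ j, ‖twist U (ζ j) K v‖ ^ 2 = 2 * ‖v‖ ^ 2 := by
      have : (K : ℂ) ≠ 0 := by exact_mod_cast hK.ne'
      rw [h2] at h1
      have h6 : ((∑ j, ‖twist U (ζ j) K v‖ ^ 2 : ℝ) : ℂ) = ((2 * ‖v‖ ^ 2 : ℝ) : ℂ) := by
        push_cast at h1 ⊢
        rw [h1]
        field_simp
      exact_mod_cast h6
    rw [h5]
    nlinarith [norm_nonneg v]
  by_contra! hcon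
  have h1 : ∀ j, ‖twist U (ζ j) K v‖ ^ 2 < c ^ 2 / 2 := fun j => hcon _ (hζ j)
  rw [← sum_norm_sq_dft] at hb2
  have h2 : ∀ j, ‖ZMod.dft b j‖ ^ 2 ≤ c ^ 2 / 2 * ‖twist U (ζ j) K v‖ ^ 2 := fun j => by
    rw [hdft, Complex.norm_real, Real.norm_of_nonneg (sq_nonneg _), sq (‖_‖ ^ 2)]
    gcongr
    exact (h1 j).le
  have hcpos : 0 < c ^ 2 / 2 := (sq_nonneg _).trans_lt (h1 0)
  have h3 : c ^ 2 ≤ c ^ 2 / 2 * ∑ j, ‖twist U (ζ j) K v‖ ^ 2 := by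
    rw [mul_sum]
    exact hb2.trans (sum_le_sum fun j _ => h2 j)
  have h4 : ∑ j, ‖twist U (ζ j) K v‖ ^ 2 = 2 := le_antisymm hb0 (by nlinarith)
  have h5 : ∑ j, ‖ZMod.dft b j‖ ^ 2 < c ^ 2 := by
    by_cases hz : ∃ j, twist U (ζ j) K v ≠ 0
    · obtain ⟨j, hj⟩ := hz
      calc ∑ j, ‖ZMod.dft b j‖ ^ 2 < ∑ j, c ^ 2 / 2 * ‖twist U (ζ j) K v‖ ^ 2 := by
            refine sum_lt_sum (fun j _ => h2 j) ⟨j, mem_univ _, ?_⟩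
            rw [hdft, Complex.norm_real, Real.norm_of_nonneg (sq_nonneg _), sq (‖_‖ ^ 2)]
            have : 0 < ‖twist U (ζ j) K v‖ ^ 2 := by positivity
            gcongr
            exact h1 j
        _ = c ^ 2 := by rw [← mul_sum, h4]; ring
    · push Not at hz
      simp [hz] at h4
  linarith

theorem twist_mul (z : ℂ) (H' M : ℕ) (v : H) :
    twist U z (H' * M) v =
      (M : ℂ)⁻¹ • ∑ i ∈ range M, z ^ (H' * i) • U^[H' * i] (twist U z H' v) := by
  have hU : ∀ t : ℕ, ∀ (c : ℂ) (x : H), U^[t] (c • x) = c • U^[t] x := fun t c x => by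
    induction t with
    | zero => rfl
    | succ t ih => rw [Function.iterate_succ_apply', ih, map_smul, Function.iterate_succ_apply']
  have hsum : ∀ (t : ℕ) (f : ℕ → H), U^[t] (∑ h ∈ range H', f h) = ∑ h ∈ range H', U^[t] (f h) :=
    fun t f => by
      induction t with
      | zero => rfl
      | succ t ih =>
        simp only [Function.iterate_succ_apply', ih, map_sum]
  simp only [twist, hU, hsum]
  rw [show ∑ h ∈ range (H' * M), z ^ h • U^[h] v =
      ∑ i ∈ range M, ∑ h ∈ range H', z ^ (H' * i + h) • U^[H' * i + h] v by
    induction M with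
    | zero => simp
    | succ M ih => rw [mul_add, mul_one, sum_range_add, ih, sum_range_succ]]
  rw [smul_sum, smul_sum]
  refine sum_congr rfl fun i _ => ?_
  rw [smul_comm (z ^ (H' * i)), smul_smul, Nat.cast_mul, mul_inv, mul_comm (H' : ℂ)⁻¹]
  simp only [smul_sum]
  refine sum_congr rfl fun h _ => ?_
  rw [Function.iterate_add_apply, pow_add]
  simp only [mul_smul]

theorem norm_twist_mul_le {z : ℂ} (hz : ‖z‖ = 1) (H' : ℕ) {M : ℕ} (hM : 0 < M) (v : H) :
    ‖twist U z (H' * M) v‖ ≤ ‖twist U z H' v‖ := by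
  have hM' : (0 : ℝ) < M := by exact_mod_cast hM
  rw [twist_mul, norm_smul, norm_inv, Complex.norm_natCast, inv_mul_le_iff₀ hM']
  refine (norm_sum_le_of_le _ fun i _ => ?_).trans
    (b := ∑ i ∈ range M, ‖twist U z H' v‖) (by simp)
  rw [norm_smul, norm_pow, hz, one_pow, one_mul, norm_iterate]

theorem exists_eigenvector [CompleteSpace H] {v : H} (hv : ‖v‖ ≤ 1) {c : ℝ} (hc : 0 ≤ c)
    (h : ∃ᶠ i : ℕ in atTop, c ≤ av i.factorial fun h => av i.factorial fun h' =>
      ‖inner ℂ (U^[h'] v) (U^[h] v)‖) :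
    ∃ (z : ℂ) (w : H), ‖z‖ = 1 ∧ z • U w = w ∧ c / 2 ≤ ‖w‖ ∧ inner ℂ w v = ((‖w‖ ^ 2 : ℝ) : ℂ) := by
  let C : ℕ → Set ℂ := fun i =>
    {z | ‖z‖ = 1 ∧ ∀ k, 1 ≤ k → k ≤ i → c ^ 2 / 2 ≤ ‖twist U z k v‖ ^ 2}
  have hclosed : ∀ i, IsClosed (C i) := fun i => by
    have heq : C i = {z | ‖z‖ = 1} ∩ ⋂ k, ⋂ (_ : 1 ≤ k), ⋂ (_ : k ≤ i),
        {z | c ^ 2 / 2 ≤ ‖twist U z k v‖ ^ 2} := by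
      ext z
      simp [C]
    rw [heq]
    refine IsClosed.inter (isClosed_eq continuous_norm continuous_const) ?_
    refine isClosed_iInter fun k => isClosed_iInter fun _ => isClosed_iInter fun _ =>
      isClosed_le continuous_const ?_
    unfold twist
    fun_prop
  obtain ⟨z, hz⟩ := IsCompact.nonempty_iInter_of_sequence_nonempty_isCompact_isClosed C
    (fun i z hz => ⟨hz.1, fun k hk hki => hz.2 k hk (hki.trans i.le_succ)⟩)
    (fun i => by
      obtain ⟨n, hn, hin⟩ := (h.and_eventually (eventually_ge_atTop i)).exists
      obtain ⟨z, hz, hzn⟩ := exists_twist U hv hc n.factorial_pos hn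
      refine ⟨z, hz, fun k hk hki => hzn.trans ?_⟩
      obtain ⟨M, hM⟩ := Nat.dvd_factorial hk (hki.trans hin)
      rw [hM]
      have hM0 : 0 < M := Nat.pos_of_ne_zero fun h0 => by
        rw [h0, mul_zero] at hM
        exact n.factorial_ne_zero hM
      gcongr
      exact norm_twist_mul_le U hz k hM0 v)
    ((isCompact_closedBall (0 : ℂ) 1).of_isClosed_subset (hclosed 0) fun z hz => by
      simpa using hz.1.le)
    hclosed
  rw [Set.mem_iInter] at hz
  have hz1 : ‖z‖ = 1 := (hz 0).1
  set f : H →L[ℂ] H := z • U.toContinuousLinearMap with hf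
  have hfx : ∀ x, f x = z • U x := fun x => rfl
  have hfn : ‖f‖ ≤ 1 := ContinuousLinearMap.opNorm_le_bound _ zero_le_one fun x => by
    rw [hfx, norm_smul, hz1, U.norm_map]
  have hit : ∀ n, f^[n] v = z ^ n • U^[n] v := fun n => by
    induction n with
    | zero => simp
    | succ n ih =>
      rw [Function.iterate_succ_apply', ih, hfx, map_smul, smul_smul, ← pow_succ',
        Function.iterate_succ_apply']
  have hlim := f.tendsto_birkhoffAverage_orthogonalProjection hfn v
  set S := f.eqLocus (1 : H →L[ℂ] H) with hS
  set w := S.orthogonalProjectionOnto v with hw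
  have hwS : f (w : H) = w := w.2
  have hbirk : ∀ n, birkhoffAverage ℂ f _root_.id n v = twist U z n v := fun n => by
    simp only [birkhoffAverage, birkhoffSum, id, hit, twist]
  have hnorm : c ^ 2 / 2 ≤ ‖(w : H)‖ ^ 2 := by
    refine ge_of_tendsto (hlim.norm.pow 2) ?_
    filter_upwards [eventually_ge_atTop 1] with n hn
    rw [hbirk]
    exact (hz n).2 n hn le_rfl
  refine ⟨z, w, hz1, hwS, ?_, ?_⟩
  · refine le_of_sq_le_sq ?_ (norm_nonneg _)
    nlinarith [sq_nonneg c]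
  · have h1 : inner ℂ (w : H) v = inner ℂ (w : H) (w : H) := by
      rw [← sub_eq_zero, ← inner_sub_right]
      exact (Submodule.mem_orthogonal _ _).1 (Submodule.sub_starProjection_mem_orthogonal v) _ w.2
    rw [h1, inner_self_eq_norm_sq_to_K]
    push_cast
    rfl

end

end PolyConfig

namespace PolyConfig

open Topology FunAlg

variable {Y : Type*} [MeasurableSpace Y] {μ : Measure Y}

/-- The action of the integers on square-integrable functions. -/
noncomputable def IntAction.isometry (S : IntAction μ) : Lp ℂ 2 μ →ₗᵢ[ℂ] Lp ℂ 2 μ :=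
  Lp.compMeasurePreservingₗᵢ ℂ (S.T 1) (S.mp 1)

variable [IsProbabilityMeasure μ]

theorem IntAction.isometry_iterate (S : IntAction μ) (f : bddFun Y) (n : ℕ) :
    S.isometry^[n] ((bddFun.memLp (μ := μ) f).toLp f.1) =
      (bddFun.memLp (μ := μ) (bddFun.comp (S.T n) (S.mp n).measurable f)).toLp _ := by
  induction n with
  | zero =>
    refine MemLp.toLp_congr _ _ (Eventually.of_forall fun y => ?_)
    rw [bddFun.comp_apply, Nat.cast_zero, S.zero, id]
  | succ n ih =>
    rw [Function.iterate_succ_apply', ih]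
    refine (Lp.toLp_compMeasurePreserving _ (S.mp 1)).trans
      (MemLp.toLp_congr _ _ (Eventually.of_forall fun y => ?_))
    rw [bddFun.comp_apply, Nat.cast_succ, S.add]
    rfl

theorem inner_toLp (f g : bddFun Y) :
    inner ℂ ((bddFun.memLp (μ := μ) g).toLp g.1) ((bddFun.memLp (μ := μ) f).toLp f.1) =
      ∫ y, f.1 y * starRingEnd ℂ (g.1 y) ∂μ := by
  rw [L2.inner_def]
  refine integral_congr_ae ?_
  filter_upwards [(bddFun.memLp (μ := μ) f).coeFn_toLp, (bddFun.memLp (μ := μ) g).coeFn_toLp]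
    with y hy hy'
  rw [hy, hy', RCLike.inner_apply]

theorem IntAction.V_eq (S : IntAction μ) (f : bddFun Y) (N : ℕ) :
    S.sys.V [N] (ofFun μ f) = av N fun h => av N fun h' =>
      ‖inner ℂ (S.isometry^[h'] ((bddFun.memLp (μ := μ) f).toLp f.1))
        (S.isometry^[h] ((bddFun.memLp (μ := μ) f).toLp f.1))‖ := by
  simp only [Sys.V, S.isometry_iterate, inner_toLp]
  congr 1
  funext h
  congr 1
  funext h'
  congr 1
  exact int_ofFun (bddFun.comp (S.T h) (S.mp h).measurable f *
    bddFun.conj (bddFun.comp (S.T h') (S.mp h').measurable f))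

theorem Sys.τ_eq_zpow {A : Type*} [CommRing A] [Algebra ℂ A] (S : Sys A) {χ : A} {z : ℂ}
    (hz : z ≠ 0) (h : S.τ 1 χ = z • χ) (n : ℤ) : S.τ n χ = z ^ n • χ := by
  induction n using Int.induction_on with
  | zero => rw [S.τ_zero, zpow_zero, one_smul]
  | succ n ih =>
    rw [add_comm, S.τ_add, ih, map_smul, h, smul_smul, zpow_add₀ hz, zpow_one, mul_comm]
  | pred n ih =>
    have h1 : S.τ (-1) χ = z⁻¹ • χ := by
      have : S.τ (-1) (S.τ 1 χ) = χ := by rw [← S.τ_add, neg_add_cancel, S.τ_zero]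
      rw [h, map_smul] at this
      rw [← this, smul_smul, inv_mul_cancel₀ hz, one_smul, this]
    rw [sub_eq_add_neg, add_comm, S.τ_add, ih, map_smul, h1, smul_smul, zpow_add₀ hz, zpow_neg_one,
      mul_comm]

theorem IntAction.exists_eig (S : IntAction μ) (hS : Ergodic (S.T 1) μ) {f : bddFun Y}
    (hf : ∀ y, ‖f.1 y‖ ≤ 1) {c : ℝ} (hc : 0 < c)
    (h : ∃ᶠ i : ℕ in atTop, c ≤ S.sys.V [i.factorial] (ofFun μ f)) :
    ∃ χ z, S.sys.Eig χ z ∧ c / 2 ≤ ‖S.sys.m (ofFun μ f * χ)‖ := by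
  simp only [S.V_eq] at h
  obtain ⟨z, w, hz, hw, hcw, hwv⟩ :=
    exists_eigenvector S.isometry (norm_toLp_le zero_le_one hf) hc.le h
  have hz0 : z ≠ 0 := by
    rintro rfl
    simp at hz
  have hwT : ∀ᵐ y ∂μ, z * w (S.T 1 y) = w y := by
    have h1 := Lp.coeFn_compMeasurePreserving w (S.mp 1)
    have h2 := Lp.coeFn_smul z (S.isometry w)
    rw [hw] at h2
    filter_upwards [h1, h2] with y hy hy'
    rw [hy', Pi.smul_apply, smul_eq_mul]
    congr 1
    exact hy.symm
  obtain ⟨r, hr⟩ := hS.ae_eq_const_of_ae_eq_comp_ae (g := fun y => ‖w y‖)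
    (Lp.stronglyMeasurable w).aestronglyMeasurable.norm (by
      filter_upwards [hwT] with y hy
      rw [Function.comp, ← hy, norm_mul, hz, one_mul])
  have hr0 : 0 ≤ r := by
    obtain ⟨y, hy⟩ := hr.exists
    exact (norm_nonneg _).trans hy.le
  have hrw : r = ‖w‖ := by
    have h1 : inner ℂ w w = ((r ^ 2 : ℝ) : ℂ) := by
      rw [L2.inner_def]
      calc ∫ y, inner ℂ (w y) (w y) ∂μ = ∫ _, ((r ^ 2 : ℝ) : ℂ) ∂μ := by
            refine integral_congr_ae ?_
            filter_upwards [hr] with y hy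
            rw [inner_self_eq_norm_sq_to_K]
            change ‖w y‖ = r at hy
            rw [hy]
            push_cast
            rfl
        _ = _ := by simp
    rw [inner_self_eq_norm_sq_to_K] at h1
    have h2 : ‖w‖ ^ 2 = r ^ 2 := Complex.ofReal_injective (by push_cast at h1 ⊢; exact h1)
    exact ((pow_left_inj₀ (norm_nonneg _) hr0 two_ne_zero).1 h2).symm
  have hrpos : 0 < r := by linarith
  have hwm : Measurable w := (Lp.stronglyMeasurable w).measurable
  have hχ1 : ∀ y, ‖if ‖w y‖ = r then starRingEnd ℂ (w y) / r else 1‖ = 1 := fun y => by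
    split_ifs with hy
    · rw [norm_div, RCLike.norm_conj, hy, Complex.norm_real, Real.norm_of_nonneg hr0,
        div_self hrpos.ne']
    · simp
  let χ : bddFun Y := bddFun.mk (fun y => if ‖w y‖ = r then starRingEnd ℂ (w y) / r else 1)
    (Measurable.ite (measurableSet_eq_fun hwm.norm measurable_const)
      ((Complex.continuous_conj.measurable.comp hwm).div_const _) measurable_const)
    fun y => (hχ1 y).le
  have hχ : ∀ᵐ y ∂μ, χ.1 y = starRingEnd ℂ (w y) / r := by
    filter_upwards [hr] with y hy
    exact if_pos hy
  refine ⟨ofFun μ χ, z, ⟨⟨χ, fun y => (hχ1 y).le, rfl⟩, ?_, hz, ?_⟩, ?_⟩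
  · refine Eq.trans ?_ (map_one (ofFun μ))
    refine ofFun_eq.2 (Eventually.of_forall fun y => ?_)
    change χ.1 y * starRingEnd ℂ (χ.1 y) = 1
    rw [Complex.mul_conj, Complex.normSq_eq_norm_sq]
    have : ‖χ.1 y‖ = 1 := hχ1 y
    rw [this]
    simp
  · refine S.sys.τ_eq_zpow hz0 ?_
    rw [← map_smul]
    refine ofFun_eq.2 ?_
    filter_upwards [hχ, (S.mp 1).quasiMeasurePreserving.ae hχ, hwT] with y hy hy' hyT
    change χ.1 (S.T 1 y) = z * χ.1 y
    rw [hy, hy', ← hyT, map_mul]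
    have : z * starRingEnd ℂ z = 1 := by
      rw [Complex.mul_conj, Complex.normSq_eq_norm_sq, hz]
      simp
    linear_combination (-(starRingEnd ℂ (w (S.T 1 y)) / r)) * this
  · have h1 : S.sys.m (ofFun μ f * ofFun μ χ) = r := by
      rw [← map_mul]
      refine (int_ofFun (f * χ)).trans ?_
      have h2 : inner ℂ w ((bddFun.memLp (μ := μ) f).toLp f.1) = r * ∫ y, (f * χ).1 y ∂μ := by
        rw [L2.inner_def, ← integral_const_mul]
        refine integral_congr_ae ?_
        filter_upwards [(bddFun.memLp (μ := μ) f).coeFn_toLp, hχ] with y hy hy'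
        change _ = (r : ℂ) * (f.1 y * χ.1 y)
        rw [hy, RCLike.inner_apply, hy']
        have : (r : ℂ) ≠ 0 := by exact_mod_cast hrpos.ne'
        field_simp
      rw [hwv, ← hrw] at h2
      have : (r : ℂ) ≠ 0 := by exact_mod_cast hrpos.ne'
      refine mul_left_cancel₀ this ?_
      rw [← h2]
      push_cast
      ring
    rw [h1, Complex.norm_real, Real.norm_of_nonneg hr0, hrw]
    exact hcw

theorem ofFun_faithful {f : bddFun Y} (h : int μ (ofFun μ f * conj (ofFun μ f)) = 0) :
    ofFun μ f = 0 := by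
  rw [conj_ofFun, ← map_mul, int_ofFun] at h
  have h1 : ∀ y, (f * bddFun.conj f).1 y = ((‖f.1 y‖ ^ 2 : ℝ) : ℂ) := fun y => by
    change f.1 y * starRingEnd ℂ (f.1 y) = _
    rw [Complex.mul_conj, Complex.normSq_eq_norm_sq]
  simp only [h1] at h
  rw [integral_complex_ofReal, Complex.ofReal_eq_zero,
    integral_eq_zero_iff_of_nonneg (fun y => sq_nonneg _) (bddFun.memLp f).integrable_norm_pow'] at h
  refine (ofFun_eq (g := 0)).2 ?_ |>.trans (map_zero _)
  filter_upwards [h] with y hy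
  simpa using hy

/-- The class of functions with nonnegative real values. -/
def nonnegClass (μ : Measure Y) : Set (FunAlg μ) :=
  {a | ∃ f : bddFun Y, (∀ y, 0 ≤ (f.1 y).re ∧ (f.1 y).im = 0) ∧ ofFun μ f = a}

theorem pow_int_le {a : FunAlg μ} (ha : a ∈ nonnegClass μ) (k : ℕ) :
    (int μ a).re ^ k ≤ (int μ (a ^ k)).re := by
  obtain ⟨f, hf, rfl⟩ := ha
  have h1 : ∀ y, f.1 y = ((f.1 y).re : ℂ) := fun y => Complex.ext (by simp) (by simp [(hf y).2])
  obtain ⟨C, -, hC⟩ := f.2.2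
  rw [← map_pow, int_ofFun, int_ofFun]
  have h2 : ∀ y, (f ^ k).1 y = (((f.1 y).re ^ k : ℝ) : ℂ) := fun y => by
    change f.1 y ^ k = _
    rw [h1, Complex.ofReal_re, Complex.ofReal_pow]
  rw [integral_congr_ae (Eventually.of_forall h1), integral_congr_ae (Eventually.of_forall h2),
    integral_complex_ofReal, integral_complex_ofReal, Complex.ofReal_re, Complex.ofReal_re]
  exact pow_integral_le μ (Complex.measurable_re.comp (bddFun.measurable f)) (fun y => (hf y).1)
    (fun y => (Complex.re_le_norm _).trans (hC y)) k

theorem exists_dual {Φ : (ℕ → ℂ) →ₗ[ℂ] ℂ} (hΦ : ∀ u : ℕ → ℂ, (∀ n, ‖u n‖ ≤ 1) → ‖Φ u‖ ≤ 1)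
    (h1 : Φ (fun _ => 1) = 1) {F : ℕ → bddFun Y} (hF : ∀ n y, ‖(F n).1 y‖ ≤ 1) :
    ∃ f : bddFun Y, (∀ y, ‖f.1 y‖ ≤ 1) ∧
      ((∀ n, ofFun μ (F n) ∈ nonnegClass μ) → ofFun μ f ∈ nonnegClass μ) ∧
      ∀ a : bddFun Y, ∫ y, f.1 y * a.1 y ∂μ = Φ fun n => ∫ y, (F n).1 y * a.1 y ∂μ := by
  obtain ⟨f, hf, hfa⟩ := exists_dual_fun (μ := μ) hΦ hF
  refine ⟨f, hf, fun hpos => ?_, hfa⟩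
  have hre : ∀ n, ∀ᵐ y ∂μ, 0 ≤ ((F n).1 y).re ∧ ((F n).1 y).im = 0 := fun n => by
    obtain ⟨g, hg, hgF⟩ := hpos n
    filter_upwards [ofFun_eq.1 hgF] with y hy
    rw [← hy]
    exact hg y
  have hnn : ∀ᵐ y ∂μ, 0 ≤ (f.1 y).re ∧ (f.1 y).im = 0 := by
    refine ae_nonneg_of_integral fun s hs => ?_
    have h2 : ∀ g : bddFun Y, ∫ y, g.1 y * s.indicator (fun _ => (1 : ℂ)) y ∂μ =
        ∫ y in s, g.1 y ∂μ := fun g => by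
      rw [← integral_indicator hs]
      refine integral_congr_ae (Eventually.of_forall fun y => ?_)
      by_cases hy : y ∈ s <;> simp [hy]
    have h3 := hfa (bddFun.mk (s.indicator fun _ => 1) (measurable_const.indicator hs) fun y => by
      by_cases hy : y ∈ s <;> simp [hy])
    simp only [bddFun.mk, h2] at h3
    have h4 : ∀ n, ∫ y in s, (F n).1 y ∂μ = ((∫ y in s, ((F n).1 y).re ∂μ : ℝ) : ℂ) := fun n => by
      rw [← integral_complex_ofReal]
      refine integral_congr_ae (ae_restrict_of_ae ?_)
      filter_upwards [hre n] with y hy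
      exact Complex.ext (by simp) (by simp [hy.2])
    rw [h3]
    simp only [h4]
    refine functional_nonneg hΦ h1 (fun n => ?_) fun n => ?_
    · refine integral_nonneg_of_ae (ae_restrict_of_ae ?_)
      filter_upwards [hre n] with y hy using hy.1
    · have h5 : ‖∫ y in s, ((F n).1 y).re ∂μ‖ ≤ 1 * μ.real s :=
        norm_setIntegral_le_of_norm_le_const (measure_lt_top _ _) fun y _ =>
          (Complex.abs_re_le_norm _).trans (hF n y)
      rw [one_mul] at h5
      exact (le_abs_self _).trans (h5.trans measureReal_le_one)
  refine ⟨bddFun.mk (fun y => ((max (f.1 y).re 0 : ℝ) : ℂ))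
    (Complex.measurable_ofReal.comp ((Complex.measurable_re.comp (bddFun.measurable f)).max
      measurable_const)) fun y => ?_, fun y => ?_, ?_⟩
  · rw [Complex.norm_real, Real.norm_of_nonneg (le_max_right _ _)]
    exact max_le ((Complex.re_le_norm _).trans (hf y)) zero_le_one
  · exact ⟨le_max_right _ _, Complex.ofReal_im _⟩
  · refine ofFun_eq.2 ?_
    filter_upwards [hnn] with y hy
    change ((max (f.1 y).re 0 : ℝ) : ℂ) = f.1 y
    rw [max_eq_left hy.1]
    exact Complex.ext (by simp) (by simp [hy.2])

/-- The algebraic model of an ergodic system. -/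
noncomputable def IntAction.ergSys (S : IntAction μ) (hS : Ergodic (S.T 1) μ) :
    ErgSys (FunAlg μ) where
  toSys := S.sys
  Pos := nonnegClass μ
  m_one := by
    rw [← map_one (ofFun μ)]
    refine (int_ofFun 1).trans ?_
    change ∫ _, (1 : ℂ) ∂μ = 1
    simp
  faithful := by
    rintro _ ⟨f, -, rfl⟩ h
    exact ofFun_faithful h
  pos_τ := by
    rintro i _ ⟨f, hf, rfl⟩
    exact ⟨bddFun.comp (S.T i) (S.mp i).measurable f, fun y => hf _, rfl⟩
  dual Φ hΦ h1 F hF := by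
    choose G hG hGF using hF
    obtain ⟨f, hf, hpos, hfa⟩ := exists_dual (μ := μ) hΦ h1 hG
    refine ⟨ofFun μ f, ⟨f, hf, rfl⟩, fun h => hpos fun n => by rw [hGF]; exact h n, ?_⟩
    rintro _ ⟨a, -, rfl⟩
    rw [← map_mul]
    refine (int_ofFun (f * a)).trans ((hfa a).trans ?_)
    congr 1
    funext n
    rw [← hGF, ← map_mul]
    exact (int_ofFun (G n * a)).symm
  pow_le a _ ha k := pow_int_le ha _
  ergodic := by
    rintro _ ⟨f, -, rfl⟩ h
    obtain ⟨c, hc⟩ := hS.ae_eq_const_of_ae_eq_comp_ae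
      (bddFun.measurable f).aestronglyMeasurable (ofFun_eq.1 (h 1))
    refine ⟨c, ?_⟩
    rw [← map_one (ofFun μ), ← map_smul]
    refine ofFun_eq.2 ?_
    filter_upwards [hc] with y hy
    rw [hy]
    change c = c * 1
    rw [mul_one]
  inverse := by
    rintro _ ⟨f, hf, rfl⟩ c hc h
    exact S.exists_eig hS hf hc h

end PolyConfig

namespace PolyConfig

open Topology ProbabilityTheory

section AlmostInvariant

theorem abs_birkhoffAverage_le {Y : Type*} {T : Y → Y} {f : Y → ℝ} (hf : ∀ y, |f y| ≤ 1)
    (n : ℕ) (y : Y) : |birkhoffAverage ℝ T f n y| ≤ 1 := by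
  rcases Nat.eq_zero_or_pos n with rfl | hn
  · simp
  have hn' : (0 : ℝ) < n := by exact_mod_cast hn
  rw [birkhoffAverage, smul_eq_mul, abs_mul, abs_inv, Nat.abs_cast, inv_mul_le_iff₀ hn', mul_one,
    birkhoffSum]
  refine (abs_sum_le_sum_abs _ _).trans ((sum_le_sum fun k _ => hf _).trans ?_)
  simp

variable {Y : Type*} [MeasurableSpace Y] {μ : Measure Y} {T : Y → Y}

/-- The σ-algebra of almost invariant sets. -/
@[reducible]
def almostInvariant (_hT : MeasurePreserving T μ μ) : MeasurableSpace Y where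
  MeasurableSet' s := MeasurableSet s ∧ T ⁻¹' s =ᵐ[μ] s
  measurableSet_empty := ⟨MeasurableSet.empty, by
    rw [Set.preimage_empty]
    exact EventuallyEq.rfl⟩
  measurableSet_compl s hs := ⟨hs.1.compl, by
    rw [Set.preimage_compl]
    exact hs.2.compl⟩
  measurableSet_iUnion s hs := ⟨MeasurableSet.iUnion fun i => (hs i).1, by
    rw [Set.preimage_iUnion]
    exact Filter.EventuallyEq.countable_iUnion fun i => (hs i).2⟩

variable (hT : MeasurePreserving T μ μ)

theorem almostInvariant_le : almostInvariant hT ≤ ‹MeasurableSpace Y› := fun _ hs => hs.1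

theorem setIntegral_comp {s : Set Y} (hs : MeasurableSet[almostInvariant hT] s) {f : Y → ℝ}
    (hf : AEStronglyMeasurable f μ) : ∫ y in s, f (T y) ∂μ = ∫ y in s, f y ∂μ := by
  rw [← setIntegral_congr_set hs.2]
  have h := setIntegral_map (μ := μ) (g := T) (f := f) hs.1 (by rwa [hT.map_eq]) hT.aemeasurable
  rw [hT.map_eq] at h
  exact h.symm

theorem setIntegral_iterate {s : Set Y} (hs : MeasurableSet[almostInvariant hT] s) {f : Y → ℝ}
    (hf : AEStronglyMeasurable f μ) (n : ℕ) :
    ∫ y in s, f (T^[n] y) ∂μ = ∫ y in s, f y ∂μ := by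
  induction n with
  | zero => rfl
  | succ n ih =>
    rw [← ih]
    exact setIntegral_comp hT hs (hf.comp_measurePreserving (hT.iterate n))

theorem measurable_almostInvariant {g : Y → ℝ} (hg : Measurable g) (h : g ∘ T =ᵐ[μ] g) :
    Measurable[almostInvariant hT] g := fun B hB => by
  refine ⟨hg hB, ?_⟩
  filter_upwards [h] with y hy
  change (g (T y) ∈ B) = (g y ∈ B)
  rw [← hy]
  rfl

theorem measurable_birkhoffAverage {f : Y → ℝ} (hf : Measurable f) (hT : Measurable T) (n : ℕ) :
    Measurable (birkhoffAverage ℝ T f n) := by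
  unfold birkhoffAverage birkhoffSum
  have h : Measurable fun y => ∑ k ∈ range n, f (T^[k] y) :=
    Finset.measurable_fun_sum _ fun k _ => hf.comp (hT.iterate k)
  exact h.const_mul ((n : ℝ)⁻¹)

theorem setIntegral_birkhoffAverage {s : Set Y} (hs : MeasurableSet[almostInvariant hT] s)
    {f : Y → ℝ} (hf : Integrable f μ) {n : ℕ} (hn : n ≠ 0) :
    ∫ y in s, birkhoffAverage ℝ T f n y ∂μ = ∫ y in s, f y ∂μ := by
  simp only [birkhoffAverage, birkhoffSum]
  have hi : ∀ k ∈ range n, Integrable (fun y => f (T^[k] y)) (μ.restrict s) := fun k _ =>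
    ((hT.iterate k).integrable_comp_of_integrable hf).integrableOn
  rw [integral_smul, integral_finsetSum _ hi]
  simp only [setIntegral_iterate hT hs hf.aestronglyMeasurable]
  have : (n : ℝ) ≠ 0 := by exact_mod_cast hn
  simp [this]

variable [IsProbabilityMeasure μ]

theorem exists_birkhoffAverage_tendsto {f : Y → ℝ} (hf : Measurable f) (hf1 : ∀ y, |f y| ≤ 1) :
    ∃ ns : ℕ → ℕ, StrictMono ns ∧ ∀ᵐ y ∂μ,
      Tendsto (fun i => birkhoffAverage ℝ T f (ns i) y) atTop
        (𝓝 (μ[f | almostInvariant hT] y)) := by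
  have hfL : MemLp f 2 μ := MemLp.of_bound hf.aestronglyMeasurable 1 (Eventually.of_forall hf1)
  have hfi : Integrable f μ := hfL.integrable (by norm_num)
  let U : Lp ℝ 2 μ →ₗᵢ[ℝ] Lp ℝ 2 μ := Lp.compMeasurePreservingₗᵢ ℝ T hT
  set F := hfL.toLp f with hF
  have hit : ∀ n, U^[n] F =ᵐ[μ] fun y => f (T^[n] y) := fun n => by
    induction n with
    | zero => exact hfL.coeFn_toLp
    | succ n ih =>
      rw [Function.iterate_succ_apply']
      refine (Lp.coeFn_compMeasurePreserving _ hT).trans ?_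
      exact hT.quasiMeasurePreserving.ae_eq_comp ih
  let J : Lp ℝ 2 μ → Lp ℝ 2 μ := fun G => G
  have hsum : ∀ n, ⇑(birkhoffSum U J n F) =ᵐ[μ] birkhoffSum T f n := fun n => by
    induction n with
    | zero => exact Lp.coeFn_zero ℝ 2 μ
    | succ n ih =>
      rw [birkhoffSum_succ]
      filter_upwards [Lp.coeFn_add (birkhoffSum U J n F) (U^[n] F), ih, hit n]
        with y h1 h2 h3
      rw [birkhoffSum_succ, ← h2, ← h3]
      exact h1
  have havg : ∀ n, ⇑(birkhoffAverage ℝ U J n F) =ᵐ[μ] birkhoffAverage ℝ T f n := fun n => by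
    filter_upwards [Lp.coeFn_smul (n : ℝ)⁻¹ (birkhoffSum U J n F), hsum n] with y h1 h2
    rw [birkhoffAverage, birkhoffAverage, h1, Pi.smul_apply, h2]
  have hlim := U.toContinuousLinearMap.tendsto_birkhoffAverage_orthogonalProjection
    U.norm_toContinuousLinearMap_le F
  set S := U.toContinuousLinearMap.eqLocus (1 : Lp ℝ 2 μ →L[ℝ] Lp ℝ 2 μ)
  set w : S := S.orthogonalProjectionOnto F
  have hw : U (w : Lp ℝ 2 μ) = w := w.2
  have hwT : (w : Lp ℝ 2 μ) ∘ T =ᵐ[μ] (w : Lp ℝ 2 μ) := by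
    have h1 := Lp.coeFn_compMeasurePreserving (w : Lp ℝ 2 μ) hT
    change ⇑(U (w : Lp ℝ 2 μ)) =ᵐ[μ] _ at h1
    rw [hw] at h1
    exact h1.symm
  obtain ⟨ns, hns, hae⟩ := (tendstoInMeasure_of_tendsto_Lp hlim).exists_seq_tendsto_ae
  have hae' : ∀ᵐ y ∂μ, Tendsto (fun i => birkhoffAverage ℝ T f (ns i) y) atTop
      (𝓝 ((w : Lp ℝ 2 μ) y)) := by
    filter_upwards [hae, ae_all_iff.2 havg] with y hy hy'
    exact hy.congr fun i => hy' (ns i)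
  refine ⟨ns, hns, ?_⟩
  have hcond : (w : Lp ℝ 2 μ) =ᵐ[μ] μ[f | almostInvariant hT] := by
    refine ae_eq_condExp_of_forall_setIntegral_eq (almostInvariant_le hT) hfi
      (fun s _ _ => ((Lp.memLp (w : Lp ℝ 2 μ)).integrable (by norm_num)).integrableOn)
      (fun s hs _ => ?_)
      (measurable_almostInvariant hT (Lp.stronglyMeasurable (w : Lp ℝ 2 μ)).measurable
        hwT).stronglyMeasurable.aestronglyMeasurable
    have h1 : Tendsto (fun i => ∫ y in s, birkhoffAverage ℝ T f (ns i) y ∂μ) atTop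
        (𝓝 (∫ y in s, (w : Lp ℝ 2 μ) y ∂μ)) := by
      refine tendsto_integral_of_dominated_convergence (fun _ => 1)
        (fun i => (measurable_birkhoffAverage hf hT.measurable _).aestronglyMeasurable)
        (integrable_const _) (fun i => Eventually.of_forall fun y => abs_birkhoffAverage_le hf1 _ _)
        (ae_restrict_of_ae hae')
    refine tendsto_nhds_unique h1 (tendsto_const_nhds.congr' ?_)
    filter_upwards [eventually_ge_atTop 1] with i hi
    have : ns i ≠ 0 := by
      have := hns.id_le i
      change i ≤ ns i at this
      omega
    exact (setIntegral_birkhoffAverage hT hs hfi this).symm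
  filter_upwards [hae', hcond] with y hy hy'
  rwa [← hy']

theorem condExp_comp_almostInvariant {f : Y → ℝ} (hf : Integrable f μ) :
    μ[f ∘ T | almostInvariant hT] =ᵐ[μ] μ[f | almostInvariant hT] := by
  refine ae_eq_condExp_of_forall_setIntegral_eq (almostInvariant_le hT) hf
    (fun s _ _ => integrable_condExp.integrableOn) (fun s hs _ => ?_)
    stronglyMeasurable_condExp.aestronglyMeasurable
  rw [setIntegral_condExp (almostInvariant_le hT)
    (hT.integrable_comp_of_integrable hf) hs]
  exact setIntegral_comp hT hs hf.aestronglyMeasurable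

end AlmostInvariant

theorem exists_countable_piSystem (Y : Type*) [m : MeasurableSpace Y]
    [MeasurableSpace.CountablyGenerated Y] :
    ∃ C : Set (Set Y), C.Countable ∧ IsPiSystem C ∧ m = MeasurableSpace.generateFrom C :=
  ⟨generateSetAlgebra (MeasurableSpace.countableGeneratingSet Y),
    countable_generateSetAlgebra MeasurableSpace.countable_countableGeneratingSet,
    fun _ hs _ ht _ => isSetAlgebra_generateSetAlgebra.inter_mem hs ht, by
      rw [generateFrom_generateSetAlgebra_eq, MeasurableSpace.generateFrom_countableGeneratingSet]⟩

section Kernel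

variable {Y : Type*} {m : MeasurableSpace Y} [mΩ : MeasurableSpace Y] [StandardBorelSpace Y]
  {μ : Measure Y} {T : Y → Y}
  [IsProbabilityMeasure μ] (hT : MeasurePreserving T μ μ)

theorem ae_condExpKernel (hm : m ≤ mΩ) {p : Y → Prop}
    (h : ∀ᵐ y ∂μ, p y) : ∀ᵐ ω ∂μ, ∀ᵐ y ∂condExpKernel μ m ω, p y := by
  refine ae_of_ae_trim hm (Measure.ae_ae_of_ae_comp ?_)
  rwa [condExpKernel_comp_trim hm]

theorem condExpKernel_ae_const (hm : m ≤ mΩ)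
    {g : Y → ℝ} (hg : Measurable[m] g) (hg1 : ∀ y, |g y| ≤ 1) :
    ∀ᵐ ω ∂μ, ∀ᵐ y ∂condExpKernel μ m ω, g y = g ω := by
  have hgm : Measurable g := hg.mono hm le_rfl
  have hbd : ∀ ν : Measure Y, IsProbabilityMeasure ν → Integrable g ν ∧
      Integrable (fun y => g y ^ 2) ν := fun ν _ =>
    ⟨Integrable.of_bound hgm.aestronglyMeasurable 1 (Eventually.of_forall hg1),
      Integrable.of_bound (hgm.pow_const 2).aestronglyMeasurable 1 (Eventually.of_forall fun y => by
        rw [Real.norm_eq_abs, abs_pow]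
        exact pow_le_one₀ (abs_nonneg _) (hg1 y))⟩
  have h1 := condExp_ae_eq_integral_condExpKernel hm (hbd μ inferInstance).1
  have h2 := condExp_ae_eq_integral_condExpKernel hm (hbd μ inferInstance).2
  rw [condExp_of_stronglyMeasurable hm hg.stronglyMeasurable (hbd μ inferInstance).1] at h1
  rw [condExp_of_stronglyMeasurable hm (hg.pow_const 2).stronglyMeasurable
    (hbd μ inferInstance).2] at h2
  filter_upwards [h1, h2] with ω h1 h2
  obtain ⟨i1, i2⟩ := hbd (condExpKernel μ m ω) inferInstance
  have h3 : ∫ y, (g y - g ω) ^ 2 ∂condExpKernel μ m ω = 0 := by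
    have : ∀ y, (g y - g ω) ^ 2 = g y ^ 2 - (2 * g ω) * g y + g ω ^ 2 := fun y => by ring
    simp only [this]
    have i3 : Integrable (fun y => g y ^ 2 - (2 * g ω) * g y) (condExpKernel μ m ω) :=
      i2.sub (i1.const_mul _)
    rw [integral_add i3 (integrable_const _), integral_sub i2 (i1.const_mul _), integral_const_mul,
      ← h1, ← h2]
    simp
    ring
  have hintg : Integrable (fun y => (g y - g ω) ^ 2) (condExpKernel μ m ω) := by
    have : ∀ y, (g y - g ω) ^ 2 = g y ^ 2 - (2 * g ω) * g y + g ω ^ 2 := fun y => by ring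
    simp only [this]
    exact (i2.sub (i1.const_mul _)).add (integrable_const _)
  have h4 := (integral_eq_zero_iff_of_nonneg (fun y => sq_nonneg _) hintg).1 h3
  filter_upwards [h4] with y hy
  simpa [sub_eq_zero] using hy

theorem condExpKernel_measurePreserving :
    ∀ᵐ ω ∂μ, MeasurePreserving T (condExpKernel μ (almostInvariant hT) ω)
      (condExpKernel μ (almostInvariant hT) ω) := by
  obtain ⟨C, hC, hpi, hgen⟩ := exists_countable_piSystem Y
  have hCm : ∀ s ∈ C, MeasurableSet s := fun s hs => by
    rw [hgen]
    exact MeasurableSpace.measurableSet_generateFrom hs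
  have key : ∀ s ∈ C, ∀ᵐ ω ∂μ, condExpKernel μ (almostInvariant hT) ω (T ⁻¹' s) =
      condExpKernel μ (almostInvariant hT) ω s := fun s hs => by
    have h1 := condExpKernel_ae_eq_condExp (μ := μ) (almostInvariant_le hT) (hCm s hs)
    have h2 := condExpKernel_ae_eq_condExp (μ := μ) (almostInvariant_le hT)
      (hT.measurable (hCm s hs))
    have h3 := condExp_comp_almostInvariant hT
      (f := s.indicator fun _ => (1 : ℝ)) ((integrable_const 1).indicator (hCm s hs))
    filter_upwards [h1, h2, h3] with ω h1 h2 h3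
    refine (measureReal_eq_measureReal_iff (measure_ne_top _ _) (measure_ne_top _ _)).1 ?_
    rw [h1, h2]
    exact h3
  filter_upwards [(ae_ball_iff hC).2 key] with ω hω
  refine ⟨hT.measurable, ?_⟩
  have : IsProbabilityMeasure ((condExpKernel μ (almostInvariant hT) ω).map T) :=
    Measure.isProbabilityMeasure_map hT.measurable.aemeasurable
  refine ext_of_generate_finite C hgen hpi (fun s hs => ?_) (by simp)
  rw [Measure.map_apply hT.measurable (hCm s hs)]
  exact hω s hs

theorem condExpKernel_ergodic :
    ∀ᵐ ω ∂μ, Ergodic T (condExpKernel μ (almostInvariant hT) ω) := by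
  obtain ⟨C, hC, hpi, hgen⟩ := exists_countable_piSystem Y
  have hCm : ∀ s ∈ C, MeasurableSet s := fun s hs => by
    rw [hgen]
    exact MeasurableSpace.measurableSet_generateFrom hs
  have hle := almostInvariant_le hT
  set κ := condExpKernel μ (almostInvariant hT) with hκ
  have key : ∀ s ∈ C, ∀ᵐ ω ∂μ, ∃ ns : ℕ → ℕ, StrictMono ns ∧ ∀ᵐ y ∂κ ω,
      Tendsto (fun i => birkhoffAverage ℝ T (s.indicator fun _ => 1) (ns i) y) atTop
        (𝓝 ((κ ω).real s)) := fun s hs => by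
    obtain ⟨ns, hns, hae⟩ := exists_birkhoffAverage_tendsto hT
      (f := s.indicator fun _ => (1 : ℝ)) (measurable_const.indicator (hCm s hs)) fun y => by
        by_cases hy : y ∈ s <;> simp [hy]
    have h1 := condExpKernel_ae_eq_condExp (μ := μ) hle (hCm s hs)
    have h2 := condExpKernel_ae_const (μ := μ) hle (g := fun ω => (κ ω).real s)
      (measurable_condExpKernel (hCm s hs)).ennreal_toReal fun y => by
        rw [abs_of_nonneg measureReal_nonneg]
        exact measureReal_le_one
    filter_upwards [ae_condExpKernel hle hae, ae_condExpKernel hle h1, h2] with ω h1 h2 h3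
    refine ⟨ns, hns, ?_⟩
    filter_upwards [h1, h2, h3] with y h1 h2 h3
    rw [← h3]
    exact h2 ▸ h1
  filter_upwards [(ae_ball_iff hC).2 key, condExpKernel_measurePreserving hT] with ω hω hmp
  refine ⟨hmp, ⟨fun s hs hTs => ?_⟩⟩
  have hsi : MeasurableSet[almostInvariant hmp] s := ⟨hs, by
    rw [hTs]
    exact EventuallyEq.rfl⟩
  have h1 : ∀ t ∈ C, (κ ω).real (t ∩ s) = (κ ω).real s * (κ ω).real t := fun t ht => by
    obtain ⟨ns, hns, hae⟩ := hω t ht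
    have h2 : Tendsto (fun i => ∫ y in s, birkhoffAverage ℝ T (t.indicator fun _ => 1) (ns i) y ∂κ ω)
        atTop (𝓝 (∫ y in s, (κ ω).real t ∂κ ω)) := by
      refine tendsto_integral_of_dominated_convergence (fun _ => 1)
        (fun i => (measurable_birkhoffAverage (measurable_const.indicator (hCm t ht))
          hT.measurable _).aestronglyMeasurable)
        (integrable_const _) (fun i => Eventually.of_forall fun y =>
          abs_birkhoffAverage_le (fun y => by by_cases hy : y ∈ t <;> simp [hy]) _ _)
        (ae_restrict_of_ae hae)
    rw [setIntegral_const, smul_eq_mul] at h2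
    refine tendsto_nhds_unique (tendsto_const_nhds.congr' ?_) h2
    filter_upwards [eventually_ge_atTop 1] with i hi
    have : ns i ≠ 0 := by
      have := hns.id_le i
      change i ≤ ns i at this
      omega
    rw [setIntegral_birkhoffAverage hmp hsi ((integrable_const 1).indicator (hCm t ht)) this,
      integral_indicator_const _ (hCm t ht), smul_eq_mul, mul_one,
      measureReal_restrict_apply (hCm t ht)]
  have h2 : (κ ω).restrict s = (κ ω s) • κ ω := by
    have : IsFiniteMeasure ((κ ω).restrict s) := inferInstance
    refine ext_of_generate_finite C hgen hpi (fun t ht => ?_) (by simp)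
    rw [Measure.restrict_apply (hCm t ht), Measure.smul_apply, smul_eq_mul,
      ← ENNReal.toReal_eq_toReal_iff' (measure_ne_top _ _)
        (ENNReal.mul_ne_top (measure_ne_top _ _) (measure_ne_top _ _)), ENNReal.toReal_mul]
    exact h1 t ht
  have h3 : κ ω s = κ ω s * κ ω s := by
    have := congrArg (fun ν : Measure Y => ν s) h2
    simpa using this
  have h4 : κ ω s = 0 ∨ κ ω s = 1 := by
    by_cases h0 : κ ω s = 0
    · exact Or.inl h0
    · right
      have := (ENNReal.mul_right_inj h0 (measure_ne_top (κ ω) s)).1 (h3.symm.trans (mul_one _).symm)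
      exact this
  rw [eventuallyConst_set']
  rcases h4 with h | h
  · exact Or.inl (ae_eq_empty.2 h)
  · exact Or.inr (ae_eq_univ.2 ((prob_compl_eq_zero_iff hs).2 h))

end Kernel

end PolyConfig

namespace PolyConfig

open Topology Polynomial

section

variable {Y : Type*} [MeasurableSpace Y] {ν : Measure Y} [IsProbabilityMeasure ν]

/-- The indicator function of a measurable set. -/
noncomputable def bddFun.ind (s : Set Y) (hs : MeasurableSet s) : bddFun Y :=
  bddFun.mk (s.indicator fun _ => 1) (measurable_const.indicator hs) fun y => by
    by_cases hy : y ∈ s <;> simp [hy]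

theorem IntAction.m_prod_ind (S : IntAction ν) {ι : Type*} [Fintype ι] (a : ι → ℤ) {s : Set Y}
    (hs : MeasurableSet s) :
    S.sys.m (∏ i, S.sys.τ (a i) (FunAlg.ofFun ν (bddFun.ind s hs))) =
      (ν.real (⋂ i, S.T (a i) ⁻¹' s) : ℂ) := by
  classical
  change FunAlg.int ν (∏ i, FunAlg.koopman S (a i) (FunAlg.ofFun ν (bddFun.ind s hs))) = _
  simp only [FunAlg.koopman_ofFun]
  rw [← map_prod, FunAlg.int_ofFun]
  have hm : MeasurableSet (⋂ i, S.T (a i) ⁻¹' s) :=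
    MeasurableSet.iInter fun i => (S.mp (a i)).measurable hs
  have h : (∏ i, bddFun.comp (S.T (a i)) (S.mp (a i)).measurable (bddFun.ind s hs)).1 =
      (⋂ i, S.T (a i) ⁻¹' s).indicator fun _ => (1 : ℂ) := by
    funext y
    have h1 : (∏ i, bddFun.comp (S.T (a i)) (S.mp (a i)).measurable (bddFun.ind s hs)).1 y =
        ∏ i, s.indicator (fun _ => (1 : ℂ)) (S.T (a i) y) := by
      change (bddFun Y).val _ y = _
      rw [map_prod, Finset.prod_apply]
      rfl
    rw [h1]
    by_cases hy : y ∈ ⋂ i, S.T (a i) ⁻¹' s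
    · rw [Set.indicator_of_mem hy]
      exact prod_eq_one fun i _ => Set.indicator_of_mem (s := s) (Set.mem_iInter.1 hy i) _
    · rw [Set.indicator_of_notMem hy]
      obtain ⟨i, hi⟩ := not_forall.1 fun h => hy (Set.mem_iInter.2 h)
      exact prod_eq_zero (mem_univ i) (Set.indicator_of_notMem (s := s) hi _)
  rw [h, integral_indicator_const _ hm]
  simp

theorem IntAction.eventually_le_average (S : IntAction ν) (hS : Ergodic (S.T 1) ν) {ι : Type*}
    [Fintype ι] [DecidableEq ι] {k : ℕ} (hk : Fintype.card ι = k + 1) {P : ℕ → ι → ℤ[X]}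
    (hP : ∀ W, AffIndep (P W)) (hdvd : ∀ W i n, (W.factorial : ℤ) ∣ (P W i).eval n)
    {s : Set Y} (hs : MeasurableSet s) {η : ℝ} (hη : 0 < η) :
    ∃ W₀, ∀ W ≥ W₀, ∀ᶠ N : ℕ in atTop, ν.real s ^ (k + 1) - η ≤
      (N : ℝ)⁻¹ * ∑ n ∈ range N, ν.real (⋂ i, S.T ((P W i).eval (n : ℤ)) ⁻¹' s) := by
  obtain ⟨E₀, -⟩ := exists_mean (hyperfilter ℕ) (Nat.hyperfilter_le_atTop)
  set f := FunAlg.ofFun ν (bddFun.ind s hs) with hf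
  have hfB : f ∈ (S.ergSys hS).B := ⟨bddFun.ind s hs, fun y => by
    change ‖s.indicator (fun _ => (1 : ℂ)) y‖ ≤ 1
    by_cases hy : y ∈ s <;> simp [hy], rfl⟩
  have hfp : f ∈ (S.ergSys hS).Pos := ⟨bddFun.ind s hs, fun y => by
    change 0 ≤ (s.indicator (fun _ => (1 : ℂ)) y).re ∧ (s.indicator (fun _ => (1 : ℂ)) y).im = 0
    by_cases hy : y ∈ s <;> simp [hy], rfl⟩
  have hm : (S.ergSys hS).m f = (ν.real s : ℂ) := by
    refine (FunAlg.int_ofFun _).trans ((integral_indicator_const _ hs).trans ?_)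
    simp
  obtain ⟨W₀, hW₀⟩ := (S.ergSys hS).le_corr E₀ hk hP hdvd hfB hfp (half_pos hη)
  refine ⟨W₀, fun W hW => ?_⟩
  by_contra hne
  have hfr : ∃ᶠ N : ℕ in atTop, (N : ℝ)⁻¹ *
      ∑ n ∈ range N, ν.real (⋂ i, S.T ((P W i).eval (n : ℤ)) ⁻¹' s) ≤ ν.real s ^ (k + 1) - η :=
    (not_eventually.1 hne).mono fun N hN => (not_le.1 hN).le
  rw [frequently_iff_neBot] at hfr
  obtain ⟨F, hF⟩ := @Ultrafilter.exists_le _ _ hfr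
  obtain ⟨E, hE⟩ := exists_mean F (hF.trans inf_le_left)
  have h1 := hW₀ W hW E
  have hu := hE (fun n => (ν.real (⋂ i, S.T ((P W i).eval (n : ℤ)) ⁻¹' s) : ℂ)) fun n => by
    rw [Complex.norm_real, Real.norm_of_nonneg measureReal_nonneg]
    exact measureReal_le_one
  have h2 : (S.ergSys hS).corr E (P W) (fun _ => f) =
      E.L fun n => (ν.real (⋂ i, S.T ((P W i).eval (n : ℤ)) ⁻¹' s) : ℂ) := by
    refine congrArg E.L (funext fun n => ?_)
    exact S.m_prod_ind _ hs
  rw [h2, hm, Complex.ofReal_re] at h1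
  have h3 : (E.L fun n => (ν.real (⋂ i, S.T ((P W i).eval (n : ℤ)) ⁻¹' s) : ℂ)).re ≤
      ν.real s ^ (k + 1) - η := by
    refine le_of_tendsto (Complex.continuous_re.continuousAt.tendsto.comp hu) ?_
    refine hF (mem_inf_of_right (mem_principal.2 ?_))
    intro N hN
    rw [Set.mem_ofPred_eq] at hN
    refine le_trans (le_of_eq ?_) hN
    change (cesaro _ N).re = _
    rw [cesaro, ← Complex.ofReal_natCast, ← Complex.ofReal_inv, ← Complex.ofReal_sum,
      ← Complex.ofReal_mul, Complex.ofReal_re]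
  linarith

/-- An invertible measure-preserving transformation generates an action. -/
def IntAction.ofOne (T : ℤ → Y → Y) (hzero : T 0 = id) (hadd : ∀ i j, T (i + j) = T i ∘ T j)
    (hT : ∀ i, Measurable (T i)) (h : MeasurePreserving (T 1) ν ν) : IntAction ν where
  T := T
  zero := hzero
  add := hadd
  mp := by
    have hneg : MeasurePreserving (T (-1)) ν ν := by
      refine ⟨hT _, ?_⟩
      conv_lhs => rw [← h.map_eq]
      rw [Measure.map_map (hT _) (hT _), ← hadd, neg_add_cancel, hzero, Measure.map_id]
    intro i
    induction i using Int.induction_on with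
    | zero => rw [hzero]; exact MeasurePreserving.id ν
    | succ i ih => rw [hadd]; exact ih.comp h
    | pred i ih => rw [sub_eq_add_neg, hadd]; exact ih.comp hneg

end

end PolyConfig

namespace PolyConfig

open Topology Polynomial ProbabilityTheory

section

variable {Y : Type*} {m : MeasurableSpace Y} [mΩ : MeasurableSpace Y] [StandardBorelSpace Y]
  {μ : Measure Y} [IsProbabilityMeasure μ]

theorem measurable_condExpKernel_real (hm : m ≤ mΩ) {s : Set Y} (hs : MeasurableSet s) :
    Measurable fun ω => (condExpKernel μ m ω).real s :=
  ((measurable_condExpKernel hs).mono hm le_rfl).ennreal_toReal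

theorem integrable_condExpKernel_real (hm : m ≤ mΩ) {s : Set Y} (hs : MeasurableSet s) :
    Integrable (fun ω => (condExpKernel μ m ω).real s) μ :=
  Integrable.of_bound (measurable_condExpKernel_real hm hs).aestronglyMeasurable 1
    (Eventually.of_forall fun ω => by
      rw [Real.norm_of_nonneg measureReal_nonneg]
      exact measureReal_le_one)

theorem integral_condExpKernel_real (hm : m ≤ mΩ) {s : Set Y} (hs : MeasurableSet s) :
    ∫ ω, (condExpKernel μ m ω).real s ∂μ = μ.real s := by
  rw [integral_congr_ae (condExpKernel_ae_eq_condExp hm hs), integral_condExp hm,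
    integral_indicator_const _ hs, smul_eq_mul, mul_one]

theorem exists_le_measure_iInter {T : ℤ → Y → Y} (hzero : T 0 = id)
    (hadd : ∀ i j, T (i + j) = T i ∘ T j) (hTm : ∀ i, Measurable (T i))
    (hT : MeasurePreserving (T 1) μ μ) {ι : Type*} [Fintype ι] [DecidableEq ι] {k : ℕ}
    (hk : Fintype.card ι = k + 1) {P : ℕ → ι → ℤ[X]} (hP : ∀ W, AffIndep (P W))
    (hdvd : ∀ W i n, (W.factorial : ℤ) ∣ (P W i).eval n) {s : Set Y} (hs : MeasurableSet s)
    {η : ℝ} (hη : 0 < η) :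
    ∃ W, ∃ n : ℕ, 1 ≤ n ∧
      μ.real s ^ (k + 1) - η ≤ μ.real (⋂ i, T ((P W i).eval (n : ℤ)) ⁻¹' s) := by
  by_contra! hcon
  set κ := condExpKernel μ (almostInvariant hT) with hκ
  have hm := almostInvariant_le hT
  set A : ℕ → ℕ → Set Y := fun W n => ⋂ i, T ((P W i).eval (n : ℤ)) ⁻¹' s with hA
  have hAm : ∀ W n, MeasurableSet (A W n) := fun W n => MeasurableSet.iInter fun i => hTm _ hs
  set g : ℕ → ℕ → Y → ℝ := fun W N ω =>
    (N : ℝ)⁻¹ * ∑ n ∈ range N, (κ ω).real (A W n) + η / 2 with hg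
  have hgm : ∀ W N, Measurable (g W N) := fun W N =>
    ((Finset.measurable_fun_sum _ fun n _ =>
      measurable_condExpKernel_real hm (hAm W n)).const_mul _).add_const _
  have hg0 : ∀ W N ω, 0 ≤ g W N ω := fun W N ω =>
    add_nonneg (mul_nonneg (by positivity) (sum_nonneg fun _ _ => measureReal_nonneg))
      (half_pos hη).le
  have hgs : ∀ W (N : ℕ), Integrable (fun ω => (N : ℝ)⁻¹ * ∑ n ∈ range N, (κ ω).real (A W n)) μ :=
    fun W N => (integrable_finsetSum _ fun n _ =>
      integrable_condExpKernel_real hm (hAm W n)).const_mul _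
  have hgi : ∀ W N, Integrable (g W N) μ := fun W N => (hgs W N).add (integrable_const _)
  have hgint : ∀ W N, ∫ ω, g W N ω ∂μ = (N : ℝ)⁻¹ * ∑ n ∈ range N, μ.real (A W n) + η / 2 := by
    intro W N
    rw [hg, integral_add (hgs W N) (integrable_const _), integral_const_mul,
      integral_finsetSum _ fun n _ => integrable_condExpKernel_real hm (hAm W n)]
    simp only [integral_condExpKernel_real hm (hAm W _)]
    simp
  set c := μ.real s ^ (k + 1) with hc
  have hgle : ∀ W, ∀ᶠ N : ℕ in atTop, ∫ ω, g W N ω ∂μ ≤ c - η / 4 := fun W => by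
    have h1 : ∀ᶠ N : ℕ in atTop, (N : ℝ)⁻¹ < η / 4 :=
      tendsto_inv_atTop_nhds_zero_nat.eventually_lt_const (by linarith)
    filter_upwards [h1, eventually_ge_atTop 1] with N h1 h2
    have hN : (0 : ℝ) < N := by exact_mod_cast h2
    rw [hgint]
    obtain ⟨M, rfl⟩ : ∃ M, N = M + 1 := ⟨N - 1, by omega⟩
    have h3 : ∑ n ∈ range (M + 1), μ.real (A W n) ≤ (M + 1 : ℕ) * (c - η) + 1 := by
      rw [sum_range_succ']
      have h4 : ∑ n ∈ range M, μ.real (A W (n + 1)) ≤ M * (c - η) := by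
        refine (sum_le_sum fun n _ => (hcon W (n + 1) (by omega)).le).trans ?_
        rw [sum_const, card_range, nsmul_eq_mul]
      have h5 : μ.real (A W 0) ≤ 1 := measureReal_le_one
      have h6 : 0 ≤ c - η := measureReal_nonneg.trans (hcon W 1 le_rfl).le
      push_cast
      linarith
    have h4 : ((M + 1 : ℕ) : ℝ)⁻¹ * ∑ n ∈ range (M + 1), μ.real (A W n) ≤
        c - η + ((M + 1 : ℕ) : ℝ)⁻¹ := by
      rw [inv_mul_le_iff₀ hN, mul_add, mul_inv_cancel₀ hN.ne']
      exact h3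
    linarith
  have hpt : ∀ᵐ ω ∂μ, ENNReal.ofReal ((κ ω).real s ^ (k + 1)) ≤
      liminf (fun W => liminf (fun N => ENNReal.ofReal (g W N ω)) atTop) atTop := by
    filter_upwards [condExpKernel_ergodic hT] with ω hω
    let S := IntAction.ofOne T hzero hadd hTm hω.toMeasurePreserving
    obtain ⟨W₀, hW₀⟩ := S.eventually_le_average hω hk hP hdvd hs (half_pos hη)
    refine le_liminf_of_le (by isBoundedDefault) ?_
    filter_upwards [eventually_ge_atTop W₀] with W hW
    refine le_liminf_of_le (by isBoundedDefault) ?_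
    filter_upwards [hW₀ W hW] with N hN
    exact ENNReal.ofReal_le_ofReal (sub_le_iff_le_add.1 hN)
  have hfat : ∫⁻ ω, liminf (fun W => liminf (fun N => ENNReal.ofReal (g W N ω)) atTop) atTop ∂μ ≤
      ENNReal.ofReal (c - η / 4) := by
    refine (lintegral_liminf_le fun W => Measurable.liminf fun N =>
      (hgm W N).ennreal_ofReal).trans ?_
    refine liminf_le_of_frequently_le' (Eventually.frequently (Eventually.of_forall fun W => ?_))
    refine (lintegral_liminf_le fun N => (hgm W N).ennreal_ofReal).trans ?_
    refine liminf_le_of_frequently_le' (Eventually.frequently ((hgle W).mono fun N hN => ?_))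
    rw [← ofReal_integral_eq_lintegral_ofReal (hgi W N) (Eventually.of_forall (hg0 W N))]
    exact ENNReal.ofReal_le_ofReal hN
  have hκm := measurable_condExpKernel_real (μ := μ) hm hs
  have hjen : c ≤ ∫ ω, (κ ω).real s ^ (k + 1) ∂μ := by
    have := pow_integral_le μ hκm
      (fun _ => measureReal_nonneg) (fun _ => measureReal_le_one) (k + 1)
    rwa [integral_condExpKernel_real hm hs] at this
  have hpow : Integrable (fun ω => (κ ω).real s ^ (k + 1)) μ :=
    Integrable.of_bound (hκm.pow_const _).aestronglyMeasurable 1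
      (Eventually.of_forall fun ω => by
        rw [Real.norm_of_nonneg (pow_nonneg measureReal_nonneg _)]
        exact pow_le_one₀ measureReal_nonneg measureReal_le_one)
  have hfin : ENNReal.ofReal c ≤ ENNReal.ofReal (c - η / 4) := by
    refine (ENNReal.ofReal_le_ofReal hjen).trans (le_trans ?_ hfat)
    rw [ofReal_integral_eq_lintegral_ofReal hpow
      (Eventually.of_forall fun ω => pow_nonneg measureReal_nonneg _)]
    exact lintegral_mono_ae hpt
  have h6 : 0 ≤ c - η := measureReal_nonneg.trans (hcon 0 1 le_rfl).le
  rw [ENNReal.ofReal_le_ofReal_iff (by linarith)] at hfin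
  linarith

end

end PolyConfig

namespace PolyConfig

open Polynomial

theorem exists_eq_mul_X_of_isIntPoly {p : ℤ → ℤ} (hp : IsIntPoly p) (h0 : p 0 = 0) :
    ∃ (D : ℤ) (s : ℤ[X]), D ≠ 0 ∧ ∀ n : ℤ, D * p n = n * s.eval n := by
  obtain ⟨q, hq⟩ := hp
  obtain ⟨D, hD, hDq⟩ := IsLocalization.integerNormalization_spec (nonZeroDivisors ℤ) q
  set r := IsLocalization.integerNormalization (nonZeroDivisors ℤ) q
  have hr : ∀ n : ℤ, r.eval n = D * p n := fun n => by
    have h := congrArg (Polynomial.eval (n : ℚ)) hDq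
    rw [eval_map_algebraMap, ← eq_intCast (algebraMap ℤ ℚ) n,
      aeval_algebraMap_apply_eq_algebraMap_eval,
      eq_intCast, eq_intCast, eval_smul, hq] at h
    simp only [zsmul_eq_mul] at h
    exact_mod_cast h
  have hr0 : r.coeff 0 = 0 := by
    rw [coeff_zero_eq_eval_zero, hr, h0, mul_zero]
  obtain ⟨s, hs⟩ := X_dvd_iff.2 hr0
  refine ⟨D, s, nonZeroDivisors.ne_zero hD, fun n => ?_⟩
  rw [← hr, hs, eval_mul, eval_X]

theorem sum_eq_zero_of_forall_mul {k : ℕ} {p : Fin k → ℤ → ℤ} (hp : ∀ i, IsIntPoly (p i))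
    {d : ℤ} (hd : d ≠ 0) {c : Fin k → ℤ} (h : ∀ n, ∑ i, c i * p i (d * n) = 0) (n : ℤ) :
    ∑ i, c i * p i n = 0 := by
  choose q hq using hp
  have hQ : ∀ n : ℤ, (∑ i, C (c i : ℚ) * q i).eval (n : ℚ) = ((∑ i, c i * p i n : ℤ) : ℚ) :=
    fun n => by
      rw [eval_finsetSum]
      push_cast
      exact sum_congr rfl fun i _ => by rw [eval_mul, eval_C, hq]
  have h0 : ∑ i, C (c i : ℚ) * q i = 0 := by
    refine eq_zero_of_infinite_isRoot _ (Set.Infinite.mono ?_ (Set.infinite_range_of_injective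
      (f := fun n : ℤ => ((d * n : ℤ) : ℚ)) fun a b hab => ?_))
    · rintro _ ⟨n, rfl⟩
      change Polynomial.eval _ _ = 0
      rw [hQ, h, Int.cast_zero]
    · exact mul_left_cancel₀ hd (Int.cast_injective hab)
  have := hQ n
  rw [h0, eval_zero] at this
  exact_mod_cast this.symm

theorem exists_affIndep_reparam {k : ℕ} {p : Fin k → ℤ → ℤ} (hpoly : ∀ i, IsIntPoly (p i))
    (hind : RatIndep p) (hzero : ∀ i, p i 0 = 0) :
    ∃ (P : ℕ → Option (Fin k) → ℤ[X]) (d : ℕ → ℕ), (∀ W, d W ≠ 0) ∧ (∀ W, AffIndep (P W)) ∧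
      (∀ W i n, (W.factorial : ℤ) ∣ (P W i).eval n) ∧ (∀ W, P W none = 0) ∧
      ∀ W i n, (P W (some i)).eval n = p i (d W * n) := by
  choose D s hD hs using fun i => exists_eq_mul_X_of_isIntPoly (hpoly i) (hzero i)
  have hD' : ∏ i, D i ≠ 0 := prod_ne_zero_iff.2 fun i _ => hD i
  set M := (∏ i, D i).natAbs with hM
  have hMD : ∀ i, ∃ E, (M : ℤ) = D i * E := fun i =>
    Int.dvd_natAbs.2 (dvd_prod_of_mem D (mem_univ i))
  choose E hE using hMD
  let R : ℕ → Fin k → ℤ[X] := fun W i =>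
    C (E i * W.factorial) * X * (s i).comp (C ((M * W.factorial : ℕ) : ℤ) * X)
  have hR : ∀ W i n, (R W i).eval n = p i ((M * W.factorial : ℕ) * n) := fun W i n => by
    refine mul_left_cancel₀ (hD i) ?_
    rw [hs]
    simp only [R, eval_mul, eval_C, eval_X, eval_comp]
    push_cast
    rw [hE i]
    ring
  have hd : ∀ W : ℕ, M * W.factorial ≠ 0 := fun W =>
    mul_ne_zero (Int.natAbs_ne_zero.2 hD') W.factorial_ne_zero
  refine ⟨fun W i => i.elim 0 (R W), fun W => M * W.factorial, hd, fun W => ⟨?_, ?_⟩, ?_,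
    fun W => rfl, hR⟩
  · rintro (_ | i)
    · exact coeff_zero 0
    · change (R W i).coeff 0 = 0
      simp [R, mul_coeff_zero]
  · intro c hc0 hc
    have h1 : ∀ n : ℤ, ∑ i, c (some i) * p i ((M * W.factorial : ℕ) * n) = 0 := fun n => by
      have := congrArg (Polynomial.eval n) hc
      rw [eval_finsetSum, Fintype.sum_option] at this
      simpa [eval_smul, hR] using this
    have h2 : (fun i => c (some i)) = 0 := by
      by_contra hne
      exact hind _ hne ⟨0, sum_eq_zero_of_forall_mul hpoly (by exact_mod_cast hd W) h1⟩
    have h3 : ∀ i, c (some i) = 0 := fun i => congrFun h2 i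
    rw [Fintype.sum_option] at hc0
    funext i
    rcases i with _ | i
    · simpa [h3] using hc0
    · exact h3 i
  · rintro W (_ | i) n
    · simp
    · change _ ∣ (R W i).eval n
      simp only [R, eval_mul, eval_C, eval_X]
      exact Dvd.dvd.mul_right (Dvd.dvd.mul_right (Dvd.intro_left _ rfl) _) _

end PolyConfig

namespace PolyConfig

open Topology

/-- The shift action on sequences. -/
def shift (i : ℤ) (x : ℤ → Bool) : ℤ → Bool := fun j => x (j + i)

theorem shift_zero : shift 0 = id := by
  funext x j
  simp [shift]

theorem shift_add (i j : ℤ) : shift (i + j) = shift i ∘ shift j := by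
  funext x l
  simp [shift, add_assoc]

theorem continuous_shift (i : ℤ) : Continuous (shift i) :=
  continuous_pi fun _ => continuous_apply _

section Empirical

variable {Y : Type*} [MeasurableSpace Y]

/-- The uniform measure on finitely many points. -/
noncomputable def empirical (N : ℕ) (w : ℕ → Y) : Measure Y :=
  (N : ENNReal)⁻¹ • ∑ x ∈ range N, Measure.dirac (w x)

theorem isProbabilityMeasure_empirical {N : ℕ} (hN : N ≠ 0) (w : ℕ → Y) :
    IsProbabilityMeasure (empirical N w) := by
  refine ⟨?_⟩
  simp only [empirical, Measure.smul_apply, Measure.finsetSum_apply, measure_univ, sum_const,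
    card_range, nsmul_eq_mul, mul_one, smul_eq_mul]
  exact ENNReal.inv_mul_cancel (by exact_mod_cast hN) (ENNReal.natCast_ne_top N)

open Classical in
theorem empirical_real (N : ℕ) (w : ℕ → Y) {s : Set Y} (hs : MeasurableSet s) :
    (empirical N w).real s = (N : ℝ)⁻¹ * #{x ∈ range N | w x ∈ s} := by
  rw [Measure.real, empirical, Measure.smul_apply, Measure.finsetSum_apply, smul_eq_mul,
    ENNReal.toReal_mul, ENNReal.toReal_inv, ENNReal.toReal_natCast, card_filter]
  congr 1
  have : ∑ x ∈ range N, Measure.dirac (w x) s =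
      ((∑ x ∈ range N, if w x ∈ s then 1 else 0 : ℕ) : ENNReal) := by
    push_cast
    refine sum_congr rfl fun x _ => ?_
    rw [Measure.dirac_apply' _ hs]
    by_cases h : w x ∈ s <;> simp [h]
  rw [this, ENNReal.toReal_natCast]

theorem abs_empirical_preimage_sub_le {T : Y → Y} (hT : Measurable T) (N : ℕ) {w : ℕ → Y}
    (hw : ∀ x, w (x + 1) = T (w x)) {s : Set Y} (hs : MeasurableSet s) :
    |(empirical N w).real (T ⁻¹' s) - (empirical N w).real s| ≤ (N : ℝ)⁻¹ := by
  classical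
  rw [empirical_real N w hs, empirical_real N w (hT hs), ← mul_sub, abs_mul, abs_inv, Nat.abs_cast]
  refine mul_le_of_le_one_right (by positivity) ?_
  rw [card_filter, card_filter]
  push_cast
  let g : ℕ → ℝ := fun x => if w x ∈ s then 1 else 0
  have h1 : ∑ x ∈ range N, (if w x ∈ T ⁻¹' s then (1 : ℝ) else 0) = ∑ x ∈ range N, g (x + 1) :=
    sum_congr rfl fun x _ => by simp only [g, hw, Set.mem_preimage]
  rw [h1, ← sum_sub_distrib, sum_range_sub]
  simp only [g]
  split_ifs <;> simp

end Empirical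

theorem exists_empirical_limit {N : ℕ → ℕ} (hN : Tendsto N atTop atTop) (hN0 : ∀ j, N j ≠ 0)
    (w : ℕ → ℕ → ℤ → Bool) (hw : ∀ j x, w j (x + 1) = shift 1 (w j x)) :
    ∃ (μ : Measure (ℤ → Bool)) (F : Ultrafilter ℕ), IsProbabilityMeasure μ ∧
      (F : Filter ℕ) ≤ atTop ∧ MeasurePreserving (shift 1) μ μ ∧
      ∀ s, IsClopen s → Tendsto (fun j => (empirical (N j) (w j)).real s) F (𝓝 (μ.real s)) := by
  let M : ℕ → ProbabilityMeasure (ℤ → Bool) := fun j =>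
    ⟨empirical (N j) (w j), isProbabilityMeasure_empirical (hN0 j) _⟩
  let F : Ultrafilter ℕ := hyperfilter ℕ
  have hF : (F : Filter ℕ) ≤ atTop := Nat.hyperfilter_le_atTop
  obtain ⟨μ, -, hμ⟩ := isCompact_univ.ultrafilter_le_nhds (F.map M) (by simp)
  have hlim : ∀ s, IsClopen s →
      Tendsto (fun j => (empirical (N j) (w j)).real s) F (𝓝 ((μ : Measure _).real s)) := by
    intro s hs
    have h := ProbabilityMeasure.tendsto_measure_of_isClopen_of_tendsto (L := (F : Filter ℕ))
      (μs := M) (μ := μ) hμ hs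
    exact (NNReal.continuous_coe.tendsto _).comp h
  refine ⟨μ, F, inferInstance, hF, ⟨(continuous_shift 1).measurable, ?_⟩, hlim⟩
  have hm := (continuous_shift 1).measurable
  have : IsProbabilityMeasure ((μ : Measure (ℤ → Bool)).map (shift 1)) :=
    Measure.isProbabilityMeasure_map hm.aemeasurable
  refine ext_of_generate_finite _ generateFrom_measurableCylinders.symm
    isPiSystem_measurableCylinders (fun s hs => ?_) (by simp)
  obtain ⟨t, S, -, rfl⟩ := (mem_measurableCylinders _).1 hs
  have hcl : IsClopen (cylinder t S : Set (ℤ → Bool)) := by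
    refine IsClopen.preimage (isClopen_discrete S) ?_
    exact continuous_pi fun i => continuous_apply _
  have hms : MeasurableSet (cylinder t S : Set (ℤ → Bool)) := hcl.isOpen.measurableSet
  rw [Measure.map_apply hm hms, ← measureReal_eq_measureReal_iff (measure_ne_top _ _)
    (measure_ne_top _ _), ← sub_eq_zero]
  have h1 := (hlim _ (hcl.preimage (continuous_shift 1))).sub (hlim _ hcl)
  refine tendsto_nhds_unique h1 ?_
  refine squeeze_zero_norm (fun j => abs_empirical_preimage_sub_le hm (N j) (hw j) hms) ?_
  exact (tendsto_inv_atTop_nhds_zero_nat.comp hN).mono_left hF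

end PolyConfig

namespace PolyConfig

open Topology

open Classical in
/-- The indicator sequence of a set of natural numbers. -/
noncomputable def indSeq (Λ : Finset ℕ) (l : ℤ) : Bool := decide (∃ y ∈ Λ, (y : ℤ) = l)

open Classical in
theorem card_range_filter_eq {N : ℕ} {Λ : Finset ℕ} (hΛ : Λ ⊆ Icc 1 N) {ι : Type*} (a : ι → ℤ) :
    #((range N).filter fun x : ℕ => shift ((x : ℤ) + 1) (indSeq Λ) ∈
        ⋂ i : Option ι, shift (i.elim 0 a) ⁻¹' {ω | ω 0 = true}) =
      #{x ∈ Λ.image (Nat.cast : ℕ → ℤ) | ∀ i, ∃ y ∈ Λ, (y : ℤ) = x + a i} := by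
  have key : ∀ x : ℕ, shift ((x : ℤ) + 1) (indSeq Λ) ∈
      ⋂ i : Option ι, shift (i.elim 0 a) ⁻¹' {ω | ω 0 = true} ↔
      x + 1 ∈ Λ ∧ ∀ i, ∃ y ∈ Λ, (y : ℤ) = ((x + 1 : ℕ) : ℤ) + a i := fun x => by
    have h : ∀ c : ℤ, shift ((x : ℤ) + 1) (indSeq Λ) ∈ shift c ⁻¹' {ω | ω 0 = true} ↔
        ∃ y ∈ Λ, (y : ℤ) = ((x + 1 : ℕ) : ℤ) + c := fun c => by
      change decide (∃ y ∈ Λ, (y : ℤ) = 0 + c + (x + 1)) = true ↔ _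
      rw [decide_eq_true_iff, zero_add, add_comm c]
      push_cast
      rfl
    rw [Set.mem_iInter, Option.forall]
    refine and_congr ((h 0).trans ⟨?_, fun hx => ⟨x + 1, hx, (add_zero _).symm⟩⟩)
      (forall_congr' fun i => h (a i))
    rintro ⟨y, hy, hyx⟩
    rw [add_zero, Nat.cast_inj] at hyx
    exact hyx ▸ hy
  rw [filter_congr fun x _ => key x, filter_image, card_image_of_injective _ Nat.cast_injective]
  refine card_nbij (· + 1) (fun x hx => ?_) (fun x _ y _ hxy => by simpa using hxy) fun y hy => ?_
  · rw [mem_coe, mem_filter] at hx ⊢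
    exact hx.2
  · have hy' := (mem_filter.1 (mem_coe.1 hy))
    have hyN := mem_Icc.1 (hΛ hy'.1)
    obtain ⟨x, rfl⟩ : ∃ x, y = x + 1 := ⟨y - 1, by omega⟩
    exact ⟨x, mem_coe.2 (mem_filter.2 ⟨mem_range.2 (by omega), hy'⟩), rfl⟩

end PolyConfig

open Classical in
theorem finite_version_many_polynomial_configurations
    (k : ℕ) (p : Fin k → ℤ → ℤ)
    (hpoly : ∀ i, IsIntPoly (p i)) (hind : RatIndep p) (hzero : ∀ i, p i 0 = 0) :
    ∀ δ > (0 : ℝ), ∀ ε > (0 : ℝ), ∃ N₀ : ℕ, ∀ N : ℕ, N₀ < N →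
      ∀ Λ : Finset ℕ, Λ ⊆ Finset.Icc 1 N → δ * N ≤ (Λ.card : ℝ) →
        ∃ n : ℕ, 1 ≤ n ∧
          (1 - ε) * δ ^ (k + 1) * N ≤
            ((Λ.filter (fun x => ∀ i, ∃ y ∈ Λ, (y : ℤ) = (x : ℤ) + p i n)).card : ℝ) := by
  intro δ hδ ε hε
  by_contra! hcon
  choose N hN Λ hΛ hcard hlt using hcon
  have hlt' : ∀ j n, 1 ≤ n → (#{x ∈ (Λ j).image (Nat.cast : ℕ → ℤ) |
      ∀ i, ∃ y ∈ Λ j, (y : ℤ) = x + p i (n : ℕ)} : ℝ) < (1 - ε) * δ ^ (k + 1) * N j := by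
    have himg : ∀ s : Finset ℕ, (do let a ← s; pure (a : ℤ)) = s.image (Nat.cast : ℕ → ℤ) :=
      fun s => by ext; simp
    simpa only [himg] using hlt
  have hN0 : ∀ j, N j ≠ 0 := fun j => by have := hN j; omega
  have hNpos : ∀ j, (0 : ℝ) < N j := fun j => by exact_mod_cast Nat.pos_of_ne_zero (hN0 j)
  obtain ⟨μ, F, hμ, -, hinv, hlim⟩ := PolyConfig.exists_empirical_limit
    (tendsto_atTop_mono (fun j => (hN j).le) tendsto_id) hN0
    (fun j x => PolyConfig.shift ((x : ℤ) + 1) (PolyConfig.indSeq (Λ j))) fun j x => by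
      rw [← Function.comp_apply (f := PolyConfig.shift 1), ← PolyConfig.shift_add]
      push_cast
      rw [add_comm]
  set A : Set (ℤ → Bool) := {ω | ω 0 = true} with hA
  have hAc : IsClopen A :=
    (isClopen_discrete {true}).preimage (continuous_apply (A := fun _ : ℤ => Bool) 0)
  have hAm : MeasurableSet A := hAc.isOpen.measurableSet
  have hcl : ∀ {m : ℕ} (a : Fin m → ℤ),
      IsClopen (⋂ i : Option (Fin m), PolyConfig.shift (i.elim 0 a) ⁻¹' A) := fun a =>
    isClopen_iInter_of_finite fun i => hAc.preimage (PolyConfig.continuous_shift _)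
  have hemp : ∀ {m : ℕ} (a : Fin m → ℤ) (j : ℕ),
      (PolyConfig.empirical (N j) fun x : ℕ =>
        PolyConfig.shift ((x : ℤ) + 1) (PolyConfig.indSeq (Λ j))).real
          (⋂ i : Option (Fin m), PolyConfig.shift (i.elim 0 a) ⁻¹' A) =
        (N j : ℝ)⁻¹ *
          #{x ∈ (Λ j).image (Nat.cast : ℕ → ℤ) | ∀ i, ∃ y ∈ Λ j, (y : ℤ) = x + a i} := fun a j => by
    rw [PolyConfig.empirical_real _ _ (hcl a).isOpen.measurableSet]
    convert congrArg (fun c : ℕ => (N j : ℝ)⁻¹ * c) (PolyConfig.card_range_filter_eq (hΛ j) a)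
  have hdens : δ ≤ μ.real A := by
    have h := hlim _ (hcl (m := 0) Fin.elim0)
    have h0 : (⋂ i : Option (Fin 0), PolyConfig.shift (i.elim 0 Fin.elim0) ⁻¹' A) = A := by
      rw [Set.iInter_option, Set.iInter_of_empty, Set.inter_univ]
      exact congrArg (· ⁻¹' A) PolyConfig.shift_zero
    rw [h0] at h
    refine ge_of_tendsto h (Eventually.of_forall fun j => ?_)
    rw [← h0, hemp, le_inv_mul_iff₀ (hNpos j), mul_comm]
    simpa [card_image_of_injective _ (Nat.cast_injective (R := ℤ))] using hcard j
  obtain ⟨P, d, hd, hP, hdvd, hnone, hsome⟩ :=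
    PolyConfig.exists_affIndep_reparam hpoly hind hzero
  have hη : 0 < ε * δ ^ (k + 1) / 2 := by positivity
  obtain ⟨W, n, hn, hle⟩ := PolyConfig.exists_le_measure_iInter PolyConfig.shift_zero
    PolyConfig.shift_add (fun i => (PolyConfig.continuous_shift i).measurable) hinv
    (by simp : Fintype.card (Option (Fin k)) = k + 1) hP hdvd hAm hη
  have hset : (⋂ i, PolyConfig.shift ((P W i).eval (n : ℤ)) ⁻¹' A) =
      ⋂ i : Option (Fin k), PolyConfig.shift (i.elim 0 fun i => p i (d W * n : ℕ)) ⁻¹' A := by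
    refine Set.iInter_congr fun i => ?_
    rcases i with _ | i
    · rw [hnone, Polynomial.eval_zero]
      rfl
    · rw [hsome]
      push_cast
      rfl
  have hupper : μ.real (⋂ i, PolyConfig.shift ((P W i).eval (n : ℤ)) ⁻¹' A) ≤
      (1 - ε) * δ ^ (k + 1) := by
    rw [hset]
    refine le_of_tendsto (hlim _ (hcl _)) (Eventually.of_forall fun j => ?_)
    rw [hemp, inv_mul_le_iff₀ (hNpos j), mul_comm (N j : ℝ)]
    exact (hlt' j (d W * n) (Nat.mul_pos (Nat.pos_of_ne_zero (hd W)) hn)).le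
  have hpow : δ ^ (k + 1) ≤ μ.real A ^ (k + 1) := pow_le_pow_left₀ hδ.le hdens _
  linarith
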